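/- arXiv:2406.18874 — 2 statements merged into one kernel-verified Lean document; each statement's English description precedes it below -/
import Mathlib

section
/- Let 𝒰 ⊆ U₂ be an open connected subset and let φ : 𝒰 → U₂ satisfy: for all U, V ∈ 𝒰, rank(U − V) ≤ 1 if and only if rank(φ(U) − φ(V)) ≤ 1. Then φ is standard, i.e. there exists an automorphism Φ of U₂ with Φ(U) = φ(U) for every U ∈ 𝒰. -/
open Matrix
open scoped ComplexOrder

noncomputable section

/-- The space of `2×2` complex matrices. -/
abbrev Mat2 : Type := Matrix (Fin 2) (Fin 2) ℂ

/-- The group of `2×2` complex unitary matrices. -/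
abbrev U2 : Type := Matrix.unitaryGroup (Fin 2) ℂ

/-- Coherency for matrices: `A ∼ B` iff `rank (A − B) ≤ 1`. -/
def Coherent (A B : Mat2) : Prop := (A - B).rank ≤ 1

/-- Coherency for unitaries: `U ∼ V` iff `rank (U − V) ≤ 1`. -/
def CoherentU (U V : U2) : Prop := ((U : Mat2) - (V : Mat2)).rank ≤ 1

/-- The Cayley transform, as a matrix: `𝔠(A) = (A − iI)(A + iI)⁻¹`. -/
def cayleyMat (A : Mat2) : Mat2 :=
  (A - Complex.I • (1 : Mat2)) * (A + Complex.I • (1 : Mat2))⁻¹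

open Classical in
/-- The Cayley transform, landing in the unitary group.  For every hermitian `A` the matrix
`cayleyMat A` is unitary, so the junk value `1` is never used for the matrices considered here. -/
def cayley (A : Mat2) : U2 :=
  if h : cayleyMat A ∈ Matrix.unitaryGroup (Fin 2) ℂ then ⟨cayleyMat A, h⟩ else 1

/-- An automorphism of `U₂`: a bijection preserving coherency in both directions. -/
def IsAut (Φ : U2 → U2) : Prop :=
  Function.Bijective Φ ∧ ∀ U V : U2, CoherentU U V ↔ CoherentU (Φ U) (Φ V)

/-- A line in `U₂`: a maximal subset all of whose elements are pairwise coherent. -/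
def IsLine (ℓ : Set U2) : Prop :=
  (∀ U ∈ ℓ, ∀ V ∈ ℓ, CoherentU U V) ∧
  ∀ m : Set U2, ℓ ⊆ m → (∀ U ∈ m, ∀ V ∈ m, CoherentU U V) → m = ℓ

/-- The matrix interval `[A, B] = {X : A ≤ X ≤ B}` (in the Loewner order). -/
def matIcc (A B : Mat2) : Set Mat2 := {X | (X - A).PosSemidef ∧ (B - X).PosSemidef}

/-- Rank one projections: `P = P* = P²` of rank one. -/
def IsProj1 (P : Mat2) : Prop := P.IsHermitian ∧ P * P = P ∧ P.rank = 1

theorem rank_le_one_iff_det_eq_zero (A : Mat2) : A.rank ≤ 1 ↔ A.det = 0 := by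
  constructor
  · intro h
    by_contra hd
    have := rank_of_det_ne_zero hd
    simp at this
    omega
  · intro h
    obtain ⟨v, hv, hAv⟩ := exists_mulVec_eq_zero_iff.mpr h
    have hker : 0 < Module.finrank ℂ (LinearMap.ker A.mulVecLin) := by
      rw [Module.finrank_pos_iff_exists_ne_zero]
      exact ⟨⟨v, by simpa using hAv⟩, by simpa [Subtype.ext_iff] using hv⟩
    have hrn := LinearMap.finrank_range_add_finrank_ker A.mulVecLin
    simp only [Module.finrank_fin_fun] at hrn
    unfold Matrix.rank
    omega

theorem coherentU_iff_det (U V : U2) : CoherentU U V ↔ ((U : Mat2) - V).det = 0 :=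
  rank_le_one_iff_det_eq_zero _

theorem coherentU_comm (U V : U2) : CoherentU U V ↔ CoherentU V U := by
  rw [coherentU_iff_det, coherentU_iff_det, ← neg_sub, det_neg]
  simp

theorem U2.star_mul_self_coe (U : U2) : (U : Mat2)ᴴ * U = 1 :=
  mem_unitaryGroup_iff'.mp U.2

theorem U2.det_ne_zero (U : U2) : (U : Mat2).det ≠ 0 := by
  intro h
  have := congrArg det U.star_mul_self_coe
  simp [h] at this

/-- Coherency in terms of the hermitian form `U* V - 1`. -/
theorem coherentU_iff_det_star_mul (U V : U2) :
    CoherentU U V ↔ ((U : Mat2)ᴴ * V - 1).det = 0 := by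
  have h : (U : Mat2)ᴴ * V - 1 = (U : Mat2)ᴴ * ((V : Mat2) - U) := by
    rw [mul_sub, U.star_mul_self_coe]
  have hU : ((U : Mat2)ᴴ).det ≠ 0 := by
    rw [det_conjTranspose]
    exact star_ne_zero.mpr U.det_ne_zero
  rw [coherentU_comm, coherentU_iff_det, h, det_mul, mul_eq_zero, or_iff_right hU]

theorem IsAut.comp {Φ Ψ : U2 → U2} (hΦ : IsAut Φ) (hΨ : IsAut Ψ) : IsAut (Φ ∘ Ψ) :=
  ⟨hΦ.1.comp hΨ.1, fun U V => (hΨ.2 U V).trans (hΦ.2 _ _)⟩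

theorem isAut_mul_left (A : U2) : IsAut (fun U => A * U) := by
  refine ⟨Group.mulLeft_bijective A, fun U V => ?_⟩
  rw [coherentU_iff_det, coherentU_iff_det]
  simp only [Submonoid.coe_mul, ← mul_sub, det_mul, mul_eq_zero, or_iff_right A.det_ne_zero]

theorem isAut_star : IsAut (fun U => star U) := by
  refine ⟨star_involutive.bijective, fun U V => ?_⟩
  rw [coherentU_iff_det, coherentU_iff_det]
  have h : ((star U : U2) : Mat2) - ((star V : U2) : Mat2) = ((U : Mat2) - (V : Mat2))ᴴ := by
    simp [← star_eq_conjTranspose]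
  rw [h, det_conjTranspose, star_eq_zero]

/-- Transposition of unitary matrices. -/
def transposeU (U : U2) : U2 := ⟨(U : Mat2)ᵀ, by
  rw [mem_unitaryGroup_iff, star_eq_conjTranspose,
    conjTranspose_transpose_eq_transpose_conjTranspose,
    ← transpose_mul, U.star_mul_self_coe, transpose_one]⟩

theorem isAut_transposeU : IsAut transposeU := by
  have hinv : Function.Involutive transposeU := fun U => Subtype.ext (transpose_transpose _)
  refine ⟨hinv.bijective, fun U V => ?_⟩
  rw [coherentU_iff_det, coherentU_iff_det]
  simp only [transposeU, ← transpose_sub, det_transpose]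

theorem IsAut.symm {Φ : U2 → U2} (hΦ : IsAut Φ) :
    ∃ Ψ, IsAut Ψ ∧ Function.LeftInverse Ψ Φ ∧ Function.RightInverse Ψ Φ := by
  let e := Equiv.ofBijective Φ hΦ.1
  have he : ∀ x, Φ (e.symm x) = x := e.apply_symm_apply
  refine ⟨e.symm, ⟨e.symm.bijective, fun U V => ?_⟩, e.symm_apply_apply, he⟩
  rw [hΦ.2 (e.symm U), he, he]

/-- The homogeneous numerator `i S (1 + U) + H S⁻* (1 - U)` of the map of `U₂` induced by
`X ↦ S X S* + H`. -/
def mobNum (S H : Mat2) (U : Mat2) : Mat2 :=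
  Complex.I • (S * (1 + U)) + H * (Sᴴ⁻¹ * (1 - U))

/-- The homogeneous denominator `S⁻* (1 - U)` of the map of `U₂` induced by `X ↦ S X S* + H`. -/
def mobDen (S : Mat2) (U : Mat2) : Mat2 := Sᴴ⁻¹ * (1 - U)

theorem conjTranspose_mul_cayley_pair (T E T' E' : Mat2) :
    (T - Complex.I • E)ᴴ * (T' - Complex.I • E') - (T + Complex.I • E)ᴴ * (T' + Complex.I • E') =
      (2 * Complex.I) • (Eᴴ * T' - Tᴴ * E') := by
  simp only [conjTranspose_sub, conjTranspose_add, conjTranspose_smul, Complex.star_def,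
    Complex.conj_I, sub_mul, add_mul, mul_sub, mul_add, smul_mul_assoc, mul_smul_comm, smul_sub]
  module

theorem mobDen_conjTranspose_mul_mobNum {S H : Mat2} (hS : S.det ≠ 0) (hH : H.IsHermitian)
    (U V : Mat2) :
    (mobDen S U)ᴴ * mobNum S H V - (mobNum S H U)ᴴ * mobDen S V =
      (2 * Complex.I) • (1 - Uᴴ * V) := by
  have h1 : S⁻¹ * S = 1 := nonsing_inv_mul _ (isUnit_iff_ne_zero.mpr hS)
  have h2 : Sᴴ * Sᴴ⁻¹ = 1 := mul_nonsing_inv _ (by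
    rw [det_conjTranspose]; exact isUnit_iff_ne_zero.mpr (star_ne_zero.mpr hS))
  have hinv : (Sᴴ⁻¹)ᴴ = S⁻¹ := by rw [conjTranspose_nonsing_inv, conjTranspose_conjTranspose]
  have e1 : (mobDen S U)ᴴ * mobNum S H V = Complex.I • ((1 - Uᴴ) * (1 + V)) +
      (1 - Uᴴ) * S⁻¹ * H * Sᴴ⁻¹ * (1 - V) := by
    have : (1 - Uᴴ) * (1 + V) = (1 - Uᴴ) * (S⁻¹ * S) * (1 + V) := by rw [h1, mul_one]
    rw [this]
    simp only [mobDen, mobNum, conjTranspose_mul, hinv, conjTranspose_sub, conjTranspose_one,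
      mul_add, mul_smul_comm, mul_assoc]
  have e2 : (mobNum S H U)ᴴ * mobDen S V = -(Complex.I • ((1 + Uᴴ) * (1 - V))) +
      (1 - Uᴴ) * S⁻¹ * H * Sᴴ⁻¹ * (1 - V) := by
    have : (1 + Uᴴ) * (1 - V) = (1 + Uᴴ) * (Sᴴ * Sᴴ⁻¹) * (1 - V) := by rw [h2, mul_one]
    rw [this]
    simp only [mobDen, mobNum, conjTranspose_mul, hinv, conjTranspose_sub, conjTranspose_one,
      conjTranspose_add, conjTranspose_smul, Complex.star_def, Complex.conj_I, hH.eq,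
      add_mul, smul_mul_assoc, mul_assoc, neg_smul, neg_mul]
  rw [e1, e2]
  simp only [mul_add, mul_sub, add_mul, sub_mul, mul_one, one_mul]
  module

theorem mob_hermitian_form {S H : Mat2} (hS : S.det ≠ 0) (hH : H.IsHermitian) (U V : Mat2) :
    (mobNum S H U - Complex.I • mobDen S U)ᴴ * (mobNum S H V - Complex.I • mobDen S V) -
      (mobNum S H U + Complex.I • mobDen S U)ᴴ * (mobNum S H V + Complex.I • mobDen S V) =
      (4 : ℂ) • (Uᴴ * V - 1) := by
  rw [conjTranspose_mul_cayley_pair, mobDen_conjTranspose_mul_mobNum hS hH, smul_smul]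
  have : 2 * Complex.I * (2 * Complex.I) = -4 := by
    linear_combination 4 * Complex.I_mul_I
  rw [this]
  module

theorem det_mobNum_add_ne_zero {S H : Mat2} (hS : S.det ≠ 0) (hH : H.IsHermitian) (U : U2) :
    (mobNum S H U + Complex.I • mobDen S U).det ≠ 0 := by
  intro hdet
  obtain ⟨x, hx, hNx⟩ := exists_mulVec_eq_zero_iff.mpr hdet
  have key := mob_hermitian_form hS hH (U : Mat2) U
  rw [U.star_mul_self_coe, sub_self, smul_zero, sub_eq_zero] at key
  have hMx : (mobNum S H U - Complex.I • mobDen S U) *ᵥ x = 0 := by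
    rw [← conjTranspose_mul_self_mulVec_eq_zero, key, ← mulVec_mulVec, hNx, mulVec_zero]
  have hE : mobDen S (U : Mat2) *ᵥ x = 0 := by
    have h := congrArg₂ (· - ·) hNx hMx
    simp only [← sub_mulVec, sub_zero] at h
    have h2 : mobNum S H (U : Mat2) + Complex.I • mobDen S U -
      (mobNum S H U - Complex.I • mobDen S U) = (2 * Complex.I) • mobDen S U := by module
    rw [h2, smul_mulVec] at h
    simpa using h
  have hT : mobNum S H (U : Mat2) *ᵥ x = 0 := by
    rw [add_mulVec, smul_mulVec, hE, smul_zero, add_zero] at hNx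
    exact hNx
  have hSdet : IsUnit Sᴴ.det := by
    rw [det_conjTranspose]; exact isUnit_iff_ne_zero.mpr (star_ne_zero.mpr hS)
  have h1 : (1 - (U : Mat2)) *ᵥ x = 0 := by
    have := congrArg (Sᴴ *ᵥ ·) hE
    simpa only [mobDen, mulVec_mulVec, ← mul_assoc, mul_nonsing_inv _ hSdet, mulVec_zero,
      one_mul] using this
  have h2 : (1 + (U : Mat2)) *ᵥ x = 0 := by
    have h3 : (S * (1 + (U : Mat2))) *ᵥ x = 0 := by
      have h4 := hT
      rw [mobNum, ← mul_assoc, add_mulVec, smul_mulVec, ← mulVec_mulVec (M := H * Sᴴ⁻¹), h1,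
        mulVec_zero, add_zero] at h4
      simpa using h4
    have := congrArg (S⁻¹ *ᵥ ·) h3
    simpa only [mulVec_mulVec, ← mul_assoc, nonsing_inv_mul _ (isUnit_iff_ne_zero.mpr hS),
      mulVec_zero, one_mul] using this
  apply hx
  have h := congrArg₂ (· + ·) h1 h2
  simp only [← add_mulVec, add_zero] at h
  have h5 : (1 - (U : Mat2)) + (1 + (U : Mat2)) = (2 : ℂ) • 1 := by module
  rw [h5, smul_mulVec, one_mulVec] at h
  simpa using h

/-- The underlying matrix of the map of `U₂` induced by `X ↦ S X S* + H`. -/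
def mobMat (S H : Mat2) (U : Mat2) : Mat2 :=
  (mobNum S H U - Complex.I • mobDen S U) * (mobNum S H U + Complex.I • mobDen S U)⁻¹

theorem mobMat_conjTranspose_mul {S H : Mat2} (hS : S.det ≠ 0) (hH : H.IsHermitian) (U V : U2) :
    (mobMat S H U)ᴴ * mobMat S H V - 1 =
      ((mobNum S H U + Complex.I • mobDen S U)⁻¹)ᴴ * ((4 : ℂ) • ((U : Mat2)ᴴ * V - 1)) *
        (mobNum S H V + Complex.I • mobDen S V)⁻¹ := by
  rw [← mob_hermitian_form hS hH, mobMat, mobMat]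
  have hU := det_mobNum_add_ne_zero hS hH U
  have hV := det_mobNum_add_ne_zero hS hH V
  set A := mobNum S H (U : Mat2) + Complex.I • mobDen S U
  set B := mobNum S H (V : Mat2) + Complex.I • mobDen S V
  set C := mobNum S H (U : Mat2) - Complex.I • mobDen S U
  set D := mobNum S H (V : Mat2) - Complex.I • mobDen S V
  clear_value C D
  have hA : (A⁻¹)ᴴ * Aᴴ = 1 := by
    rw [← conjTranspose_mul, mul_nonsing_inv _ (isUnit_iff_ne_zero.mpr hU), conjTranspose_one]
  have hB : B * B⁻¹ = 1 := mul_nonsing_inv _ (isUnit_iff_ne_zero.mpr hV)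
  rw [mul_sub, sub_mul]
  have : (A⁻¹)ᴴ * (Aᴴ * B) * B⁻¹ = 1 := by
    rw [← mul_assoc, hA, one_mul, hB]
  rw [this, conjTranspose_mul]
  simp only [mul_assoc]

theorem mobMat_mem {S H : Mat2} (hS : S.det ≠ 0) (hH : H.IsHermitian) (U : U2) :
    mobMat S H U ∈ unitaryGroup (Fin 2) ℂ := by
  rw [mem_unitaryGroup_iff', star_eq_conjTranspose, ← sub_eq_zero,
    mobMat_conjTranspose_mul hS hH, U.star_mul_self_coe]
  simp

/-- `mobMat S⁻¹ (-S⁻¹ H S⁻*)` inverts `mobMat S H`. -/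
theorem mobMat_inverse {S H : Mat2} (hS : S.det ≠ 0) (hH : H.IsHermitian) (U : U2) :
    mobMat S⁻¹ (-(S⁻¹ * H * Sᴴ⁻¹)) (mobMat S H U) = U := by
  have hN := det_mobNum_add_ne_zero hS hH U
  have hSu : IsUnit S.det := isUnit_iff_ne_zero.mpr hS
  have hSHu : IsUnit Sᴴ.det := by
    rw [det_conjTranspose]; exact isUnit_iff_ne_zero.mpr (star_ne_zero.mpr hS)
  set T := mobNum S H (U : Mat2) with hT
  set E := mobDen S (U : Mat2) with hE
  set A := T + Complex.I • E with hA
  have hAA : A * A⁻¹ = 1 := mul_nonsing_inv _ (isUnit_iff_ne_zero.mpr hN)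
  have hW : mobMat S H U = (T - Complex.I • E) * A⁻¹ := rfl
  have hp : 1 + mobMat S H U = (2 : ℂ) • (T * A⁻¹) := by
    rw [hW, ← hAA, ← add_mul, hA, ← smul_mul_assoc]
    congr 1
    module
  have hm : 1 - mobMat S H U = (2 * Complex.I) • (E * A⁻¹) := by
    rw [hW, ← hAA, ← sub_mul, hA, ← smul_mul_assoc]
    congr 1
    module
  have hden : mobDen S⁻¹ (mobMat S H U) = (2 * Complex.I) • ((1 - (U : Mat2)) * A⁻¹) := by
    rw [mobDen, hm, conjTranspose_nonsing_inv, nonsing_inv_nonsing_inv _ hSHu, hE, mobDen,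
      mul_smul_comm, ← mul_assoc, ← mul_assoc, mul_nonsing_inv _ hSHu, one_mul]
  have hnum : mobNum S⁻¹ (-(S⁻¹ * H * Sᴴ⁻¹)) (mobMat S H U) =
      (2 * Complex.I) • ((Complex.I • (1 + (U : Mat2))) * A⁻¹) := by
    rw [mobNum, ← mobDen, hden, hp, hT, mobNum]
    have e1 : S⁻¹ * ((2 : ℂ) • ((Complex.I • (S * (1 + (U : Mat2))) +
        H * (Sᴴ⁻¹ * (1 - (U : Mat2)))) * A⁻¹)) =
        (2 : ℂ) • (Complex.I • (S⁻¹ * S * (1 + (U : Mat2)) * A⁻¹) +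
          S⁻¹ * H * Sᴴ⁻¹ * (1 - (U : Mat2)) * A⁻¹) := by
      simp only [mul_smul_comm, add_mul, mul_add, smul_mul_assoc, mul_assoc]
    rw [e1, nonsing_inv_mul _ hSu, one_mul]
    simp only [mul_smul_comm, neg_mul, smul_mul_assoc, mul_assoc]
    module
  have e3 : mobNum S⁻¹ (-(S⁻¹ * H * Sᴴ⁻¹)) (mobMat S H U) - Complex.I • mobDen S⁻¹ (mobMat S H U)
      = U * ((-4 : ℂ) • A⁻¹) := by
    rw [hnum, hden, mul_smul_comm, smul_mul_assoc, add_mul, sub_mul]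
    have : (-4 : ℂ) = 4 * (Complex.I * Complex.I) := by rw [Complex.I_mul_I]; ring
    rw [this]
    module
  have e4 : mobNum S⁻¹ (-(S⁻¹ * H * Sᴴ⁻¹)) (mobMat S H U) + Complex.I • mobDen S⁻¹ (mobMat S H U)
      = (-4 : ℂ) • A⁻¹ := by
    rw [hnum, hden, smul_mul_assoc, add_mul, sub_mul, one_mul]
    have : (-4 : ℂ) = 4 * (Complex.I * Complex.I) := by rw [Complex.I_mul_I]; ring
    rw [this]
    module
  rw [mobMat, e3, e4, mul_assoc, mul_nonsing_inv, mul_one]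
  rw [det_smul, det_nonsing_inv]
  simpa using hN

/-- The automorphism of `U₂` induced by `X ↦ S X S* + H`. -/
def mob (S H : Mat2) (hS : S.det ≠ 0) (hH : H.IsHermitian) (U : U2) : U2 :=
  ⟨mobMat S H U, mobMat_mem hS hH U⟩

theorem isAut_mob {S H : Mat2} (hS : S.det ≠ 0) (hH : H.IsHermitian) : IsAut (mob S H hS hH) := by
  have hS' : S⁻¹.det ≠ 0 := by
    rw [det_nonsing_inv]; simpa using hS
  have hH' : (-(S⁻¹ * H * Sᴴ⁻¹)).IsHermitian := by
    rw [← conjTranspose_nonsing_inv]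
    exact (isHermitian_mul_mul_conjTranspose _ hH).neg
  have hSHu : IsUnit Sᴴ.det := by
    rw [det_conjTranspose]; exact isUnit_iff_ne_zero.mpr (star_ne_zero.mpr hS)
  have hleft : Function.LeftInverse (mob _ _ hS' hH') (mob S H hS hH) :=
    fun U => Subtype.ext (mobMat_inverse hS hH U)
  have hHH : -(S⁻¹⁻¹ * (-(S⁻¹ * H * Sᴴ⁻¹)) * (S⁻¹)ᴴ⁻¹) = H := by
    have hSu : IsUnit S.det := isUnit_iff_ne_zero.mpr hS
    rw [conjTranspose_nonsing_inv, nonsing_inv_nonsing_inv _ hSu, nonsing_inv_nonsing_inv _ hSHu]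
    rw [mul_neg, neg_mul, neg_neg, ← mul_assoc, ← mul_assoc, mul_nonsing_inv _ hSu, one_mul,
      mul_assoc, nonsing_inv_mul _ hSHu, mul_one]
  have hright : Function.RightInverse (mob _ _ hS' hH') (mob S H hS hH) := by
    intro U
    have h := mobMat_inverse hS' hH' U
    rw [hHH, nonsing_inv_nonsing_inv _ (isUnit_iff_ne_zero.mpr hS)] at h
    exact Subtype.ext h
  refine ⟨⟨hleft.injective, hright.surjective⟩, fun U V => ?_⟩
  rw [coherentU_iff_det_star_mul, coherentU_iff_det_star_mul]
  simp only [mob, mobMat_conjTranspose_mul hS hH, det_mul, det_smul, det_conjTranspose,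
    det_nonsing_inv]
  simp [det_mobNum_add_ne_zero hS hH]

theorem det_add_I_ne_zero {X : Mat2} (hX : X.IsHermitian) :
    (X + Complex.I • (1 : Mat2)).det ≠ 0 := by
  intro h
  have h00 := hX.apply 0 0
  have h11 := hX.apply 1 1
  have h01 := hX.apply 0 1
  rw [det_fin_two] at h
  simp only [Matrix.add_apply, Matrix.smul_apply, one_apply, smul_eq_mul] at h
  rw [← h01] at h
  simp only [Complex.ext_iff, Complex.star_def] at h h00 h11
  simp at h h00 h11
  obtain ⟨h1, h2⟩ := h
  have a0 : (X 0 0).im = 0 := by linarith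
  have a1 : (X 1 1).im = 0 := by linarith
  rw [a0, a1] at h1 h2
  have e : (X 0 0).re = -(X 1 1).re := by linarith
  rw [e] at h1
  nlinarith [sq_nonneg (X 1 1).re, sq_nonneg (X 1 0).re, sq_nonneg (X 1 0).im]

theorem cayleyMat_eq {X : Mat2} (hX : X.IsHermitian) :
    cayleyMat X = 1 - (2 * Complex.I) • (X + Complex.I • (1 : Mat2))⁻¹ := by
  have hA := mul_nonsing_inv _ (isUnit_iff_ne_zero.mpr (det_add_I_ne_zero hX))
  have h : X - Complex.I • (1 : Mat2) =
      (X + Complex.I • (1 : Mat2)) - (2 * Complex.I) • (1 : Mat2) := by module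
  rw [cayleyMat, h, sub_mul, hA, smul_mul_assoc, one_mul]

theorem cayleyMat_mem {X : Mat2} (hX : X.IsHermitian) :
    cayleyMat X ∈ unitaryGroup (Fin 2) ℂ := by
  have hA := mul_nonsing_inv _ (isUnit_iff_ne_zero.mpr (det_add_I_ne_zero hX))
  have hAH : (X + Complex.I • (1 : Mat2))ᴴ = X + Complex.I • (1 : Mat2) -
      (2 * Complex.I) • (1 : Mat2) := by
    rw [conjTranspose_add, hX.eq, conjTranspose_smul, conjTranspose_one, Complex.star_def,
      Complex.conj_I]
    module
  rw [mem_unitaryGroup_iff', star_eq_conjTranspose, cayleyMat_eq hX]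
  set A := X + Complex.I • (1 : Mat2)
  have h1 : (A⁻¹)ᴴ * Aᴴ = 1 := by rw [← conjTranspose_mul, hA, conjTranspose_one]
  have h2 : (A⁻¹)ᴴ - A⁻¹ = (2 * Complex.I) • ((A⁻¹)ᴴ * A⁻¹) := by
    have e2 : (A⁻¹)ᴴ * Aᴴ * A⁻¹ = A⁻¹ := by rw [h1, one_mul]
    rw [hAH, mul_sub, sub_mul, mul_smul_comm, mul_one, smul_mul_assoc, mul_assoc, hA,
      mul_one] at e2
    rw [sub_eq_iff_eq_add] at e2 ⊢
    exact e2.trans (add_comm _ _)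
  rw [conjTranspose_sub, conjTranspose_smul, conjTranspose_one]
  have h3 : star (2 * Complex.I) = -(2 * Complex.I) := by simp
  rw [h3, sub_mul, mul_sub, mul_sub, smul_mul_smul_comm, mul_one, one_mul, mul_one]
  have h4 : -(2 * Complex.I) * (2 * Complex.I) = -((2 * Complex.I) * (2 * Complex.I)) := by ring
  have h5 : (-((2 * Complex.I) * (2 * Complex.I))) • ((A⁻¹)ᴴ * A⁻¹) =
      -((2 * Complex.I) • ((A⁻¹)ᴴ - A⁻¹)) := by rw [h2]; module
  rw [h4, h5]
  module

theorem coe_cayley_eq_cayleyMat {X : Mat2} (hX : X.IsHermitian) :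
    (cayley X : Mat2) = cayleyMat X := by
  rw [cayley, dif_pos (cayleyMat_mem hX)]

theorem coe_cayley {X : Mat2} (hX : X.IsHermitian) :
    (cayley X : Mat2) = 1 - (2 * Complex.I) • (X + Complex.I • (1 : Mat2))⁻¹ := by
  rw [coe_cayley_eq_cayleyMat hX, cayleyMat_eq hX]

theorem cayley_coherentU_iff {X Y : Mat2} (hX : X.IsHermitian) (hY : Y.IsHermitian) :
    CoherentU (cayley X) (cayley Y) ↔ (X - Y).det = 0 := by
  rw [coherentU_iff_det, coe_cayley hX, coe_cayley hY]
  have hdX := det_add_I_ne_zero hX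
  have hdY := det_add_I_ne_zero hY
  have hA := nonsing_inv_mul _ (isUnit_iff_ne_zero.mpr hdX)
  have hB := mul_nonsing_inv _ (isUnit_iff_ne_zero.mpr hdY)
  have hXY : X - Y = (X + Complex.I • (1 : Mat2)) - (Y + Complex.I • (1 : Mat2)) := by module
  rw [hXY]
  set A := X + Complex.I • (1 : Mat2)
  set B := Y + Complex.I • (1 : Mat2)
  have h : (1 - (2 * Complex.I) • A⁻¹) - (1 - (2 * Complex.I) • B⁻¹) =
      (2 * Complex.I) • (A⁻¹ * (A - B) * B⁻¹) := by
    rw [mul_sub, sub_mul, hA, one_mul, mul_assoc, hB, mul_one]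
    module
  rw [h, det_smul, det_mul, det_mul, det_nonsing_inv, det_nonsing_inv]
  simp [hdX, hdY]

theorem cayley_not_coherentU_one {X : Mat2} (hX : X.IsHermitian) : ¬ CoherentU (cayley X) 1 := by
  rw [coherentU_iff_det, coe_cayley hX]
  have h : (1 - (2 * Complex.I) • (X + Complex.I • (1 : Mat2))⁻¹) - ((1 : U2) : Mat2) =
      (-(2 * Complex.I)) • (X + Complex.I • (1 : Mat2))⁻¹ := by
    rw [OneMemClass.coe_one]; module
  rw [h, det_smul, det_nonsing_inv]
  simp [det_add_I_ne_zero hX]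

theorem U2.sub_one_relation (V : U2) :
    ((V : Mat2) - 1) + ((V : Mat2) - 1)ᴴ + ((V : Mat2) - 1)ᴴ * ((V : Mat2) - 1) = 0 := by
  rw [conjTranspose_sub, conjTranspose_one, sub_mul, mul_sub, V.star_mul_self_coe, mul_one, one_mul]
  abel

/-- The inverse Cayley transform. -/
def cayleyInv (V : Mat2) : Mat2 :=
  -(Complex.I • (1 : Mat2)) - (2 * Complex.I) • (V - 1)⁻¹

theorem cayleyInv_isHermitian {V : U2} (hV : ¬ CoherentU V 1) :
    (cayleyInv (V : Mat2)).IsHermitian := by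
  rw [coherentU_iff_det, OneMemClass.coe_one] at hV
  have rel := V.sub_one_relation
  have hN := mul_nonsing_inv _ (isUnit_iff_ne_zero.mpr hV)
  rw [IsHermitian, cayleyInv]
  set N := (V : Mat2) - 1
  have hN' : (N⁻¹)ᴴ * Nᴴ = 1 := by rw [← conjTranspose_mul, hN, conjTranspose_one]
  have h : (N⁻¹)ᴴ + N⁻¹ + 1 = 0 := by
    have e := congrArg (fun M => (N⁻¹)ᴴ * M * N⁻¹) rel
    simp only [mul_add, add_mul, mul_zero, zero_mul] at e
    rw [mul_assoc, hN, mul_one, hN', one_mul, ← mul_assoc, hN', one_mul, hN] at e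
    exact e
  have h5 : (N⁻¹)ᴴ = -N⁻¹ - 1 := by
    rw [← sub_eq_zero, ← h]; abel
  have h3 : star (2 * Complex.I) = -(2 * Complex.I) := by simp
  rw [conjTranspose_sub, conjTranspose_neg, conjTranspose_smul, conjTranspose_smul,
    conjTranspose_one, h5, h3, Complex.star_def, Complex.conj_I]
  module

theorem cayley_cayleyInv {V : U2} (hV : ¬ CoherentU V 1) : cayley (cayleyInv (V : Mat2)) = V := by
  apply Subtype.ext
  rw [coe_cayley (cayleyInv_isHermitian hV), cayleyInv]
  rw [coherentU_iff_det, OneMemClass.coe_one] at hV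
  have hN := nonsing_inv_mul _ (isUnit_iff_ne_zero.mpr hV)
  have h : -(Complex.I • (1 : Mat2)) - (2 * Complex.I) • ((V : Mat2) - 1)⁻¹ +
      Complex.I • (1 : Mat2) = (-(2 * Complex.I)) • ((V : Mat2) - 1)⁻¹ := by module
  have hinv : ((-(2 * Complex.I)) • ((V : Mat2) - 1)⁻¹)⁻¹ =
      (-(2 * Complex.I))⁻¹ • ((V : Mat2) - 1) := by
    apply inv_eq_left_inv
    rw [smul_mul_smul_comm, mul_nonsing_inv _ (isUnit_iff_ne_zero.mpr hV), inv_mul_cancel₀,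
      one_smul]
    simp
  rw [h, hinv, smul_smul]
  have : 2 * Complex.I * (-(2 * Complex.I))⁻¹ = -1 := by
    rw [inv_neg, mul_neg, mul_inv_cancel₀ (by simp)]
  rw [this]
  module

theorem cayley_injective {X Y : Mat2} (hX : X.IsHermitian) (hY : Y.IsHermitian)
    (h : cayley X = cayley Y) : X = Y := by
  have h1 : (cayley X : Mat2) = cayley Y := by rw [h]
  rw [coe_cayley hX, coe_cayley hY, sub_right_inj] at h1
  have h2 := smul_right_injective Mat2 (r := 2 * Complex.I) (by simp) h1
  have h3 := congrArg (·⁻¹) h2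
  simp only [nonsing_inv_nonsing_inv _ (isUnit_iff_ne_zero.mpr (det_add_I_ne_zero hX)),
    nonsing_inv_nonsing_inv _ (isUnit_iff_ne_zero.mpr (det_add_I_ne_zero hY))] at h3
  exact add_right_cancel h3

theorem cayley_transpose {X : Mat2} (hX : X.IsHermitian) :
    cayley Xᵀ = transposeU (cayley X) := by
  apply Subtype.ext
  change _ = (cayley X : Mat2)ᵀ
  rw [coe_cayley hX, coe_cayley (isHermitian_transpose_iff.mpr hX), transpose_sub,
    transpose_smul, transpose_nonsing_inv, transpose_add, transpose_smul, transpose_one]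

theorem cayley_neg {X : Mat2} (hX : X.IsHermitian) : cayley (-X) = star (cayley X) := by
  apply Subtype.ext
  have h3 : star (2 * Complex.I) = -(2 * Complex.I) := by simp
  have h4 : -X + Complex.I • (1 : Mat2) = -(X + Complex.I • (1 : Mat2))ᴴ := by
    rw [conjTranspose_add, hX.eq, conjTranspose_smul, conjTranspose_one, Complex.star_def,
      Complex.conj_I]
    module
  have h5 : (-(X + Complex.I • (1 : Mat2))ᴴ)⁻¹ = -((X + Complex.I • (1 : Mat2))⁻¹)ᴴ := by
    apply inv_eq_left_inv
    rw [neg_mul_neg, ← conjTranspose_mul,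
      mul_nonsing_inv _ (isUnit_iff_ne_zero.mpr (det_add_I_ne_zero hX)), conjTranspose_one]
  rw [coe_cayley hX.neg, Unitary.coe_star, coe_cayley hX, star_eq_conjTranspose, conjTranspose_sub,
    conjTranspose_smul, conjTranspose_one, h3, h4, h5]
  module

theorem mob_cayley {S H X : Mat2} (hS : S.det ≠ 0) (hH : H.IsHermitian) (hX : X.IsHermitian) :
    mob S H hS hH (cayley X) = cayley (S * X * Sᴴ + H) := by
  have hY : (S * X * Sᴴ + H).IsHermitian := (isHermitian_mul_mul_conjTranspose _ hX).add hH
  apply Subtype.ext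
  have hSHu : IsUnit Sᴴ.det := by
    rw [det_conjTranspose]; exact isUnit_iff_ne_zero.mpr (star_ne_zero.mpr hS)
  have hSS := mul_nonsing_inv _ hSHu
  have hdet := det_mobNum_add_ne_zero hS hH (cayley X)
  have hdY := det_add_I_ne_zero hY
  rw [coe_cayley_eq_cayleyMat hY]
  change mobMat S H (cayley X : Mat2) = _
  rw [mobMat]
  have hA := mul_nonsing_inv _ (isUnit_iff_ne_zero.mpr (det_add_I_ne_zero hX))
  have hden : mobDen S (cayley X : Mat2) =
      (2 * Complex.I) • (Sᴴ⁻¹ * (X + Complex.I • (1 : Mat2))⁻¹) := by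
    rw [mobDen, coe_cayley hX, sub_sub_cancel, mul_smul_comm]
  have hnum : mobNum S H (cayley X : Mat2) =
      (2 * Complex.I) • ((S * X * Sᴴ + H) * (Sᴴ⁻¹ * (X + Complex.I • (1 : Mat2))⁻¹)) := by
    rw [mobNum, ← mobDen, hden, coe_cayley hX]
    have e : (1 : Mat2) + (1 - (2 * Complex.I) • (X + Complex.I • (1 : Mat2))⁻¹) =
        (2 : ℂ) • (X * (X + Complex.I • (1 : Mat2))⁻¹) := by
      have e2 : X = (X + Complex.I • (1 : Mat2)) - Complex.I • (1 : Mat2) := by module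
      conv_rhs => rw [e2, sub_add_cancel, sub_mul, hA, smul_mul_assoc, one_mul]
      module
    rw [e, add_mul, mul_assoc (S * X), ← mul_assoc Sᴴ, hSS, one_mul]
    simp only [mul_smul_comm, mul_assoc]
    module
  set Y := S * X * Sᴴ + H
  set C := Sᴴ⁻¹ * (X + Complex.I • (1 : Mat2))⁻¹
  clear_value Y
  have hm : mobNum S H (cayley X : Mat2) - Complex.I • mobDen S (cayley X : Mat2) =
      (Y - Complex.I • (1 : Mat2)) * ((2 * Complex.I) • C) := by
    rw [hnum, hden, sub_mul, smul_mul_assoc, one_mul, mul_smul_comm]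
  have hp : mobNum S H (cayley X : Mat2) + Complex.I • mobDen S (cayley X : Mat2) =
      (Y + Complex.I • (1 : Mat2)) * ((2 * Complex.I) • C) := by
    rw [hnum, hden, add_mul, smul_mul_assoc, one_mul, mul_smul_comm]
  rw [hp, det_mul] at hdet
  rw [hp, hm, Matrix.mul_inv_rev, mul_assoc, ← mul_assoc ((2 * Complex.I) • C), mul_nonsing_inv _
    (isUnit_iff_ne_zero.mpr (right_ne_zero_of_mul hdet)), one_mul, cayleyMat]

/-- The rank one matrix `v v*`. -/
def outer (v : Fin 2 → ℂ) : Mat2 := vecMulVec v (star v)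

/-- The determinant of the matrix with columns `v` and `w`. -/
def cross (v w : Fin 2 → ℂ) : ℂ := v 0 * w 1 - v 1 * w 0

/-- A vector orthogonal to `v`. -/
def perp (v : Fin 2 → ℂ) : Fin 2 → ℂ := ![-star (v 1), star (v 0)]

/-- The quadratic form `q* X q`. -/
def qform (X : Mat2) (q : Fin 2 → ℂ) : ℂ := star q ⬝ᵥ (X *ᵥ q)

theorem outer_apply (v : Fin 2 → ℂ) (i j : Fin 2) : outer v i j = v i * star (v j) := rfl

theorem outer_isHermitian (v : Fin 2 → ℂ) : (outer v).IsHermitian :=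
  (posSemidef_vecMulVec_self_star v).1

theorem outer_posSemidef (v : Fin 2 → ℂ) : (outer v).PosSemidef :=
  posSemidef_vecMulVec_self_star v

theorem outer_smul (a : ℂ) (v : Fin 2 → ℂ) : outer (a • v) = (a * star a) • outer v := by
  ext i j
  simp only [outer_apply, Pi.smul_apply, Matrix.smul_apply, smul_eq_mul, star_mul']
  ring

theorem det_smul_outer_add (a b : ℂ) (v w : Fin 2 → ℂ) :
    (a • outer v + b • outer w).det = a * b * (cross v w * star (cross v w)) := by
  rw [det_fin_two]
  simp only [outer_apply, Matrix.smul_apply, Matrix.add_apply, smul_eq_mul, cross, star_sub,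
    star_mul']
  ring

theorem det_outer (v : Fin 2 → ℂ) : (outer v).det = 0 := by
  simpa using det_smul_outer_add 1 0 v v

theorem outer_ne_zero {v : Fin 2 → ℂ} (hv : v ≠ 0) : outer v ≠ 0 := by
  intro h
  apply hv
  ext i
  have := congrFun (congrFun h i) i
  rw [outer_apply, Matrix.zero_apply, mul_eq_zero, star_eq_zero, or_self] at this
  exact this

theorem exists_smul_of_cross_eq_zero {v w : Fin 2 → ℂ} (hv : v ≠ 0) (h : cross v w = 0) :
    ∃ a : ℂ, w = a • v := by
  unfold cross at h
  by_cases h0 : v 0 = 0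
  · have h1 : v 1 ≠ 0 := fun h1 => hv (by ext i; fin_cases i <;> assumption)
    refine ⟨w 1 / v 1, ?_⟩
    have hw : w 0 = 0 := by simpa [h0, h1] using h
    ext i
    fin_cases i
    · simp [h0, hw]
    · simp [h1]
  · refine ⟨w 0 / v 0, ?_⟩
    ext i
    fin_cases i
    · simp [h0]
    · simp only [Fin.mk_one, Pi.smul_apply, smul_eq_mul]
      field_simp
      linear_combination h

theorem perp_ne_zero {v : Fin 2 → ℂ} (hv : v ≠ 0) : perp v ≠ 0 := by
  intro h
  apply hv
  have h0 := congrFun h 0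
  have h1 := congrFun h 1
  simp [perp] at h0 h1
  ext i; fin_cases i <;> assumption

theorem cross_perp_perp (v w : Fin 2 → ℂ) : cross (perp v) (perp w) = star (cross v w) := by
  simp [cross, perp]
  ring

theorem exists_smul_perp {q z : Fin 2 → ℂ} (hq : q ≠ 0) (h : star q ⬝ᵥ z = 0) :
    ∃ a : ℂ, z = a • perp q := by
  apply exists_smul_of_cross_eq_zero (perp_ne_zero hq)
  simp [dotProduct, Fin.sum_univ_two] at h
  simp [cross, perp]
  linear_combination -h

theorem qform_eq (X : Mat2) (q : Fin 2 → ℂ) :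
    qform X q = star (q 0) * (X 0 0 * q 0 + X 0 1 * q 1) +
      star (q 1) * (X 1 0 * q 0 + X 1 1 * q 1) := by
  simp [qform, dotProduct, mulVec, Fin.sum_univ_two]

theorem qform_add (X Y : Mat2) (q : Fin 2 → ℂ) : qform (X + Y) q = qform X q + qform Y q := by
  simp only [qform_eq, Matrix.add_apply]
  ring

theorem qform_sub (X Y : Mat2) (q : Fin 2 → ℂ) : qform (X - Y) q = qform X q - qform Y q := by
  simp only [qform_eq, Matrix.sub_apply]
  ring

theorem qform_smul (a : ℂ) (X : Mat2) (q : Fin 2 → ℂ) : qform (a • X) q = a * qform X q := by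
  simp only [qform_eq, Matrix.smul_apply, smul_eq_mul]
  ring

theorem qform_outer (v q : Fin 2 → ℂ) :
    qform (outer v) q = (star q ⬝ᵥ v) * star (star q ⬝ᵥ v) := by
  simp only [qform_eq, outer_apply, dotProduct, Fin.sum_univ_two, Pi.star_apply, star_add,
    star_mul', star_star]
  ring

theorem qform_outer_perp (v : Fin 2 → ℂ) : qform (outer v) (perp v) = 0 := by
  have : star (perp v) ⬝ᵥ v = 0 := by
    simp [dotProduct, perp, Fin.sum_univ_two]; ring
  rw [qform_outer, this, zero_mul]

theorem qform_eq_ofReal {X : Mat2} (hX : X.IsHermitian) (q : Fin 2 → ℂ) :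
    qform X q = ((qform X q).re : ℂ) := by
  refine (Complex.conj_eq_iff_re.mp ?_).symm
  have h00 := hX.apply 0 0
  have h11 := hX.apply 1 1
  have h01 := hX.apply 0 1
  have h10 := hX.apply 1 0
  rw [Complex.star_def] at h00 h11 h01 h10
  simp only [qform_eq, map_add, map_mul, Complex.star_def, Complex.conj_conj, h00, h11, h01, h10]
  ring

/-- The squared length of a vector. -/
def lenSq (q : Fin 2 → ℂ) : ℝ := Complex.normSq (q 0) + Complex.normSq (q 1)

theorem lenSq_pos {q : Fin 2 → ℂ} (hq : q ≠ 0) : 0 < lenSq q := by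
  have h0 := Complex.normSq_nonneg (q 0)
  have h1 := Complex.normSq_nonneg (q 1)
  refine lt_of_le_of_ne (add_nonneg h0 h1) fun h => hq ?_
  have e0 : q 0 = 0 := Complex.normSq_eq_zero.mp (by unfold lenSq at h; linarith)
  have e1 : q 1 = 0 := Complex.normSq_eq_zero.mp (by unfold lenSq at h; linarith)
  ext i; fin_cases i <;> assumption

theorem qform_one (q : Fin 2 → ℂ) : qform 1 q = (lenSq q : ℂ) := by
  simp [qform_eq, lenSq, Complex.normSq_eq_conj_mul_self]

theorem outer_mul_outer_self (q : Fin 2 → ℂ) : outer q * outer q = (lenSq q : ℂ) • outer q := by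
  ext i j
  simp only [mul_apply, Fin.sum_univ_two, outer_apply, Matrix.smul_apply, lenSq, smul_eq_mul,
    Complex.ofReal_add, Complex.normSq_eq_conj_mul_self, Complex.star_def]
  ring

/-- A hermitian singular matrix is a real multiple of some `z z*`. -/
theorem exists_outer_of_det_eq_zero {Z : Mat2} (hZ : Z.IsHermitian) (hd : Z.det = 0) :
    ∃ (s : ℝ) (z : Fin 2 → ℂ), Z = (s : ℂ) • outer z := by
  have h00 : ((Z 0 0).re : ℂ) = Z 0 0 := Complex.conj_eq_iff_re.mp (hZ.apply 0 0)
  have h11 : ((Z 1 1).re : ℂ) = Z 1 1 := Complex.conj_eq_iff_re.mp (hZ.apply 1 1)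
  have h01 := hZ.apply 0 1
  have h10 := hZ.apply 1 0
  rw [det_fin_two] at hd
  by_cases h : Z 0 0 = 0
  · have hb : Z 1 0 = 0 := by
      rw [← h01, h, zero_mul, zero_sub, neg_eq_zero, mul_eq_zero, star_eq_zero, or_self] at hd
      exact hd
    have hb' : Z 0 1 = 0 := by rw [← h01, hb, star_zero]
    refine ⟨(Z 1 1).re, ![0, 1], ?_⟩
    ext i j
    fin_cases i <;> fin_cases j <;> simp [outer_apply, h, hb, hb', h11]
  · refine ⟨((Z 0 0).re)⁻¹, ![Z 0 0, Z 1 0], ?_⟩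
    have hc : star (Z 0 0) = Z 0 0 := hZ.apply 0 0
    ext i j
    rw [Complex.ofReal_inv, h00]
    rw [Complex.star_def] at hc h01 h10
    fin_cases i <;> fin_cases j <;> simp [outer_apply, hc, h01, h]
    · rw [eq_inv_mul_iff_mul_eq₀ h, mul_comm]
    · rw [eq_inv_mul_iff_mul_eq₀ h]
      linear_combination hd

/-- A hermitian singular matrix isotropic for `q` is a real multiple of `q⊥ q⊥*`. -/
theorem exists_outer_perp {Z : Mat2} (hZ : Z.IsHermitian) (hd : Z.det = 0) {q : Fin 2 → ℂ}
    (hq : q ≠ 0) (h : qform Z q = 0) : ∃ t : ℝ, Z = (t : ℂ) • outer (perp q) := by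
  obtain ⟨s, z, rfl⟩ := exists_outer_of_det_eq_zero hZ hd
  rw [qform_smul, qform_outer, mul_eq_zero, mul_eq_zero, star_eq_zero, or_self] at h
  rcases h with h | h
  · exact ⟨0, by simp [h]⟩
  · obtain ⟨a, rfl⟩ := exists_smul_perp hq h
    refine ⟨s * Complex.normSq a, ?_⟩
    rw [outer_smul, smul_smul, Complex.ofReal_mul, Complex.normSq_eq_conj_mul_self,
      Complex.star_def, mul_comm a]

/-- A unitary coherent with, and different from, the identity differs from it by a multiple of
some `q q*`. -/
theorem U2.exists_outer_of_coherent_one {W : U2} (hW : CoherentU W 1) (hne : W ≠ 1) :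
    ∃ (n : ℂ) (q : Fin 2 → ℂ), n ≠ 0 ∧ q ≠ 0 ∧ (W : Mat2) = 1 + n • outer q := by
  rw [coherentU_iff_det, OneMemClass.coe_one] at hW
  have rel := W.sub_one_relation
  have hN : (W : Mat2) - 1 ≠ 0 := fun h => hne (Subtype.ext (sub_eq_zero.mp h))
  suffices h : ∃ (n : ℂ) (q : Fin 2 → ℂ), q ≠ 0 ∧ (W : Mat2) - 1 = n • outer q by
    obtain ⟨n, q, hq, h⟩ := h
    refine ⟨n, q, ?_, hq, by rw [← h]; abel⟩
    rintro rfl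
    exact hN (by simpa using h)
  set N := (W : Mat2) - 1
  obtain ⟨v, hv, hNv⟩ := exists_mulVec_eq_zero_iff.mpr hW
  have hNHv : Nᴴ *ᵥ v = 0 := by
    have := congrArg (· *ᵥ v) rel
    simpa only [add_mulVec, ← mulVec_mulVec, hNv, mulVec_zero, add_zero, zero_add,
      zero_mulVec] using this
  have hcol : ∀ j, star v ⬝ᵥ (fun i => N i j) = 0 := by
    intro j
    have := congrArg star (congrFun hNHv j)
    simp only [mulVec, dotProduct, conjTranspose_apply, Fin.sum_univ_two, star_add, star_mul',
      star_star, Pi.zero_apply, star_zero, Pi.star_apply] at this ⊢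
    linear_combination this
  choose l hl using fun j => exists_smul_perp hv (hcol j)
  have hp := perp_ne_zero hv
  have hlv : l 0 * v 0 + l 1 * v 1 = 0 := by
    obtain ⟨i, hi⟩ := Function.ne_iff.mp hp
    have e := congrFun hNv i
    have e0 := congrFun (hl 0) i
    have e1 := congrFun (hl 1) i
    simp only [mulVec, dotProduct, Fin.sum_univ_two, Pi.zero_apply, Pi.smul_apply,
      smul_eq_mul] at e e0 e1 hi
    rw [e0, e1] at e
    apply mul_right_cancel₀ hi
    linear_combination e
  obtain ⟨m, hm⟩ := exists_smul_perp hv (z := star l) (by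
    have := congrArg star hlv
    simp only [star_add, star_mul', star_zero] at this
    simp only [dotProduct, Fin.sum_univ_two, Pi.star_apply]
    linear_combination this)
  refine ⟨star m, perp v, hp, ?_⟩
  ext i j
  have e := congrFun (hl j) i
  have e2 := congrArg star (congrFun hm j)
  simp only [Pi.star_apply, star_star, Pi.smul_apply, smul_eq_mul, star_mul'] at e e2
  rw [e, e2, Matrix.smul_apply, outer_apply, smul_eq_mul]
  ring

/-- Coherency of a finite point with a point `1 + n q q*` at infinity. -/
theorem cayley_coherentU_iff_of_outer {Y : Mat2} (hY : Y.IsHermitian) {W : U2} {n : ℂ}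
    {q : Fin 2 → ℂ} (hW : (W : Mat2) = 1 + n • outer q) :
    CoherentU (cayley Y) W ↔
      2 * Complex.I + n * (qform Y q + Complex.I * lenSq q) = 0 := by
  rw [coherentU_iff_det, coe_cayley hY, hW]
  have hd := det_add_I_ne_zero hY
  have hA := mul_nonsing_inv _ (isUnit_iff_ne_zero.mpr hd)
  have hq : qform Y q + Complex.I * lenSq q = qform (Y + Complex.I • (1 : Mat2)) q := by
    rw [qform_add, qform_smul, qform_one]
  rw [hq]
  set A := Y + Complex.I • (1 : Mat2)
  have h : A * ((1 - (2 * Complex.I) • A⁻¹) - (1 + n • outer q)) =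
      -((2 * Complex.I) • (1 : Mat2) + n • (A * outer q)) := by
    rw [← hA, ← mul_smul_comm, ← mul_smul_comm, ← mul_add, ← mul_neg]
    congr 1
    abel
  have hdet : ((2 * Complex.I) • (1 : Mat2) + n • (A * outer q)).det =
      2 * Complex.I * (2 * Complex.I + n * qform A q) := by
    rw [det_fin_two]
    simp [mul_apply, Fin.sum_univ_two, outer_apply, qform_eq]
    ring
  have h2 := congrArg det h
  rw [det_mul, det_neg, hdet] at h2
  constructor
  · intro h3
    rw [h3] at h2
    simpa using h2.symm
  · intro h3
    rw [h3] at h2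
    simpa [hd] using h2

/-- The point at infinity of the null hyperplane `q* X q = x`. -/
def infPoint (q : Fin 2 → ℂ) (x : ℝ) : U2 :=
  ⟨1 + (-(2 * Complex.I) / (x + Complex.I * lenSq q)) • outer q, by
    rw [mem_unitaryGroup_iff', star_eq_conjTranspose]
    by_cases hq : q = 0
    · have : outer q = 0 := by ext i j; simp [outer_apply, hq]
      simp [this]
    have hm := lenSq_pos hq
    have hm0 : (x : ℂ) + Complex.I * lenSq q ≠ 0 := by
      intro h
      have := congrArg Complex.im h
      simp at this
      linarith
    have hm1 : (x : ℂ) - Complex.I * lenSq q ≠ 0 := by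
      intro h
      have := congrArg Complex.im h
      simp at this
      linarith
    rw [conjTranspose_add, conjTranspose_one, conjTranspose_smul, (outer_isHermitian q).eq,
      add_mul, mul_add, mul_add, smul_mul_smul_comm, outer_mul_outer_self, smul_smul, mul_one,
      one_mul, mul_one, add_assoc, ← add_smul, ← add_smul]
    convert add_zero (1 : Mat2)
    rw [smul_eq_zero]
    left
    simp only [Complex.star_def, map_div₀, map_add, map_mul, map_neg, Complex.conj_I,
      Complex.conj_ofReal, map_ofNat]
    rw [neg_mul, ← sub_eq_add_neg]
    field_simp
    ring⟩

theorem coe_infPoint (q : Fin 2 → ℂ) (x : ℝ) : (infPoint q x : Mat2) =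
    1 + (-(2 * Complex.I) / (x + Complex.I * lenSq q)) • outer q := rfl

theorem infPoint_coeff_ne_zero {q : Fin 2 → ℂ} (hq : q ≠ 0) (x : ℝ) :
    (x : ℂ) + Complex.I * lenSq q ≠ 0 := by
  intro h
  have := congrArg Complex.im h
  simp at this
  linarith [lenSq_pos hq]

theorem infPoint_coherentU_one (q : Fin 2 → ℂ) (x : ℝ) : CoherentU (infPoint q x) 1 := by
  rw [coherentU_iff_det, coe_infPoint, OneMemClass.coe_one, add_sub_cancel_left, det_smul,
    det_outer, mul_zero]

theorem infPoint_coherentU_infPoint {q r : Fin 2 → ℂ} (hq : q ≠ 0) (hr : r ≠ 0) (x y : ℝ) :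
    CoherentU (infPoint q x) (infPoint r y) ↔ cross q r = 0 := by
  rw [coherentU_iff_det, coe_infPoint, coe_infPoint, add_sub_add_left_eq_sub, sub_eq_add_neg,
    ← neg_smul, det_smul_outer_add]
  simp [infPoint_coeff_ne_zero hq, infPoint_coeff_ne_zero hr]

theorem cayley_coherentU_infPoint {Y : Mat2} (hY : Y.IsHermitian) {q : Fin 2 → ℂ} (hq : q ≠ 0)
    (x : ℝ) : CoherentU (cayley Y) (infPoint q x) ↔ qform Y q = x := by
  rw [cayley_coherentU_iff_of_outer hY (coe_infPoint q x)]
  have := infPoint_coeff_ne_zero hq x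
  field_simp
  constructor
  · intro h
    have h2 : 2 * Complex.I * (x - qform Y q) = 0 := by linear_combination h
    simp at h2
    linear_combination -h2
  · intro h
    rw [h]
    ring

/-- A positive semidefinite `2×2` matrix is a sum of two matrices of the form `v v*`. -/
theorem Matrix.PosSemidef.exists_outer_add_outer {A : Mat2} (hA : A.PosSemidef) :
    ∃ v w : Fin 2 → ℂ, A = outer v + outer w := by
  obtain ⟨B, rfl⟩ : ∃ B : Mat2, A = Bᴴ * B := by
    open scoped MatrixOrder in
    exact CStarAlgebra.nonneg_iff_eq_star_mul_self.mp hA.nonneg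
  refine ⟨fun i => star (B 0 i), fun i => star (B 1 i), ?_⟩
  ext i j
  simp only [mul_apply, Fin.sum_univ_two, Matrix.add_apply, outer_apply, conjTranspose_apply,
    star_star]

theorem cross_perp_self (v : Fin 2 → ℂ) : cross v (perp v) = lenSq v := by
  simp [cross, perp, lenSq, Complex.normSq_eq_conj_mul_self]
  ring

theorem ne_zero_of_cross_ne_zero {v w : Fin 2 → ℂ} (h : cross v w ≠ 0) : v ≠ 0 := by
  rintro rfl
  simp [cross] at h

theorem eq_zero_of_smul_outer_add {v w : Fin 2 → ℂ} (h : cross v w ≠ 0) {a b : ℂ}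
    (hab : a • outer v + b • outer w = 0) : a = 0 := by
  have hd := det_smul_outer_add a b v w
  rw [hab, det_zero] at hd
  rcases mul_eq_zero.mp hd.symm with h1 | h1
  · rcases mul_eq_zero.mp h1 with h2 | h2
    · exact h2
    · rw [h2, zero_smul, add_zero, smul_eq_zero] at hab
      exact hab.resolve_right (outer_ne_zero (ne_zero_of_cross_ne_zero h))
  · simp [h] at h1

theorem outer_add_outer_half (w u : Fin 2 → ℂ) :
    outer w + outer u = outer (((Real.sqrt 2 : ℂ)⁻¹) • (w + u)) +
      outer (((Real.sqrt 2 : ℂ)⁻¹) • (w - u)) := by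
  have h : (Real.sqrt 2 : ℂ)⁻¹ * star ((Real.sqrt 2 : ℂ)⁻¹) = 2⁻¹ := by
    rw [Complex.star_def, map_inv₀, Complex.conj_ofReal, ← mul_inv, ← Complex.ofReal_mul,
      Real.mul_self_sqrt (by norm_num)]
    norm_num
  rw [outer_smul, outer_smul, h]
  ext i j
  simp only [Matrix.add_apply, Matrix.smul_apply, outer_apply, Pi.add_apply, Pi.sub_apply,
    star_add, star_sub, smul_eq_mul]
  ring

/-- A map on the positive cone which maps each rank one direction into a rank one direction is
additive up to a translation. -/
theorem additive_of_directions {ψ : Mat2 → Mat2} {p : (Fin 2 → ℂ) → (Fin 2 → ℂ)}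
    (h1 : ∀ v ≠ 0, ∀ A : Mat2, A.PosSemidef →
      ∃ s : ℂ, ψ (A + outer v) - ψ A = s • outer (p v))
    (h2 : ∀ v w, cross v w ≠ 0 → cross (p v) (p w) ≠ 0) {A B : Mat2} (hA : A.PosSemidef)
    (hB : B.PosSemidef) : ψ (A + B) - ψ A = ψ B - ψ 0 := by
  have key : ∀ v w, cross v w ≠ 0 → ∀ X : Mat2, X.PosSemidef →
      ψ (X + outer w + outer v) - ψ (X + outer w) = ψ (X + outer v) - ψ X := by
    intro v w hvw X hX
    have hv := ne_zero_of_cross_ne_zero hvw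
    have hw : w ≠ 0 := by rintro rfl; simp [cross] at hvw
    obtain ⟨s1, e1⟩ := h1 v hv X hX
    obtain ⟨s2, e2⟩ := h1 w hw (X + outer v) (hX.add (outer_posSemidef v))
    obtain ⟨s3, e3⟩ := h1 w hw X hX
    obtain ⟨s4, e4⟩ := h1 v hv (X + outer w) (hX.add (outer_posSemidef w))
    rw [add_right_comm] at e2
    have := eq_zero_of_smul_outer_add (h2 v w hvw) (a := s1 - s4) (b := s2 - s3) (by
      rw [sub_smul, sub_smul, ← e1, ← e2, ← e3, ← e4]
      abel)
    rw [e1, e4, sub_eq_zero.mp this]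
  have key2 : ∀ v w, ∀ X : Mat2, X.PosSemidef →
      ψ (X + outer w + outer v) - ψ (X + outer w) = ψ (X + outer v) - ψ X := by
    intro v w X hX
    by_cases hv : v = 0
    · have : outer v = 0 := by ext i j; simp [outer_apply, hv]
      simp [this]
    by_cases hvw : cross v w = 0
    · obtain ⟨a, rfl⟩ := exists_smul_of_cross_eq_zero hv hvw
      have hl : (lenSq v : ℂ) ≠ 0 := by exact_mod_cast (lenSq_pos hv).ne'
      have hu : cross v (perp v) ≠ 0 := by rwa [cross_perp_self]
      have hs : (Real.sqrt 2 : ℂ) ≠ 0 := by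
        exact_mod_cast (Real.sqrt_pos.mpr (by norm_num : (0 : ℝ) < 2)).ne'
      have ha : cross v (((Real.sqrt 2 : ℂ)⁻¹) • (a • v + perp v)) ≠ 0 := by
        have : cross v (((Real.sqrt 2 : ℂ)⁻¹) • (a • v + perp v)) =
            (Real.sqrt 2 : ℂ)⁻¹ * cross v (perp v) := by
          simp only [cross, Pi.smul_apply, Pi.add_apply, smul_eq_mul]; ring
        rw [this]
        exact mul_ne_zero (inv_ne_zero hs) hu
      have hb : cross v (((Real.sqrt 2 : ℂ)⁻¹) • (a • v - perp v)) ≠ 0 := by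
        have : cross v (((Real.sqrt 2 : ℂ)⁻¹) • (a • v - perp v)) =
            -((Real.sqrt 2 : ℂ)⁻¹ * cross v (perp v)) := by
          simp only [cross, Pi.smul_apply, Pi.sub_apply, smul_eq_mul]; ring
        rw [this]
        exact neg_ne_zero.mpr (mul_ne_zero (inv_ne_zero hs) hu)
      rw [← key v _ hu _ (hX.add (outer_posSemidef _)), add_assoc X, outer_add_outer_half,
        ← add_assoc X, key v _ hb _ (hX.add (outer_posSemidef _)), key v _ ha _ hX]
    · exact key v w hvw X hX
  have key3 : ∀ v, ∀ X B : Mat2, X.PosSemidef → B.PosSemidef →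
      ψ (X + B + outer v) - ψ (X + B) = ψ (X + outer v) - ψ X := by
    intro v X B hX hB
    obtain ⟨b, c, rfl⟩ := hB.exists_outer_add_outer
    rw [← add_assoc X, key2 _ _ _ (hX.add (outer_posSemidef _)), key2 _ _ _ hX]
  obtain ⟨b, c, rfl⟩ := hB.exists_outer_add_outer
  have e1 := key3 b 0 A PosSemidef.zero hA
  have e2 := key3 c 0 (A + outer b) PosSemidef.zero (hA.add (outer_posSemidef _))
  have e3 := key3 c 0 (outer b) PosSemidef.zero (outer_posSemidef _)
  simp only [zero_add] at e1 e2 e3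
  rw [← add_assoc A]
  calc _ = (ψ (A + outer b + outer c) - ψ (A + outer b)) + (ψ (A + outer b) - ψ A) := by abel
    _ = (ψ (outer b + outer c) - ψ (outer b)) + (ψ (outer b) - ψ 0) := by rw [e2, e3, e1]
    _ = _ := by abel

theorem eq_of_triple_identity {f₁ f₂ g₁ g₂ : ℝ →+ ℝ} (hf₁ : ∀ t, f₁ t = 0 → t = 0)
    (hf₂ : ∀ t, f₂ t = 0 → t = 0)
    (h : ∀ a b c : ℝ, a * c = b * b →
      (f₁ (a - b) + g₁ b) * (f₂ (c - b) + g₂ b) = g₁ b * g₂ b) (t : ℝ) :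
    g₁ t = f₁ t ∧ g₂ t = f₂ t := by
  by_cases ht : t = 0
  · simp [ht]
  have e1 := h t (-t) t (by ring)
  have e2 := h t (t + t) (t + t + (t + t)) (by ring)
  simp only [map_sub, map_add, map_neg] at e1 e2
  have h1 : f₁ t * (g₂ t - f₂ t) = 0 := by linarith
  have h2 : f₂ t * (g₁ t - f₁ t) = 0 := by linarith
  have n1 : f₁ t ≠ 0 := fun h => ht (hf₁ t h)
  have n2 : f₂ t ≠ 0 := fun h => ht (hf₂ t h)
  exact ⟨sub_eq_zero.mp ((mul_eq_zero.mp h2).resolve_left n2),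
    sub_eq_zero.mp ((mul_eq_zero.mp h1).resolve_left n1)⟩

theorem eq_mul_of_sq_identity {f : ℝ →+ ℝ} (h1 : f 1 ≠ 0)
    (h : ∀ b, f (b * b) * f 1 = f b * f b) (t : ℝ) : f t = f 1 * t := by
  have hmul : ∀ a b, f (a * b) * f 1 = f a * f b := by
    intro a b
    have e := h (a + b)
    have e1 := h a
    have e2 := h b
    rw [show (a + b) * (a + b) = a * a + b * b + (a * b + a * b) by ring] at e
    simp only [map_add] at e
    linarith
  let g : ℝ →+* ℝ :=
    { toFun := fun t => f t / f 1
      map_one' := div_self h1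
      map_zero' := by simp
      map_add' := fun a b => by simp [add_div]
      map_mul' := fun a b => by
        have := hmul a b
        field_simp
        linarith }
  have hg : g t = t := by rw [Subsingleton.elim g (RingHom.id ℝ)]; rfl
  have hg' : f t / f 1 = t := hg
  field_simp at hg'
  linarith

theorem isHermitian_decomposition {Z : Mat2} (hZ : Z.IsHermitian) :
    ∃ a d x y : ℝ, Z = (a : ℂ) • outer ![1, 0] + (d : ℂ) • outer ![0, 1] +
      (x : ℂ) • outer ![1, 1] + (y : ℂ) • outer ![1, -Complex.I] := by
  have h00 : ((Z 0 0).re : ℂ) = Z 0 0 := Complex.conj_eq_iff_re.mp (hZ.apply 0 0)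
  have h11 : ((Z 1 1).re : ℂ) = Z 1 1 := Complex.conj_eq_iff_re.mp (hZ.apply 1 1)
  have h01 : star (Z 0 1) = Z 1 0 := hZ.apply 1 0
  have e := Complex.re_add_im (Z 0 1)
  refine ⟨(Z 0 0).re - (Z 0 1).re - (Z 0 1).im, (Z 1 1).re - (Z 0 1).re - (Z 0 1).im,
    (Z 0 1).re, (Z 0 1).im, ?_⟩
  have e' : Z 1 0 = (Z 0 1).re - (Z 0 1).im * Complex.I := by
    rw [← h01]
    apply Complex.ext <;> simp
  ext i j
  fin_cases i <;> fin_cases j <;> simp [outer_apply, h00, h11]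
  · ring
  · linear_combination e'
  · ring

/-- A map on hermitian matrices which is additive, preserves singularity in both directions and
acts on four rank one directions in a normalized way is a multiple of the identity or of the
transpose. -/
theorem eq_smul_or_transpose_of_normalized {M : Mat2 → Mat2}
    (hadd : ∀ Z W : Mat2, Z.IsHermitian → W.IsHermitian → M (Z + W) = M Z + M W)
    (hdet : ∀ Z : Mat2, Z.IsHermitian → (Z.det = 0 ↔ (M Z).det = 0))
    {f₁ f₂ f₃ f₄ : ℝ → ℝ} {u : Fin 2 → ℂ}
    (h₁ : ∀ t : ℝ, M ((t : ℂ) • outer ![1, 0]) = (f₁ t : ℂ) • outer ![1, 0])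
    (h₂ : ∀ t : ℝ, M ((t : ℂ) • outer ![0, 1]) = (f₂ t : ℂ) • outer ![0, 1])
    (h₃ : ∀ t : ℝ, M ((t : ℂ) • outer ![1, 1]) = (f₃ t : ℂ) • outer ![1, 1])
    (h₄ : ∀ t : ℝ, M ((t : ℂ) • outer ![1, -Complex.I]) = (f₄ t : ℂ) • outer u) (hu : u ≠ 0) :
    ∃ c : ℝ, c ≠ 0 ∧ ((∀ Z : Mat2, Z.IsHermitian → M Z = (c : ℂ) • Z) ∨
      (∀ Z : Mat2, Z.IsHermitian → M Z = (c : ℂ) • Zᵀ)) := by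
  have hherm : ∀ (t : ℝ) (v : Fin 2 → ℂ), ((t : ℂ) • outer v).IsHermitian := fun t v => by
    rw [IsHermitian, conjTranspose_smul, (outer_isHermitian v).eq, Complex.star_def,
      Complex.conj_ofReal]
  have hcomb : ∀ a d x y : ℝ, M ((a : ℂ) • outer ![1, 0] + (d : ℂ) • outer ![0, 1] +
      (x : ℂ) • outer ![1, 1] + (y : ℂ) • outer ![1, -Complex.I]) =
      (f₁ a : ℂ) • outer ![1, 0] + (f₂ d : ℂ) • outer ![0, 1] +
      (f₃ x : ℂ) • outer ![1, 1] + (f₄ y : ℂ) • outer u := by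
    intro a d x y
    rw [hadd _ _ (((hherm _ _).add (hherm _ _)).add (hherm _ _)) (hherm _ _),
      hadd _ _ ((hherm _ _).add (hherm _ _)) (hherm _ _), hadd _ _ (hherm _ _) (hherm _ _),
      h₁, h₂, h₃, h₄]
  have hadditive : ∀ (f : ℝ → ℝ) (v w : Fin 2 → ℂ), w ≠ 0 →
      (∀ t : ℝ, M ((t : ℂ) • outer v) = (f t : ℂ) • outer w) → ∀ s t, f (s + t) = f s + f t := by
    intro f v w hw h s t
    have e := hadd _ _ (hherm s v) (hherm t v)
    rw [← add_smul, ← Complex.ofReal_add, h, h, h, ← add_smul] at e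
    exact_mod_cast smul_left_injective ℂ (outer_ne_zero hw) e
  have ne10 : (![1, 0] : Fin 2 → ℂ) ≠ 0 := fun h => by simpa using congrFun h 0
  have ne01 : (![0, 1] : Fin 2 → ℂ) ≠ 0 := fun h => by simpa using congrFun h 1
  have ne11 : (![1, 1] : Fin 2 → ℂ) ≠ 0 := fun h => by simpa using congrFun h 1
  let F₁ : ℝ →+ ℝ := AddMonoidHom.mk' f₁ (hadditive f₁ _ _ ne10 h₁)
  let F₂ : ℝ →+ ℝ := AddMonoidHom.mk' f₂ (hadditive f₂ _ _ ne01 h₂)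
  let F₃ : ℝ →+ ℝ := AddMonoidHom.mk' f₃ (hadditive f₃ _ _ ne11 h₃)
  let F₄ : ℝ →+ ℝ := AddMonoidHom.mk' f₄ (hadditive f₄ _ _ hu h₄)
  have z₃ : f₃ 0 = 0 := F₃.map_zero
  have z₄ : f₄ 0 = 0 := F₄.map_zero
  have hd : ∀ a d x y : ℝ, (a + x + y) * (d + x + y) = x * x + y * y ↔
      (f₁ a + f₃ x + f₄ y * Complex.normSq (u 0)) * (f₂ d + f₃ x + f₄ y * Complex.normSq (u 1)) =
      Complex.normSq (f₃ x + f₄ y * (u 0 * star (u 1))) := by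
    intro a d x y
    have := hdet _ ((((hherm a ![1, 0]).add (hherm d ![0, 1])).add (hherm x ![1, 1])).add
      (hherm y ![1, -Complex.I]))
    rw [hcomb, det_fin_two, det_fin_two, sub_eq_zero, sub_eq_zero] at this
    simp only [outer_apply, Matrix.add_apply, Matrix.smul_apply, smul_eq_mul] at this
    simp at this
    rw [← @Complex.ofReal_inj, ← @Complex.ofReal_inj _ (Complex.normSq _)]
    push_cast
    simp only [Complex.normSq_eq_conj_mul_self, map_add, map_mul, Complex.star_def,
      Complex.conj_conj, Complex.conj_ofReal]
    convert this using 2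
    · linear_combination ((y : ℂ) ^ 2) * Complex.I_mul_I
    · ring
    · ring
  have nz₁ : ∀ t, f₁ t = 0 → t = 0 := fun t h => by
    simpa [z₃, z₄, h] using (hd t 1 0 0).mpr (by simp [z₃, z₄, h])
  have nz₂ : ∀ t, f₂ t = 0 → t = 0 := fun t h => by
    simpa [z₃, z₄, h] using (hd 1 t 0 0).mpr (by simp [z₃, z₄, h])
  have tri := eq_of_triple_identity (f₁ := F₁) (f₂ := F₂) (g₁ := F₃) (g₂ := F₃) nz₁ nz₂
    (fun a b c h => by
      have := (hd (a - b) (c - b) b 0).mp (by linarith)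
      simp only [z₄, zero_mul, add_zero, Complex.ofReal_zero, Complex.normSq_ofReal] at this
      exact this)
  have e₃ : ∀ t, f₃ t = f₁ t := fun t => (tri t).1
  have e₂ : ∀ t, f₂ t = f₁ t := fun t => by rw [← e₃]; exact (tri t).2.symm
  set c := f₁ 1 with hc
  have hc0 : c ≠ 0 := fun h => one_ne_zero (nz₁ 1 h)
  have lin : ∀ t, f₁ t = c * t := eq_mul_of_sq_identity (f := F₁) hc0 (fun b => by
    have := (hd (b * b - b) (1 - b) b 0).mp (by ring)
    have m1 : f₁ (b * b - b) = f₁ (b * b) - f₁ b := F₁.map_sub _ _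
    have m2 : f₁ (1 - b) = f₁ 1 - f₁ b := F₁.map_sub _ _
    change f₁ (b * b) * f₁ 1 = f₁ b * f₁ b
    simpa [z₄, Complex.normSq_ofReal, e₃, e₂, m1, m2] using this)
  set n₀ := Complex.normSq (u 0) with hn₀
  set n₁ := Complex.normSq (u 1) with hn₁
  have tri2 := eq_of_triple_identity (f₁ := F₁) (f₂ := F₁)
    (g₁ := (AddMonoidHom.mulRight n₀).comp F₄) (g₂ := (AddMonoidHom.mulRight n₁).comp F₄) nz₁ nz₁
    (fun a b c h => by
      have := (hd (a - b) (c - b) 0 b).mp (by linarith)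
      simp only [z₃, e₂, add_zero, Complex.ofReal_zero, zero_add, Complex.normSq_mul,
        Complex.normSq_ofReal, Complex.star_def, Complex.normSq_conj, ← hn₀, ← hn₁] at this
      refine this.trans ?_
      change f₄ b * f₄ b * (n₀ * n₁) = f₄ b * n₀ * (f₄ b * n₁)
      ring)
  have k₀ : ∀ t, f₄ t * n₀ = c * t := fun t => (tri2 t).1.trans (lin t)
  have k₁ : ∀ t, f₄ t * n₁ = c * t := fun t => (tri2 t).2.trans (lin t)
  have hn0 : n₀ ≠ 0 := fun h => hc0 (by simpa [h] using (k₀ 1).symm)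
  have hf40 : f₄ 1 ≠ 0 := fun h => hc0 (by simpa [h] using (k₀ 1).symm)
  have hn01 : n₁ = n₀ := mul_left_cancel₀ hf40 ((k₁ 1).trans (k₀ 1).symm)
  obtain ⟨w, hw⟩ : ∃ w : ℂ, u 0 * star (u 1) = n₀ * w :=
    ⟨u 0 * star (u 1) / n₀, by
      have : (n₀ : ℂ) ≠ 0 := by exact_mod_cast hn0
      field_simp⟩
  have hw1 : Complex.normSq w = 1 := by
    have := congrArg Complex.normSq hw
    rw [Complex.normSq_mul, Complex.normSq_mul, Complex.normSq_ofReal, Complex.star_def,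
      Complex.normSq_conj, ← hn₀, ← hn₁, hn01] at this
    exact (mul_left_cancel₀ (mul_ne_zero hn0 hn0) (by linarith)).symm
  have f4w : ∀ t : ℝ, (f₄ t : ℂ) * (u 0 * star (u 1)) = c * t * w := fun t => by
    rw [hw, ← mul_assoc, ← Complex.ofReal_mul, k₀, Complex.ofReal_mul]
  have hre : w.re = 0 := by
    have := (hd (-2) (-2) 3 4).mp (by norm_num)
    rw [f4w, k₀, k₁, e₃, e₂, lin, lin] at this
    rw [Complex.normSq_apply] at this hw1
    simp at this
    have h2 : c * c * (24 * w.re) = 0 := by linear_combination -this - 16 * c ^ 2 * hw1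
    simpa [hc0] using h2
  have hI : w = Complex.I ∨ w = -Complex.I := by
    rw [Complex.normSq_apply, hre, zero_mul, zero_add] at hw1
    rcases mul_self_eq_one_iff.mp hw1 with h | h
    · left; apply Complex.ext <;> simp [h, hre]
    · right; apply Complex.ext <;> simp [h, hre]
  have hout : ∀ t : ℝ, (f₄ t : ℂ) • outer u = (c * t : ℂ) • !![1, w; star w, 1] := by
    intro t
    have a0 : (f₄ t : ℂ) * (u 0 * star (u 0)) = c * t := by
      rw [Complex.star_def, Complex.mul_conj, ← hn₀]
      exact_mod_cast k₀ t
    have a1 : (f₄ t : ℂ) * (u 1 * star (u 1)) = c * t := by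
      rw [Complex.star_def, Complex.mul_conj, ← hn₁]
      exact_mod_cast k₁ t
    have a2 : (f₄ t : ℂ) * (u 1 * star (u 0)) = c * t * star w := by
      have := congrArg star (f4w t)
      simp only [star_mul', Complex.star_def, Complex.conj_ofReal, Complex.conj_conj] at this ⊢
      rw [← this]
      ring
    ext i j
    fin_cases i <;> fin_cases j
    · simpa [outer_apply] using a0
    · simpa [outer_apply] using f4w t
    · simpa [outer_apply] using a2
    · simpa [outer_apply] using a1
  refine ⟨c, hc0, ?_⟩
  rcases hI with rfl | rfl
  · left
    intro Z hZ
    obtain ⟨a, d, x, y, rfl⟩ := isHermitian_decomposition hZ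
    rw [hcomb, hout, e₃, e₂, lin, lin, lin]
    ext i j
    fin_cases i <;> fin_cases j <;> simp [outer_apply] <;> ring
  · right
    intro Z hZ
    obtain ⟨a, d, x, y, rfl⟩ := isHermitian_decomposition hZ
    rw [hcomb, hout, e₃, e₂, lin, lin, lin]
    ext i j
    fin_cases i <;> fin_cases j <;> simp [outer_apply] <;> ring

theorem outer_mulVec (T : Mat2) (x : Fin 2 → ℂ) : outer (T *ᵥ x) = T * outer x * Tᴴ := by
  rw [outer, outer, mul_vecMulVec, vecMulVec_mul, star_mulVec]

theorem eq_congruence_of_directions {L : Mat2 → Mat2} {p : (Fin 2 → ℂ) → (Fin 2 → ℂ)}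
    (hadd : ∀ Z W : Mat2, Z.IsHermitian → W.IsHermitian → L (Z + W) = L Z + L W)
    (hdet : ∀ Z : Mat2, Z.IsHermitian → (Z.det = 0 ↔ (L Z).det = 0))
    (hdir : ∀ v ≠ 0, ∀ t : ℝ, ∃ s : ℝ, L ((t : ℂ) • outer v) = (s : ℂ) • outer (p v))
    (hcross : ∀ v w, cross v w ≠ 0 → cross (p v) (p w) ≠ 0) :
    ∃ (S : Mat2) (c : ℝ), S.det ≠ 0 ∧ c ≠ 0 ∧
      ((∀ Z : Mat2, Z.IsHermitian → L Z = (c : ℂ) • (S * Z * Sᴴ)) ∨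
        (∀ Z : Mat2, Z.IsHermitian → L Z = (c : ℂ) • (S * Zᵀ * Sᴴ))) := by
  have ne10 : (![1, 0] : Fin 2 → ℂ) ≠ 0 := fun h => by simpa using congrFun h 0
  have ne01 : (![0, 1] : Fin 2 → ℂ) ≠ 0 := fun h => by simpa using congrFun h 1
  have ne11 : (![1, 1] : Fin 2 → ℂ) ≠ 0 := fun h => by simpa using congrFun h 1
  have ne1I : (![1, -Complex.I] : Fin 2 → ℂ) ≠ 0 := fun h => by simpa using congrFun h 0
  choose g₁ hg₁ using hdir _ ne10
  choose g₂ hg₂ using hdir _ ne01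
  choose g₃ hg₃ using hdir _ ne11
  choose g₄ hg₄ using hdir _ ne1I
  have huv := hcross ![1, 0] ![0, 1] (by simp [cross])
  have huw := hcross ![1, 0] ![1, 1] (by simp [cross])
  have hwv := hcross ![1, 1] ![0, 1] (by simp [cross])
  have hz0 := ne_zero_of_cross_ne_zero (hcross ![1, -Complex.I] ![0, 1] (by simp [cross]))
  generalize p ![1, 0] = u at *
  generalize p ![0, 1] = v at *
  generalize p ![1, 1] = w at *
  generalize p ![1, -Complex.I] = z at *
  set α := cross w v / cross u v with hα
  set β := cross u w / cross u v with hβ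
  have hα0 : α ≠ 0 := div_ne_zero hwv huv
  have hβ0 : β ≠ 0 := div_ne_zero huw huv
  let S : Mat2 := !![α * u 0, β * v 0; α * u 1, β * v 1]
  have hS : S.det ≠ 0 := by
    have : S.det = α * β * cross u v := by
      simp [S, det_fin_two, cross]; ring
    rw [this]
    exact mul_ne_zero (mul_ne_zero hα0 hβ0) huv
  have hSu : S *ᵥ (α⁻¹ • ![1, 0]) = u := by
    ext i; fin_cases i <;> simp [S, mulVec, dotProduct, Fin.sum_univ_two] <;> field_simp
  have hSv : S *ᵥ (β⁻¹ • ![0, 1]) = v := by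
    ext i; fin_cases i <;> simp [S, mulVec, dotProduct, Fin.sum_univ_two] <;> field_simp
  have hSw : S *ᵥ ![1, 1] = w := by
    have : ∀ i, α * u i + β * v i = w i := fun i => by
      rw [hα, hβ, div_mul_eq_mul_div, div_mul_eq_mul_div, ← add_div, div_eq_iff huv]
      simp only [cross]
      fin_cases i <;> simp <;> ring
    ext i; fin_cases i <;> simp [S, mulVec, dotProduct, Fin.sum_univ_two, this]
  have hTS : S⁻¹ * S = 1 := nonsing_inv_mul _ (isUnit_iff_ne_zero.mpr hS)
  have hST : S * S⁻¹ = 1 := mul_nonsing_inv _ (isUnit_iff_ne_zero.mpr hS)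
  have inv_mulVec : ∀ {x y : Fin 2 → ℂ}, S *ᵥ x = y → S⁻¹ *ᵥ y = x := by
    rintro x y rfl
    rw [mulVec_mulVec, hTS, one_mulVec]
  let M : Mat2 → Mat2 := fun Z => S⁻¹ * L Z * S⁻¹ᴴ
  have hML : ∀ Z, L Z = S * M Z * Sᴴ := fun Z => by
    have : S⁻¹ᴴ * Sᴴ = 1 := by rw [← conjTranspose_mul, hST, conjTranspose_one]
    simp only [M]
    rw [mul_assoc, mul_assoc, this, mul_one, ← mul_assoc, hST, one_mul]
  have hM : ∀ {t s : ℝ} {x y : Fin 2 → ℂ}, L ((t : ℂ) • outer x) = (s : ℂ) • outer y →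
      M ((t : ℂ) • outer x) = (s : ℂ) • outer (S⁻¹ *ᵥ y) := by
    intro t s x y h
    simp only [M]
    rw [h, outer_mulVec, mul_smul_comm, smul_mul_assoc]
  have hsm : ∀ (s : ℝ) (a : ℂ) (x : Fin 2 → ℂ),
      (s : ℂ) • outer (a • x) = ((s * Complex.normSq a : ℝ) : ℂ) • outer x := by
    intro s a x
    rw [outer_smul, smul_smul, Complex.star_def, Complex.mul_conj, Complex.ofReal_mul]
  obtain ⟨c, hc, h⟩ := eq_smul_or_transpose_of_normalized (M := M)
    (fun Z W hZ hW => by simp only [M]; rw [hadd Z W hZ hW, mul_add, add_mul])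
    (fun Z hZ => by
      rw [hdet Z hZ, hML, det_mul, det_mul, det_conjTranspose]
      simp [hS])
    (fun t => by rw [hM (hg₁ t), inv_mulVec hSu, hsm])
    (fun t => by rw [hM (hg₂ t), inv_mulVec hSv, hsm])
    (fun t => by rw [hM (hg₃ t), inv_mulVec hSw])
    (fun t => hM (hg₄ t))
    (fun h => hz0 (by rw [← one_mulVec z, ← hST, ← mulVec_mulVec, h, mulVec_zero]))
  refine ⟨S, c, hS, hc, h.imp (fun h Z hZ => ?_) (fun h Z hZ => ?_)⟩ <;>
    rw [hML, h Z hZ, mul_smul_comm, smul_mul_assoc]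

/-- A map on the positive cone which maps rank one directions into rank one directions and
preserves coherency in both directions is affine of standard form. -/
theorem eq_affine_of_directions {ψ : Mat2 → Mat2} {p : (Fin 2 → ℂ) → (Fin 2 → ℂ)}
    (hdir : ∀ v ≠ 0, ∀ A : Mat2, A.PosSemidef → ∀ t : ℝ, 0 ≤ t →
      ∃ s : ℝ, ψ (A + (t : ℂ) • outer v) - ψ A = (s : ℂ) • outer (p v))
    (hcross : ∀ v w, cross v w ≠ 0 → cross (p v) (p w) ≠ 0)
    (hdet : ∀ A B : Mat2, A.PosSemidef → B.PosSemidef →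
      ((A - B).det = 0 ↔ (ψ A - ψ B).det = 0)) :
    ∃ (S : Mat2) (c : ℝ), S.det ≠ 0 ∧ c ≠ 0 ∧
      ((∀ A : Mat2, A.PosSemidef → ψ A = ψ 0 + (c : ℂ) • (S * A * Sᴴ)) ∨
        (∀ A : Mat2, A.PosSemidef → ψ A = ψ 0 + (c : ℂ) • (S * Aᵀ * Sᴴ))) := by
  have hψ : ∀ A B : Mat2, A.PosSemidef → B.PosSemidef → ψ (A + B) = ψ A + ψ B - ψ 0 := by
    intro A B hA hB
    have := additive_of_directions (fun v hv A hA => by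
      obtain ⟨s, hs⟩ := hdir v hv A hA 1 zero_le_one
      rw [Complex.ofReal_one, one_smul] at hs
      exact ⟨s, hs⟩) hcross hA hB
    rw [sub_eq_iff_eq_add] at this
    rw [this]
    abel
  let P : Mat2 → Mat2 := fun Z => ((1 / 4 : ℝ) : ℂ) • ((Z + 1)ᴴ * (Z + 1))
  let N : Mat2 → Mat2 := fun Z => ((1 / 4 : ℝ) : ℂ) • ((Z - 1)ᴴ * (Z - 1))
  have hP : ∀ Z, (P Z).PosSemidef := fun Z =>
    (posSemidef_conjTranspose_mul_self _).smul (by exact_mod_cast (by norm_num : (0 : ℝ) ≤ 1 / 4))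
  have hN : ∀ Z, (N Z).PosSemidef := fun Z =>
    (posSemidef_conjTranspose_mul_self _).smul (by exact_mod_cast (by norm_num : (0 : ℝ) ≤ 1 / 4))
  have hPN : ∀ Z : Mat2, Z.IsHermitian → P Z - N Z = Z := by
    intro Z hZ
    simp only [P, N]
    rw [← smul_sub, conjTranspose_add, conjTranspose_sub, conjTranspose_one, hZ.eq]
    have : (Z + 1) * (Z + 1) - (Z - 1) * (Z - 1) = (4 : ℂ) • Z := by
      have : (4 : ℂ) • Z = Z + Z + Z + Z := by module
      rw [this]
      noncomm_ring
    rw [this, smul_smul]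
    norm_num
  let L : Mat2 → Mat2 := fun Z => ψ (P Z) - ψ (N Z)
  have hL : ∀ A B : Mat2, A.PosSemidef → B.PosSemidef → L (A - B) = ψ A - ψ B := by
    intro A B hA hB
    have e := hPN (A - B) (hA.1.sub hB.1)
    have e1 := hψ _ _ hA (hN (A - B))
    have e2 := hψ _ _ hB (hP (A - B))
    have e3 : A + N (A - B) = B + P (A - B) := by
      rw [sub_eq_iff_eq_add] at e
      rw [e]
      abel
    rw [e3, e2] at e1
    simp only [L]
    have := sub_left_injective e1
    rw [sub_eq_sub_iff_add_eq_add, add_comm, this]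
  have hsmul : ∀ (v : Fin 2 → ℂ) (t : ℝ), 0 ≤ t → ((t : ℂ) • outer v).PosSemidef :=
    fun v t ht => (outer_posSemidef v).smul (by exact_mod_cast ht)
  obtain ⟨S, c, hS, hc, h⟩ := eq_congruence_of_directions (L := L) (p := p)
    (fun Z W hZ hW => by
      conv_lhs => rw [← hPN Z hZ, ← hPN W hW, sub_add_sub_comm]
      rw [hL _ _ ((hP Z).add (hP W)) ((hN Z).add (hN W)), hψ _ _ (hP Z) (hP W),
        hψ _ _ (hN Z) (hN W)]
      simp only [L]
      abel)
    (fun Z hZ => by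
      conv_lhs => rw [← hPN Z hZ]
      exact hdet _ _ (hP Z) (hN Z))
    (fun v hv t => by
      rcases le_total 0 t with ht | ht
      · obtain ⟨s, hs⟩ := hdir v hv 0 PosSemidef.zero t ht
        refine ⟨s, ?_⟩
        rw [← hs, zero_add, ← hL _ _ (hsmul v t ht) PosSemidef.zero, sub_zero]
      · obtain ⟨s, hs⟩ := hdir v hv 0 PosSemidef.zero (-t) (by linarith)
        refine ⟨-s, ?_⟩
        have := hL 0 _ PosSemidef.zero (hsmul v (-t) (by linarith))
        rw [zero_add] at hs
        have e : (0 : Mat2) - ((-t : ℝ) : ℂ) • outer v = (t : ℂ) • outer v := by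
          rw [Complex.ofReal_neg, neg_smul, zero_sub, neg_neg]
        rw [e] at this
        rw [this, Complex.ofReal_neg s, neg_smul (s : ℂ), ← hs, neg_sub])
    hcross
  refine ⟨S, c, hS, hc, h.imp (fun h A hA => ?_) (fun h A hA => ?_)⟩ <;>
    rw [← h A hA.1, ← sub_zero A, hL A 0 hA PosSemidef.zero, sub_zero, add_sub_cancel]

theorem coherentU_iff_cross {V W : U2} {m n : ℂ} {q r : Fin 2 → ℂ} (hm : m ≠ 0) (hn : n ≠ 0)
    (hV : (V : Mat2) = 1 + m • outer q) (hW : (W : Mat2) = 1 + n • outer r) :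
    CoherentU V W ↔ cross q r = 0 := by
  rw [coherentU_iff_det, hV, hW, add_sub_add_left_eq_sub, sub_eq_add_neg,
    ← neg_smul, det_smul_outer_add]
  simp [hm, hn]

theorem isHermitian_real_smul_one (κ : ℝ) : ((κ : ℂ) • (1 : Mat2)).IsHermitian := by
  rw [IsHermitian, conjTranspose_smul, conjTranspose_one, Complex.star_def, Complex.conj_ofReal]

theorem qform_re_nonneg {A : Mat2} (hA : A.PosSemidef) (q : Fin 2 → ℂ) : 0 ≤ (qform A q).re := by
  have := hA.dotProduct_mulVec_nonneg q
  exact (Complex.le_def.mp this).1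

/-- The data of a map `φ` fixing `1`, preserving coherency in both directions on a set containing
`1`, all finite points above `κ` and the points at infinity belonging to these. -/
structure ConeData (κ : ℝ) (𝒟 : Set U2) (φ : U2 → U2) : Prop where
  one_mem : (1 : U2) ∈ 𝒟
  cayley_mem : ∀ A : Mat2, A.PosSemidef → cayley ((κ : ℂ) • 1 + A) ∈ 𝒟
  infPoint_mem : ∀ q ≠ 0, ∀ x : ℝ, κ * lenSq q ≤ x → infPoint q x ∈ 𝒟
  coherent_iff : ∀ U ∈ 𝒟, ∀ V ∈ 𝒟, (CoherentU U V ↔ CoherentU (φ U) (φ V))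
  map_one : φ 1 = 1

/-- The map induced on the positive cone by a coherency preserving map. -/
def coneMap (κ : ℝ) (φ : U2 → U2) (A : Mat2) : Mat2 :=
  cayleyInv (φ (cayley ((κ : ℂ) • 1 + A)))

namespace ConeData

variable {κ : ℝ} {𝒟 : Set U2} {φ : U2 → U2}

theorem map_cayley_not_coherentU_one (h : ConeData κ 𝒟 φ) {A : Mat2} (hA : A.PosSemidef) :
    ¬CoherentU (φ (cayley ((κ : ℂ) • 1 + A))) 1 := by
  rw [← h.map_one, ← h.coherent_iff _ (h.cayley_mem A hA) _ h.one_mem]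
  exact cayley_not_coherentU_one ((isHermitian_real_smul_one κ).add hA.1)

theorem isHermitian_coneMap (h : ConeData κ 𝒟 φ) {A : Mat2} (hA : A.PosSemidef) :
    (coneMap κ φ A).IsHermitian :=
  cayleyInv_isHermitian (h.map_cayley_not_coherentU_one hA)

theorem cayley_coneMap (h : ConeData κ 𝒟 φ) {A : Mat2} (hA : A.PosSemidef) :
    cayley (coneMap κ φ A) = φ (cayley ((κ : ℂ) • 1 + A)) :=
  cayley_cayleyInv (h.map_cayley_not_coherentU_one hA)

theorem det_coneMap_sub (h : ConeData κ 𝒟 φ) {A B : Mat2} (hA : A.PosSemidef)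
    (hB : B.PosSemidef) :
    (A - B).det = 0 ↔ (coneMap κ φ A - coneMap κ φ B).det = 0 := by
  rw [← cayley_coherentU_iff (h.isHermitian_coneMap hA) (h.isHermitian_coneMap hB),
    h.cayley_coneMap hA, h.cayley_coneMap hB,
    ← h.coherent_iff _ (h.cayley_mem A hA) _ (h.cayley_mem B hB),
    cayley_coherentU_iff ((isHermitian_real_smul_one κ).add hA.1)
      ((isHermitian_real_smul_one κ).add hB.1), add_sub_add_left_eq_sub]

/-- The parameter of the point at infinity in direction `q` coherent with `κ + A`. -/
def level (κ : ℝ) (A : Mat2) (q : Fin 2 → ℂ) : ℝ := (qform ((κ : ℂ) • 1 + A) q).re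

theorem qform_eq_level {A : Mat2} (hA : A.PosSemidef) (q : Fin 2 → ℂ) :
    qform ((κ : ℂ) • 1 + A) q = level κ A q :=
  qform_eq_ofReal ((isHermitian_real_smul_one κ).add hA.1) q

theorem infPoint_level_mem (h : ConeData κ 𝒟 φ) {A : Mat2} (hA : A.PosSemidef)
    {q : Fin 2 → ℂ} (hq : q ≠ 0) : infPoint q (level κ A q) ∈ 𝒟 := by
  apply h.infPoint_mem q hq
  have := qform_re_nonneg hA q
  rw [level, qform_add, qform_smul, qform_one, Complex.add_re, ← Complex.ofReal_mul,
    Complex.ofReal_re]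
  linarith

theorem coherentU_map_infPoint (h : ConeData κ 𝒟 φ) {A : Mat2} (hA : A.PosSemidef)
    {q : Fin 2 → ℂ} (hq : q ≠ 0) {x : ℝ} (hx : infPoint q x ∈ 𝒟) (hAx : level κ A q = x) :
    CoherentU (cayley (coneMap κ φ A)) (φ (infPoint q x)) := by
  rw [h.cayley_coneMap hA, ← h.coherent_iff _ (h.cayley_mem A hA) _ hx,
    cayley_coherentU_infPoint ((isHermitian_real_smul_one κ).add hA.1) hq, qform_eq_level hA, hAx]

theorem exists_map_infPoint_eq (h : ConeData κ 𝒟 φ) {A : Mat2} (hA : A.PosSemidef)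
    {q : Fin 2 → ℂ} (hq : q ≠ 0) : ∃ (n : ℂ) (r : Fin 2 → ℂ), n ≠ 0 ∧ r ≠ 0 ∧
      (φ (infPoint q (level κ A q)) : Mat2) = 1 + n • outer r := by
  have hmem := h.infPoint_level_mem hA hq
  apply U2.exists_outer_of_coherent_one
  · rw [← h.map_one, ← h.coherent_iff _ hmem _ h.one_mem]
    exact infPoint_coherentU_one _ _
  · intro h1
    have := h.coherentU_map_infPoint hA hq hmem rfl
    rw [h1, h.cayley_coneMap hA] at this
    exact h.map_cayley_not_coherentU_one hA this

theorem exists_direction (h : ConeData κ 𝒟 φ) {q : Fin 2 → ℂ} (hq : q ≠ 0) :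
    ∃ r ≠ 0, ∀ A : Mat2, A.PosSemidef → ∃ n : ℂ, n ≠ 0 ∧
      (φ (infPoint q (level κ A q)) : Mat2) = 1 + n • outer r := by
  obtain ⟨n, r, hn, hr, e⟩ := h.exists_map_infPoint_eq PosSemidef.zero hq
  refine ⟨r, hr, fun A hA => ?_⟩
  obtain ⟨m, s, hm, hs, e'⟩ := h.exists_map_infPoint_eq hA hq
  have hcoh : CoherentU (φ (infPoint q (level κ 0 q))) (φ (infPoint q (level κ A q))) := by
    rw [← h.coherent_iff _ (h.infPoint_level_mem PosSemidef.zero hq) _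
      (h.infPoint_level_mem hA hq), infPoint_coherentU_infPoint hq hq, cross]
    ring
  obtain ⟨a, rfl⟩ := exists_smul_of_cross_eq_zero hr ((coherentU_iff_cross hn hm e e').mp hcoh)
  refine ⟨m * (a * star a), mul_ne_zero hm ?_, by rw [e', outer_smul, smul_smul]⟩
  have : a ≠ 0 := by rintro rfl; simp at hs
  simp [this]

theorem exists_affine (h : ConeData κ 𝒟 φ) :
    ∃ (S : Mat2) (c : ℝ), S.det ≠ 0 ∧ c ≠ 0 ∧
      ((∀ A : Mat2, A.PosSemidef →
          coneMap κ φ A = coneMap κ φ 0 + (c : ℂ) • (S * A * Sᴴ)) ∨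
        (∀ A : Mat2, A.PosSemidef →
          coneMap κ φ A = coneMap κ φ 0 + (c : ℂ) • (S * Aᵀ * Sᴴ))) := by
  choose! r hr0 hr using fun q hq => h.exists_direction (q := q) hq
  refine eq_affine_of_directions (p := fun v => perp (r (perp v))) ?_ ?_
    (fun A B hA hB => h.det_coneMap_sub hA hB)
  · intro v hv A hA t ht
    have hq := perp_ne_zero hv
    have hA' : (A + (t : ℂ) • outer v).PosSemidef :=
      hA.add ((outer_posSemidef v).smul (by exact_mod_cast ht))
    obtain ⟨n, hn, e⟩ := hr _ hq A hA
    have hmem := h.infPoint_level_mem hA hq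
    have hlevel : level κ (A + (t : ℂ) • outer v) (perp v) = level κ A (perp v) := by
      rw [level, level, ← add_assoc, qform_add _ (_ • _), qform_smul, qform_outer_perp, mul_zero,
        add_zero]
    have c1 := h.coherentU_map_infPoint hA hq hmem rfl
    have c2 := h.coherentU_map_infPoint hA' hq hmem hlevel
    rw [cayley_coherentU_iff_of_outer (h.isHermitian_coneMap hA) e] at c1
    rw [cayley_coherentU_iff_of_outer (h.isHermitian_coneMap hA') e] at c2
    refine exists_outer_perp ((h.isHermitian_coneMap hA').sub (h.isHermitian_coneMap hA))
      ((h.det_coneMap_sub hA' hA).mp ?_) (hr0 _ hq) ?_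
    · rw [add_sub_cancel_left, det_smul, det_outer, mul_zero]
    · rw [qform_sub]
      apply mul_left_cancel₀ hn
      linear_combination c2 - c1
  · intro v w hvw
    have hv := perp_ne_zero (ne_zero_of_cross_ne_zero hvw)
    have hw : perp w ≠ 0 := perp_ne_zero (by rintro rfl; simp [cross] at hvw)
    obtain ⟨m, hm, e⟩ := hr _ hv 0 PosSemidef.zero
    obtain ⟨n, hn, e'⟩ := hr _ hw 0 PosSemidef.zero
    rw [cross_perp_perp, star_ne_zero, ne_eq, ← coherentU_iff_cross hm hn e e',
      ← h.coherent_iff _ (h.infPoint_level_mem PosSemidef.zero hv) _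
      (h.infPoint_level_mem PosSemidef.zero hw), infPoint_coherentU_infPoint hv hw,
      cross_perp_perp, star_eq_zero]
    exact hvw

end ConeData

theorem Matrix.IsHermitian.ofReal_re_diag {Z : Mat2} (hZ : Z.IsHermitian) (i : Fin 2) :
    ((Z i i).re : ℂ) = Z i i :=
  Complex.conj_eq_iff_re.mp (hZ.apply i i)

theorem posSemidef_of_minors {Z : Mat2} (hZ : Z.IsHermitian) (ha : 0 < (Z 0 0).re)
    (hd : Complex.normSq (Z 0 1) ≤ (Z 0 0).re * (Z 1 1).re) : Z.PosSemidef := by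
  have h00 := hZ.ofReal_re_diag 0
  have h11 := hZ.ofReal_re_diag 1
  have h10 : star (Z 0 1) = Z 1 0 := hZ.apply 1 0
  have ha' : Z 0 0 ≠ 0 := by
    intro h
    rw [h] at ha
    simp at ha
  have hc : star (Z 0 0) = Z 0 0 := hZ.apply 0 0
  set a := (Z 0 0).re
  set d := (Z 1 1).re
  have e : Z = ((a⁻¹ : ℝ) : ℂ) • outer ![Z 0 0, Z 1 0] +
      (((a * d - Complex.normSq (Z 0 1)) / a : ℝ) : ℂ) • outer ![0, 1] := by
    push_cast
    rw [h00, h11, ← Complex.mul_conj, ← Complex.star_def, h10]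
    ext i j
    fin_cases i <;> fin_cases j
    · simp [outer_apply]
      rw [← Complex.star_def, hc]
      field_simp
    · simp [outer_apply]
      rw [← Complex.star_def, ← h10, star_star]
      field_simp
    · simp [outer_apply]
      rw [← Complex.star_def, hc]
      field_simp
    · simp [outer_apply]
      rw [← Complex.star_def, ← h10, star_star]
      field_simp
      ring
  rw [e]
  refine ((outer_posSemidef _).smul ?_).add ((outer_posSemidef _).smul ?_)
  · exact_mod_cast inv_nonneg.mpr ha.le
  · exact_mod_cast div_nonneg (sub_nonneg.mpr hd) ha.le

theorem exists_le_posSemidef_sub {X : Mat2} (hX : X.IsHermitian) (κ : ℝ) :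
    ∃ κ' ≤ κ, (X - (κ' : ℂ) • 1).PosSemidef := by
  set n := |(X 0 0).re| + |(X 1 1).re| + |κ| + 1 + ‖X 0 1‖ with hn
  have h0 := abs_nonneg (X 0 0).re
  have h1 := abs_nonneg (X 1 1).re
  have h2 := abs_nonneg κ
  have h3 := norm_nonneg (X 0 1)
  have h4 := neg_abs_le (X 0 0).re
  have h5 := neg_abs_le (X 1 1).re
  have h6 := neg_abs_le κ
  refine ⟨-n, by linarith, posSemidef_of_minors (hX.sub (isHermitian_real_smul_one _)) ?_ ?_⟩
  · simp
    linarith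
  · simp [Complex.normSq_eq_norm_sq, pow_two]
    exact mul_le_mul (by linarith) (by linarith) h3 (by linarith)

theorem exists_aut_congruence {H S : Mat2} (hH : H.IsHermitian) (hS : S.det ≠ 0) {c : ℝ}
    (hc : c ≠ 0) : ∃ Φ : U2 → U2, IsAut Φ ∧
      ∀ X : Mat2, X.IsHermitian → Φ (cayley X) = cayley (H + (c : ℂ) • (S * X * Sᴴ)) := by
  have hpos : ∀ {H : Mat2} {c : ℝ}, H.IsHermitian → 0 < c → ∃ Φ : U2 → U2, IsAut Φ ∧
      ∀ X : Mat2, X.IsHermitian → Φ (cayley X) = cayley (H + (c : ℂ) • (S * X * Sᴴ)) := by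
    intro H c hH hc
    have hc' : ((Real.sqrt c : ℝ) : ℂ) ≠ 0 := by exact_mod_cast (Real.sqrt_pos.mpr hc).ne'
    have hS' : (((Real.sqrt c : ℝ) : ℂ) • S).det ≠ 0 := by
      rw [det_smul]
      exact mul_ne_zero (pow_ne_zero _ hc') hS
    refine ⟨mob _ H hS' hH, isAut_mob hS' hH, fun X hX => ?_⟩
    rw [mob_cayley hS' hH hX, conjTranspose_smul, smul_mul_assoc, smul_mul_assoc, mul_smul_comm,
      smul_smul, Complex.star_def, Complex.conj_ofReal, ← Complex.ofReal_mul,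
      Real.mul_self_sqrt hc.le, add_comm]
  rcases lt_or_gt_of_ne hc with h | h
  · obtain ⟨Φ, hΦ, e⟩ := hpos hH.neg (neg_pos.mpr h)
    refine ⟨fun U => star (Φ U), isAut_star.comp hΦ, fun X hX => ?_⟩
    have hherm : (-H + ((-c : ℝ) : ℂ) • (S * X * Sᴴ)).IsHermitian := by
      refine hH.neg.add ?_
      rw [IsHermitian, conjTranspose_smul, conjTranspose_mul, conjTranspose_mul,
        conjTranspose_conjTranspose, hX.eq, Complex.star_def, Complex.conj_ofReal, mul_assoc]
    change star (Φ (cayley X)) = _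
    rw [e X hX, ← cayley_neg hherm]
    congr 1
    rw [Complex.ofReal_neg]
    module
  · exact hpos hH h

theorem ConeData.exists_aut {κ : ℝ} {𝒟 : Set U2} {φ : U2 → U2} (h : ConeData κ 𝒟 φ) :
    ∃ Φ : U2 → U2, IsAut Φ ∧ ∀ A : Mat2, A.PosSemidef →
      Φ (cayley ((κ : ℂ) • 1 + A)) = φ (cayley ((κ : ℂ) • 1 + A)) := by
  obtain ⟨S, c, hS, hc, hA⟩ := h.exists_affine
  have hSS : (((c * κ : ℝ) : ℂ) • (S * Sᴴ)).IsHermitian := by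
    rw [IsHermitian, conjTranspose_smul, conjTranspose_mul, conjTranspose_conjTranspose,
      Complex.star_def, Complex.conj_ofReal]
  have hH : (coneMap κ φ 0 - ((c * κ : ℝ) : ℂ) • (S * Sᴴ)).IsHermitian :=
    (h.isHermitian_coneMap PosSemidef.zero).sub hSS
  obtain ⟨Φ, hΦ, e⟩ := exists_aut_congruence hH hS hc
  have key : ∀ A : Mat2, coneMap κ φ 0 - ((c * κ : ℝ) : ℂ) • (S * Sᴴ) +
      (c : ℂ) • (S * ((κ : ℂ) • 1 + A) * Sᴴ) = coneMap κ φ 0 + (c : ℂ) • (S * A * Sᴴ) := by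
    intro A
    rw [mul_add, add_mul, mul_smul_comm, mul_one, smul_mul_assoc, smul_add, smul_smul,
      Complex.ofReal_mul]
    abel
  rcases hA with hA | hA
  · refine ⟨Φ, hΦ, fun A hpA => ?_⟩
    rw [e _ ((isHermitian_real_smul_one κ).add hpA.1), key, ← hA A hpA, h.cayley_coneMap hpA]
  · refine ⟨Φ ∘ transposeU, hΦ.comp isAut_transposeU, fun A hpA => ?_⟩
    have hX := (isHermitian_real_smul_one κ).add hpA.1
    rw [Function.comp_apply, ← cayley_transpose hX, e _ hX.transpose, transpose_add,
      transpose_smul, transpose_one, key, ← hA A hpA, h.cayley_coneMap hpA]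

theorem IsAut.coneData {Ψ : U2 → U2} (hΨ : IsAut Ψ) (h1 : Ψ 1 = 1) (κ : ℝ) :
    ConeData κ Set.univ Ψ where
  one_mem := trivial
  cayley_mem _ _ := trivial
  infPoint_mem _ _ _ _ := trivial
  coherent_iff U _ V _ := hΨ.2 U V
  map_one := h1

theorem cayleyInv_cayley {X : Mat2} (hX : X.IsHermitian) : cayleyInv (cayley X) = X :=
  have h := cayley_not_coherentU_one hX
  cayley_injective (cayleyInv_isHermitian h) hX (cayley_cayleyInv h)

/-- An automorphism fixing `1` and all finite points above `κ` fixes all finite points. -/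
theorem IsAut.map_cayley_of_cone {Ψ : U2 → U2} (hΨ : IsAut Ψ) (h1 : Ψ 1 = 1) {κ : ℝ}
    (h : ∀ A : Mat2, A.PosSemidef →
      Ψ (cayley ((κ : ℂ) • 1 + A)) = cayley ((κ : ℂ) • 1 + A)) {X : Mat2} (hX : X.IsHermitian) :
    Ψ (cayley X) = cayley X := by
  obtain ⟨κ', hκ, hXκ⟩ := exists_le_posSemidef_sub hX κ
  have hd := hΨ.coneData h1 κ'
  have hm : (((κ - κ' : ℝ) : ℂ) • (1 : Mat2)).PosSemidef :=
    PosSemidef.one.smul (by exact_mod_cast sub_nonneg.mpr hκ)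
  have hid : ∀ B : Mat2, B.PosSemidef →
      coneMap κ' Ψ (((κ - κ' : ℝ) : ℂ) • 1 + B) = (κ : ℂ) • 1 + B := by
    intro B hB
    have e : (κ' : ℂ) • (1 : Mat2) + (((κ - κ' : ℝ) : ℂ) • 1 + B) = (κ : ℂ) • 1 + B := by
      push_cast
      module
    rw [coneMap, e, h B hB, cayleyInv_cayley ((isHermitian_real_smul_one κ).add hB.1)]
  obtain ⟨D, hD⟩ : ∃ D : Mat2 → Mat2, (∀ A B, D (A + B) = D A + D B) ∧
      ∀ A : Mat2, A.PosSemidef → coneMap κ' Ψ A = coneMap κ' Ψ 0 + D A := by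
    obtain ⟨S, c, -, -, hA | hA⟩ := hd.exists_affine
    · exact ⟨fun A => (c : ℂ) • (S * A * Sᴴ),
        fun A B => by simp only [mul_add, add_mul, smul_add], hA⟩
    · exact ⟨fun A => (c : ℂ) • (S * Aᵀ * Sᴴ),
        fun A B => by simp only [transpose_add, mul_add, add_mul, smul_add], hA⟩
  have hDid : ∀ B : Mat2, B.PosSemidef → D B = B := by
    intro B hB
    have e0 := hid 0 PosSemidef.zero
    have e1 := hid B hB
    rw [add_zero, add_zero, hD.2 _ hm] at e0
    rw [hD.2 _ (hm.add hB), hD.1, ← add_assoc, e0] at e1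
    exact add_left_cancel e1
  have e0 := hid 0 PosSemidef.zero
  rw [add_zero, add_zero, hD.2 _ hm, hDid _ hm] at e0
  have eX : coneMap κ' Ψ (X - (κ' : ℂ) • 1) = X := by
    have e2 : coneMap κ' Ψ 0 = (κ' : ℂ) • 1 := by
      rw [← sub_eq_iff_eq_add.mpr e0.symm]
      push_cast
      module
    rw [hD.2 _ hXκ, hDid _ hXκ, e2]
    abel
  have := hd.cayley_coneMap hXκ
  rw [eX, add_sub_cancel] at this
  exact this.symm

theorem exists_entry_ball_subset {O : Set U2} (hO : IsOpen O) {U : U2} (hU : U ∈ O) :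
    ∃ ε > 0, ∀ V : U2, (∀ i j, ‖(V : Mat2) i j - (U : Mat2) i j‖ < ε) → V ∈ O := by
  obtain ⟨O', hO', rfl⟩ := isOpen_induced_iff.mp hO
  obtain ⟨ε, hε, hball⟩ :=
    Metric.isOpen_iff (α := Fin 2 → Fin 2 → ℂ).mp hO' (U : Mat2) hU
  exact ⟨ε, hε, fun V hV => hball ((dist_pi_lt_iff hε).mpr fun i =>
    (dist_pi_lt_iff hε).mpr fun j => (dist_eq_norm _ _).trans_lt (hV i j))⟩

theorem lenSq_eq_norm (q : Fin 2 → ℂ) : lenSq q = ‖q 0‖ ^ 2 + ‖q 1‖ ^ 2 := by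
  rw [lenSq, Complex.normSq_eq_norm_sq, Complex.normSq_eq_norm_sq]

theorem norm_sq_le_lenSq (q : Fin 2 → ℂ) (i : Fin 2) : ‖q i‖ ^ 2 ≤ lenSq q := by
  rw [lenSq_eq_norm]
  fin_cases i
  · exact le_add_of_nonneg_right (sq_nonneg _)
  · exact le_add_of_nonneg_left (sq_nonneg _)

theorem norm_cayley_sub_one_le {κ : ℝ} (hκ : 0 < κ) {A : Mat2} (hA : A.PosSemidef) (i j : Fin 2) :
    ‖(cayley ((κ : ℂ) • 1 + A) : Mat2) i j - (1 : Mat2) i j‖ ≤ 2 / κ := by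
  have hX := (isHermitian_real_smul_one κ).add hA.1
  set X := (κ : ℂ) • 1 + A with hXdef
  set N := (cayley X : Mat2) - 1 with hN
  have hXN : (X + Complex.I • 1) * N = -((2 * Complex.I) • (1 : Mat2)) := by
    rw [hN, coe_cayley hX, sub_sub_cancel_left, mul_neg, mul_smul_comm,
      mul_nonsing_inv _ (isUnit_iff_ne_zero.mpr (det_add_I_ne_zero hX))]
  set x : Fin 2 → ℂ := fun k => N k j with hx
  have hq : qform (X + Complex.I • 1) x = -(2 * Complex.I) * star (N j j) := by
    have e0 := congrFun (congrFun hXN 0) j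
    have e1 := congrFun (congrFun hXN 1) j
    rw [mul_apply, Fin.sum_univ_two] at e0 e1
    rw [qform_eq]
    simp only [hx]
    rw [e0, e1]
    fin_cases j <;> simp <;> ring
  have hre : κ * lenSq x ≤ 2 * ‖N j j‖ := by
    have h1 := congrArg Complex.re hq
    rw [qform_add, qform_smul, qform_one, hXdef, qform_add, qform_smul, qform_one] at h1
    have h2 := qform_re_nonneg hA x
    have h3 := Complex.abs_im_le_norm (N j j)
    have h4 := neg_abs_le (N j j).im
    simp at h1
    linarith
  have hs := norm_sq_le_lenSq x j
  have hL := norm_sq_le_lenSq x i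
  change ‖N j j‖ ^ 2 ≤ _ at hs
  change ‖N i j‖ ≤ _
  change ‖N i j‖ ^ 2 ≤ _ at hL
  have hs2 : κ * ‖N j j‖ ≤ 2 := by
    rcases (norm_nonneg (N j j)).eq_or_lt with h | h
    · rw [← h]; norm_num
    · by_contra hcon
      push Not at hcon
      nlinarith
  rw [le_div_iff₀ hκ]
  apply le_of_sq_le_sq _ (by norm_num)
  calc (‖N i j‖ * κ) ^ 2 = κ * (κ * ‖N i j‖ ^ 2) := by ring
    _ ≤ κ * (κ * lenSq x) := by gcongr
    _ ≤ κ * (2 * ‖N j j‖) := by gcongr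
    _ ≤ 2 ^ 2 := by linarith

theorem norm_infPoint_sub_one_le {κ : ℝ} (hκ : 0 < κ) {q : Fin 2 → ℂ} (hq : q ≠ 0) {x : ℝ}
    (hx : κ * lenSq q ≤ x) (i j : Fin 2) :
    ‖(infPoint q x : Mat2) i j - (1 : Mat2) i j‖ ≤ 2 / κ := by
  have hl := lenSq_pos hq
  have hx0 : 0 < x := lt_of_lt_of_le (mul_pos hκ hl) hx
  rw [coe_infPoint, Matrix.add_apply, add_sub_cancel_left, Matrix.smul_apply, outer_apply,
    smul_eq_mul, norm_mul, norm_div, norm_mul, norm_star, norm_neg, norm_mul, Complex.norm_I]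
  have hden : x ≤ ‖(x : ℂ) + Complex.I * lenSq q‖ := by
    have := Complex.re_le_norm ((x : ℂ) + Complex.I * lenSq q)
    simpa using this
  have hprod : ‖q i‖ * ‖q j‖ ≤ lenSq q := by
    have h1 := norm_sq_le_lenSq q i
    have h2 := norm_sq_le_lenSq q j
    nlinarith [sq_nonneg (‖q i‖ - ‖q j‖)]
  rw [div_mul_eq_mul_div, div_le_div_iff₀ (lt_of_lt_of_le hx0 hden) hκ]
  simp only [Complex.norm_ofNat, mul_one]
  nlinarith

/-- Every neighbourhood of `1` contains all points far up in the cone, and the points at infinity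
belonging to these. -/
theorem exists_cone_subset {O : Set U2} (hO : IsOpen O) (h1 : (1 : U2) ∈ O) :
    ∃ κ : ℝ, 0 < κ ∧ (∀ A : Mat2, A.PosSemidef → cayley ((κ : ℂ) • 1 + A) ∈ O) ∧
      ∀ q ≠ 0, ∀ x : ℝ, κ * lenSq q ≤ x → infPoint q x ∈ O := by
  obtain ⟨ε, hε, h⟩ := exists_entry_ball_subset hO h1
  have hκ : 0 < 4 / ε := by positivity
  have hlt : 2 / (4 / ε) < ε := by
    rw [div_div_eq_mul_div, div_lt_iff₀ (by norm_num)]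
    linarith
  exact ⟨4 / ε, hκ, fun A hA => h _ fun i j => (norm_cayley_sub_one_le hκ hA i j).trans_lt hlt,
    fun q hq x hx => h _ fun i j => (norm_infPoint_sub_one_le hκ hq hx i j).trans_lt hlt⟩

open Filter Topology in
theorem eventually_not_coherentU_one {P : U2} (hP : ¬CoherentU P 1) :
    ∀ᶠ V in 𝓝 P, ¬CoherentU V 1 := by
  simp only [coherentU_iff_det, OneMemClass.coe_one] at hP ⊢
  have hcd : Continuous fun V : U2 => ((V : Mat2) - 1).det :=
    (continuous_subtype_val.sub continuous_const).matrix_det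
  exact hcd.continuousAt.eventually_ne hP

theorem continuousAt_cayleyInv {P : U2} (hP : ¬CoherentU P 1) :
    ContinuousAt (fun V : U2 => cayleyInv (V : Mat2)) P := by
  rw [coherentU_iff_det, OneMemClass.coe_one] at hP
  have hc : Continuous fun V : U2 => (V : Mat2) - 1 := continuous_subtype_val.sub continuous_const
  simp only [cayleyInv, inv_def, Ring.inverse_eq_inv']
  have hs : ContinuousAt
      (fun V : U2 => (((V : Mat2) - 1).det)⁻¹ • ((V : Mat2) - 1).adjugate) P :=
    (hc.matrix_det.continuousAt.inv₀ hP).smul hc.matrix_adjugate.continuousAt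
  have hs' : ContinuousAt (fun V : U2 =>
      (2 * Complex.I) • (((V : Mat2) - 1).det)⁻¹ • ((V : Mat2) - 1).adjugate) P :=
    hs.const_smul (2 * Complex.I)
  exact continuousAt_const.sub hs'

open Filter Topology in
theorem eventually_posSemidef_cayleyInv_sub {P : U2} (hP : ¬CoherentU P 1) {κ : ℝ} (hκ : 0 < κ)
    (hval : cayleyInv (P : Mat2) - (κ : ℂ) • 1 = (κ : ℂ) • 1) :
    ∀ᶠ V : U2 in 𝓝 P, (cayleyInv (V : Mat2) - (κ : ℂ) • 1).PosSemidef := by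
  have hcont : ContinuousAt (fun V : U2 => cayleyInv (V : Mat2) - (κ : ℂ) • 1) P :=
    (continuousAt_cayleyInv hP).sub continuousAt_const
  have hpos : ∀ᶠ M : Mat2 in 𝓝 ((κ : ℂ) • 1),
      0 < (M 0 0).re ∧ Complex.normSq (M 0 1) < (M 0 0).re * (M 1 1).re := by
    have h0 : Continuous fun M : Mat2 => (M 0 0).re := by fun_prop
    have h1 : Continuous fun M : Mat2 => (M 1 1).re := by fun_prop
    have h01 : Continuous fun M : Mat2 => Complex.normSq (M 0 1) :=
      Complex.continuous_normSq.comp (continuous_id.matrix_elem 0 1)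
    exact (h0.continuousAt.eventually_const_lt (by simpa using hκ)).and
      (h01.continuousAt.eventually_lt (h0.mul h1).continuousAt (by simp [hκ]))
  have htend := hcont.tendsto
  rw [hval] at htend
  filter_upwards [eventually_not_coherentU_one hP, htend.eventually hpos] with V hV ⟨h0, h1⟩
  exact posSemidef_of_minors
    ((cayleyInv_isHermitian hV).sub (isHermitian_real_smul_one κ)) h0 h1.le

open Filter Topology in
theorem eventually_eq_cayley {κ : ℝ} (hκ : 0 < κ) :
    ∀ᶠ V in 𝓝 (cayley ((κ : ℂ) • (1 : Mat2) + (κ : ℂ) • 1)),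
      ∃ A : Mat2, A.PosSemidef ∧ V = cayley ((κ : ℂ) • 1 + A) := by
  have hX := (isHermitian_real_smul_one κ).add (isHermitian_real_smul_one κ)
  have hP := cayley_not_coherentU_one hX
  have hval := cayleyInv_cayley hX
  generalize cayley ((κ : ℂ) • (1 : Mat2) + (κ : ℂ) • 1) = P at hP hval ⊢
  filter_upwards [eventually_not_coherentU_one hP,
    eventually_posSemidef_cayleyInv_sub hP hκ (by rw [hval, add_sub_cancel_right])] with V hV hA
  exact ⟨_, hA, by rw [add_sub_cancel, cayley_cayleyInv hV]⟩

open Filter Topology in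
theorem exists_nhds_one_star_mul_mem {𝒰 : Set U2} (hopen : IsOpen 𝒰) {U₀ : U2} (hU₀ : U₀ ∈ 𝒰) :
    ∃ O : Set U2, IsOpen O ∧ (1 : U2) ∈ O ∧ ∀ P ∈ O, ∀ V ∈ O, U₀ * (star P * V) ∈ 𝒰 := by
  have hmul : Continuous fun p : U2 × U2 => U₀ * (star p.1 * p.2) := by fun_prop
  have hnear : ∀ᶠ p : U2 × U2 in 𝓝 ((1 : U2), (1 : U2)), U₀ * (star p.1 * p.2) ∈ 𝒰 :=
    (hopen.preimage hmul).mem_nhds (by simpa using hU₀)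
  rw [nhds_prod_eq] at hnear
  obtain ⟨O', hO', hsub⟩ :=
    (eventually_prod_self_iff (r := fun P V => U₀ * (star P * V) ∈ 𝒰)).mp hnear
  obtain ⟨O, hOO', hO, h1⟩ := mem_nhds_iff.mp hO'
  exact ⟨O, hO, h1, fun P hP V hV => hsub P (hOO' hP) V (hOO' hV)⟩

open Filter Topology in
/-- A coherency preserving map of an open set agrees with an automorphism near every point. -/
theorem exists_aut_eventuallyEq {𝒰 : Set U2} (hopen : IsOpen 𝒰) {φ : U2 → U2}
    (hφ : ∀ U ∈ 𝒰, ∀ V ∈ 𝒰, (CoherentU U V ↔ CoherentU (φ U) (φ V))) {U₀ : U2} (hU₀ : U₀ ∈ 𝒰) :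
    ∃ Φ : U2 → U2, IsAut Φ ∧ ∀ᶠ U in 𝓝 U₀, Φ U = φ U := by
  obtain ⟨O, hO, h1, hmem⟩ := exists_nhds_one_star_mul_mem hopen hU₀
  obtain ⟨κ, hκ, hcone, hinf⟩ := exists_cone_subset hO h1
  have hPO := hcone ((κ : ℂ) • 1) (PosSemidef.one.smul (by exact_mod_cast hκ.le))
  have hev := eventually_eq_cayley hκ
  generalize cayley ((κ : ℂ) • (1 : Mat2) + (κ : ℂ) • 1) = P at hPO hev
  obtain ⟨T, hT⟩ : ∃ T, T = U₀ * star P := ⟨_, rfl⟩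
  replace hmem : ∀ V ∈ O, T * V ∈ 𝒰 := fun V hV => by
    rw [hT, mul_assoc]
    exact hmem P hPO V hV
  have hPT : star T * U₀ = P := by
    rw [hT, star_mul, star_star, mul_assoc, Unitary.star_mul_self, mul_one]
  clear hT
  have hcd : ConeData κ O (fun U => star (φ T) * φ (T * U)) :=
    { one_mem := h1
      cayley_mem := hcone
      infPoint_mem := hinf
      coherent_iff := fun U hU V hV => by
        rw [(isAut_mul_left T).2 U V, hφ _ (hmem U hU) _ (hmem V hV)]
        exact (isAut_mul_left (star (φ T))).2 _ _
      map_one := by simp }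
  obtain ⟨Φ, hΦ, hΦφ⟩ := hcd.exists_aut
  refine ⟨(fun U => φ T * U) ∘ Φ ∘ (fun U => star T * U),
    (isAut_mul_left _).comp (hΦ.comp (isAut_mul_left _)), ?_⟩
  have htend : Tendsto (fun U : U2 => star T * U) (𝓝 U₀) (𝓝 P) := by
    have : Continuous fun U : U2 => star T * U := by fun_prop
    rw [← hPT]
    exact this.tendsto U₀
  filter_upwards [htend.eventually hev] with U hU
  obtain ⟨A, hA, hUA⟩ := hU
  have h := hΦφ A hA
  rw [← hUA, ← mul_assoc T, Unitary.mul_star_self, one_mul] at h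
  rw [Function.comp_apply, Function.comp_apply, h, ← mul_assoc, Unitary.mul_star_self, one_mul]

open Filter Topology in
theorem IsAut.eq_self_of_eventually_of_not_coherentU {Ψ : U2 → U2} (hΨ : IsAut Ψ) {P : U2}
    (h : ∀ᶠ U in 𝓝 P, Ψ U = U) {U : U2} (hU : ¬CoherentU U P) : Ψ U = U := by
  have hΨ' : IsAut ((fun V => star P * V) ∘ Ψ ∘ (fun V => P * V)) :=
    (isAut_mul_left _).comp (hΨ.comp (isAut_mul_left _))
  set Ψ' := (fun V => star P * V) ∘ Ψ ∘ (fun V => P * V) with hdef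
  have htend : Tendsto (fun V : U2 => P * V) (𝓝 1) (𝓝 P) := by
    have : Continuous fun V : U2 => P * V := by fun_prop
    simpa using this.tendsto 1
  have hfix : ∀ V, Ψ (P * V) = P * V ↔ Ψ' V = V := fun V => by
    simp only [hdef, Function.comp_apply]
    constructor
    · intro e
      rw [e, ← mul_assoc, Unitary.star_mul_self, one_mul]
    · intro e
      conv_rhs => rw [← e]
      rw [← mul_assoc, Unitary.mul_star_self, one_mul]
  obtain ⟨O, hOsub, hO, h1⟩ := mem_nhds_iff.mp (htend.eventually h)
  obtain ⟨κ, -, hcone, -⟩ := exists_cone_subset hO h1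
  have hV : ¬CoherentU (star P * U) 1 := by
    rw [(isAut_mul_left P).2]
    simpa [← mul_assoc] using hU
  have key := hΨ'.map_cayley_of_cone ((hfix 1).mp (hOsub h1))
    (fun A hA => (hfix _).mp (hOsub (hcone A hA))) (cayleyInv_isHermitian hV)
  rw [cayley_cayleyInv hV, ← hfix, ← mul_assoc, Unitary.mul_star_self, one_mul] at key
  exact key

theorem exists_not_coherentU_mem {O : Set U2} (hO : IsOpen O) (h1 : (1 : U2) ∈ O) (W : U2) :
    ∃ P ∈ O, ¬CoherentU W P := by
  by_cases hW : CoherentU W 1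
  swap
  · exact ⟨1, h1, hW⟩
  obtain ⟨κ, -, hcone, -⟩ := exists_cone_subset hO h1
  have hm0 : cayley ((κ : ℂ) • (1 : Mat2)) ∈ O := by simpa using hcone 0 PosSemidef.zero
  have hm1 : cayley ((κ : ℂ) • (1 : Mat2) + 1) ∈ O := hcone 1 PosSemidef.one
  have hh0 := isHermitian_real_smul_one κ
  have hh1 : ((κ : ℂ) • (1 : Mat2) + 1).IsHermitian := hh0.add isHermitian_one
  by_cases hW1 : W = 1
  · refine ⟨_, hm0, ?_⟩
    rw [hW1, coherentU_comm]
    exact cayley_not_coherentU_one hh0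
  obtain ⟨n, q, hn, hq, e⟩ := U2.exists_outer_of_coherent_one hW hW1
  by_contra hcon
  push Not at hcon
  have c0 := (coherentU_comm _ _).mp (hcon _ hm0)
  have c1 := (coherentU_comm _ _).mp (hcon _ hm1)
  rw [cayley_coherentU_iff_of_outer hh0 e] at c0
  rw [cayley_coherentU_iff_of_outer hh1 e, qform_add, qform_one] at c1
  have hl : (lenSq q : ℂ) ≠ 0 := by exact_mod_cast (lenSq_pos hq).ne'
  exact mul_ne_zero hn hl (by linear_combination c1 - c0)

open Filter Topology in
/-- Automorphisms which agree near some point are equal. -/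
theorem IsAut.eq_of_eventuallyEq {Φ₁ Φ₂ : U2 → U2} (h₁ : IsAut Φ₁) (h₂ : IsAut Φ₂) {U₀ : U2}
    (h : ∀ᶠ U in 𝓝 U₀, Φ₁ U = Φ₂ U) : Φ₁ = Φ₂ := by
  obtain ⟨Θ, hΘ, hl, hr⟩ := h₂.symm
  have hfix : ∀ᶠ U in 𝓝 U₀, (Θ ∘ Φ₁) U = U := by
    filter_upwards [h] with U hU
    rw [Function.comp_apply, hU, hl]
  obtain ⟨O, hOsub, hO, hU₀⟩ := mem_nhds_iff.mp hfix
  ext1 U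
  have hcont : Continuous fun V : U2 => U₀ * V := by fun_prop
  obtain ⟨P, hP, hUP⟩ := exists_not_coherentU_mem (hO.preimage hcont) (by simpa using hU₀)
    (star U₀ * U)
  have hUP' : ¬CoherentU U (U₀ * P) := by
    rw [(isAut_mul_left U₀).2] at hUP
    simpa [← mul_assoc] using hUP
  have key := (hΘ.comp h₁).eq_self_of_eventually_of_not_coherentU
    (mem_of_superset (hO.mem_nhds hP) hOsub) hUP'
  rw [← hr (Φ₁ U)]
  exact congrArg Φ₂ key

/-- **Lester's theorem.**  A map of an open connected subset of `U₂` into `U₂` preserving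
coherency in both directions is standard. -/
theorem lester_theorem
    (𝒰 : Set U2) (hopen : IsOpen 𝒰) (hconn : IsConnected 𝒰)
    (φ : U2 → U2)
    (hφ : ∀ U ∈ 𝒰, ∀ V ∈ 𝒰, (CoherentU U V ↔ CoherentU (φ U) (φ V))) :
    ∃ Φ : U2 → U2, IsAut Φ ∧ ∀ U ∈ 𝒰, Φ U = φ U := by
  choose Φ hΦ hev using fun x : 𝒰 => exists_aut_eventuallyEq hopen hφ x.2
  have : PreconnectedSpace 𝒰 := isPreconnected_iff_preconnectedSpace.mp hconn.isPreconnected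
  have hloc : IsLocallyConstant Φ := by
    rw [IsLocallyConstant.iff_eventually_eq]
    intro x
    have h := continuous_subtype_val.continuousAt.eventually (hev x).eventually_nhds
    filter_upwards [h] with y hy
    refine (hΦ y).eq_of_eventuallyEq (hΦ x) (U₀ := y) ?_
    filter_upwards [hy, hev y] with U h1 h2
    rw [h1, h2]
  obtain ⟨U₀, hU₀⟩ := hconn.nonempty
  refine ⟨Φ ⟨U₀, hU₀⟩, hΦ _, fun U hU => ?_⟩
  rw [hloc.apply_eq_of_preconnectedSpace ⟨U₀, hU₀⟩ ⟨U, hU⟩]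
  exact (hev ⟨U, hU⟩).self_of_nhds
end
end

section
/- Let φ : [0, I] → U₂ satisfy rank(X − Y) ≤ 1 ⟹ rank(φ(X) − φ(Y)) ≤ 1 for all X, Y ∈ [0, I], and assume φ(0) = 𝔠(0) = −I, φ((1/2)I) = 𝔠((1/2)I), and φ(I) = 𝔠(I) = −i·I. Then there exists a 2×2 unitary matrix U such that either φ(X) = 𝔠(U X U*) for every X ∈ [0, I], or φ(X) = 𝔠(U Xᵗ U*) for every X ∈ [0, I]. -/
open Matrix
open scoped ComplexOrder

noncomputable section

/-- `Q` is a rank one orthogonal projection, expressed through its trace. -/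
structure IsTraceOneProj (Q : Mat2) : Prop where
  herm : Qᴴ = Q
  idem : Q * Q = Q
  trace_eq : Q.trace = 1

/-- The matrix acting as `α` on the range of `Q` and as `β` on its kernel. -/
def spec (α β : ℂ) (Q : Mat2) : Mat2 := α • Q + β • (1 - Q)

/-- The scalar Cayley transform. -/
def omega (s : ℝ) : ℂ := (s - Complex.I) / (s + Complex.I)

theorem spec_mul (α β γ δ : ℂ) {Q : Mat2} (hQ : Q * Q = Q) :
    spec α β Q * spec γ δ Q = spec (α * γ) (β * δ) Q := by
  simp only [spec, add_mul, mul_add, smul_mul_smul_comm, mul_sub, sub_mul, hQ, mul_one, one_mul,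
    sub_self, smul_zero, sub_zero, add_zero, zero_add]

theorem spec_self (α : ℂ) (Q : Mat2) : spec α α Q = α • (1 : Mat2) := by
  simp [spec, ← smul_add]

theorem spec_one_sub (α β : ℂ) (Q : Mat2) : spec α β (1 - Q) = spec β α Q := by
  simp [spec, add_comm]

theorem spec_sub (α β γ δ : ℂ) (Q : Mat2) :
    spec α β Q - spec γ δ Q = spec (α - γ) (β - δ) Q := by
  simp only [spec]; module

theorem spec_conjTranspose (α β : ℂ) {Q : Mat2} (hQ : Qᴴ = Q) :
    (spec α β Q)ᴴ = spec (star α) (star β) Q := by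
  simp [spec, hQ]

namespace IsTraceOneProj

variable {Q Q' : Mat2}

theorem one_sub (h : IsTraceOneProj Q) : IsTraceOneProj (1 - Q) where
  herm := by simp [h.herm]
  idem := by simp [mul_sub, sub_mul, h.idem]
  trace_eq := by simp [Matrix.trace_sub, h.trace_eq]; norm_num

theorem conj (h : IsTraceOneProj Q) {W : Mat2} (hW : Wᴴ * W = 1) :
    IsTraceOneProj (W * Q * Wᴴ) where
  herm := by simp [h.herm, Matrix.mul_assoc]
  idem := by
    calc W * Q * Wᴴ * (W * Q * Wᴴ) = W * Q * (Wᴴ * W) * Q * Wᴴ := by simp only [Matrix.mul_assoc]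
      _ = W * (Q * Q) * Wᴴ := by rw [hW]; simp only [Matrix.mul_assoc, Matrix.one_mul]
      _ = _ := by rw [h.idem]
  trace_eq := by rw [Matrix.trace_mul_comm, ← Matrix.mul_assoc, hW, Matrix.one_mul, h.trace_eq]

theorem exists_entries (h : IsTraceOneProj Q) :
    ∃ (p : ℝ) (q : ℂ), Q = !![(p : ℂ), q; star q, 1 - p] ∧ q * star q = p * (1 - p) := by
  have h00 := congr_fun₂ h.herm 0 0
  have h01 := congr_fun₂ h.herm 1 0
  have hi := congr_fun₂ h.idem 0 0
  have ht := h.trace_eq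
  simp only [Matrix.conjTranspose_apply] at h00 h01
  simp [Matrix.trace_fin_two, Matrix.mul_apply, Fin.sum_univ_two] at ht hi
  obtain ⟨p, hp⟩ : ∃ p : ℝ, (p : ℂ) = Q 0 0 := ⟨_, Complex.conj_eq_iff_re.1 h00⟩
  refine ⟨p, Q 0 1, ?_, ?_⟩
  · ext i j
    fin_cases i <;> fin_cases j
    · simp [hp]
    · simp
    · simpa using h01.symm
    · simp [hp]; linear_combination ht
  · rw [h01, hp]; linear_combination hi

theorem exists_unitary (h : IsTraceOneProj Q) :
    ∃ W : Mat2, Wᴴ * W = 1 ∧ W * Wᴴ = 1 ∧ W * !![1, 0; 0, 0] * Wᴴ = Q := by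
  obtain ⟨p, q, rfl, hq⟩ := h.exists_entries
  have hre : Complex.normSq q = p * (1 - p) := by
    rw [Complex.star_def, Complex.mul_conj] at hq
    exact_mod_cast hq
  have key : ∀ v w : ℂ, v * star v = p → w * star w = 1 - p → v * star w = q →
      ∃ W : Mat2, Wᴴ * W = 1 ∧ W * Wᴴ = 1 ∧
        W * !![1, 0; 0, 0] * Wᴴ = !![(p : ℂ), q; star q, 1 - p] := by
    intro v w hv hw hvw
    have hvw' : w * star v = star q := by rw [← hvw]; simp [mul_comm]
    have hWW : !![v, -star w; w, star v] * !![v, -star w; w, star v]ᴴ = 1 := by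
      ext i j
      fin_cases i <;> fin_cases j <;> simp [Matrix.mul_apply, Fin.sum_univ_two] <;>
        simp at hv hw <;> first | linear_combination hv + hw | ring
    refine ⟨!![v, -star w; w, star v], mul_eq_one_comm.1 hWW, hWW, ?_⟩
    ext i j
    simp at hv hw hvw hvw'
    fin_cases i <;> fin_cases j <;> simp [Matrix.mul_apply, Fin.sum_univ_two, *]
  by_cases hp : p = 0
  · subst hp
    have hq0 : q = 0 := by simpa using hre
    exact key 0 1 (by simp) (by simp) (by simp [hq0])
  · have hp0 : 0 < p := by
      have := Complex.normSq_nonneg q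
      rcases lt_or_gt_of_ne hp with h | h
      · nlinarith
      · exact h
    have hs : ((√p : ℝ) : ℂ) * (√p : ℝ) = p := by
      rw [← Complex.ofReal_mul, Real.mul_self_sqrt hp0.le]
    have hs0 : ((√p : ℝ) : ℂ) ≠ 0 := by
      simpa using (Real.sqrt_pos.2 hp0).ne'
    have hpc : (p : ℂ) ≠ 0 := by exact_mod_cast hp
    refine key (√p : ℝ) (star q / (√p : ℝ)) (by simpa using hs) ?_ ?_
    · simp at hq ⊢
      field_simp
      rw [pow_two, hs]
      linear_combination hq
    · simp
      field_simp

theorem exists_trace_mul (h : IsTraceOneProj Q) (h' : IsTraceOneProj Q') :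
    ∃ r : ℝ, 0 ≤ r ∧ r ≤ 1 ∧ (Q * Q').trace = r := by
  obtain ⟨W, hW, hW', rfl⟩ := h.exists_unitary
  have h2 := h'.conj (W := Wᴴ) (by simpa using hW')
  obtain ⟨p, q, hp, hq⟩ := h2.exists_entries
  have hre : Complex.normSq q = p * (1 - p) := by
    rw [Complex.star_def, Complex.mul_conj] at hq
    exact_mod_cast hq
  have := Complex.normSq_nonneg q
  refine ⟨p, by nlinarith, by nlinarith, ?_⟩
  calc (W * !![1, 0; 0, 0] * Wᴴ * Q').trace = (!![1, 0; 0, 0] * (Wᴴ * Q' * Wᴴᴴ)).trace := by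
        rw [Matrix.mul_assoc, Matrix.mul_assoc, Matrix.trace_mul_comm]
        simp only [Matrix.mul_assoc, conjTranspose_conjTranspose]
    _ = (p : ℂ) := by rw [hp]; simp [Matrix.trace_fin_two]

theorem eq_of_trace_mul_eq_one (h : IsTraceOneProj Q) (h' : IsTraceOneProj Q')
    (ht : (Q * Q').trace = 1) : Q = Q' := by
  have : ((Q - Q')ᴴ * (Q - Q')).trace = 0 := by
    rw [conjTranspose_sub, h.herm, h'.herm]
    simp only [sub_mul, mul_sub, h.idem, h'.idem, Matrix.trace_sub, h.trace_eq, h'.trace_eq,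
      Matrix.trace_mul_comm Q' Q, ht]
    ring
  exact sub_eq_zero.1 (Matrix.trace_conjTranspose_mul_self_eq_zero_iff.1 this)

theorem trace_mul_one_sub (h : IsTraceOneProj Q) (Q' : Mat2) :
    (Q * (1 - Q')).trace = 1 - (Q * Q').trace := by
  rw [mul_sub, mul_one, trace_sub, h.trace_eq]

theorem det_spec_sub_spec (h : IsTraceOneProj Q) (h' : IsTraceOneProj Q') (α β γ δ : ℂ) :
    (spec α β Q - spec γ δ Q').det = (α - δ) * (β - δ) -
      (γ - δ) * ((Q * Q').trace * (β - δ) + (1 - (Q * Q').trace) * (α - δ)) := by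
  obtain ⟨p, q, rfl, hq⟩ := h.exists_entries
  obtain ⟨p', q', rfl, hq'⟩ := h'.exists_entries
  simp [spec, Matrix.det_fin_two, Matrix.trace_fin_two] at hq hq' ⊢
  linear_combination (-(α - β) ^ 2) * hq - (γ - δ) ^ 2 * hq'

theorem det_spec (h : IsTraceOneProj Q) (α β : ℂ) : (spec α β Q).det = α * β := by
  have := h.det_spec_sub_spec h α β 0 0
  simpa [spec_self] using this

theorem exists_trace_mul_eq (h : IsTraceOneProj Q) {r : ℝ} (h0 : 0 ≤ r) (h1 : r ≤ 1) :
    ∃ P, IsTraceOneProj P ∧ (P * Q).trace = r := by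
  obtain ⟨W, hW, hW', rfl⟩ := h.exists_unitary
  have hs : ((√(r * (1 - r)) : ℝ) : ℂ) * (√(r * (1 - r)) : ℝ) = r * (1 - r) := by
    rw [← Complex.ofReal_mul, Real.mul_self_sqrt (by nlinarith)]; simp
  set P : Mat2 := !![(r : ℂ), (√(r * (1 - r)) : ℝ); (√(r * (1 - r)) : ℝ), 1 - r] with hP
  have hPP : IsTraceOneProj P := by
    refine ⟨?_, ?_, ?_⟩
    · ext i j; fin_cases i <;> fin_cases j <;> simp [hP]
    · ext i j
      fin_cases i <;> fin_cases j <;> simp only [hP, Matrix.mul_apply, Fin.sum_univ_two] <;>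
        simp <;> first | linear_combination hs | ring
    · simp [hP, Matrix.trace_fin_two]
  refine ⟨W * P * Wᴴ, hPP.conj hW, ?_⟩
  calc (W * P * Wᴴ * (W * !![1, 0; 0, 0] * Wᴴ)).trace
      = (P * (Wᴴ * W) * !![1, 0; 0, 0] * (Wᴴ * W)).trace := by
        simp only [Matrix.mul_assoc]; rw [Matrix.trace_mul_comm]; simp only [Matrix.mul_assoc]
    _ = (r : ℂ) := by rw [hW]; simp [hP, Matrix.trace_fin_two]

end IsTraceOneProj

theorem ofReal_add_I_ne_zero (s : ℝ) : (s : ℂ) + Complex.I ≠ 0 := by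
  intro h
  simpa using congrArg Complex.im h

theorem one_add_I_mul_ne_zero (x : ℝ) : 1 + Complex.I * x ≠ 0 := by
  intro h
  simpa using congrArg Complex.re h

theorem omega_mul_star (s : ℝ) : omega s * star (omega s) = 1 := by
  have h1 := ofReal_add_I_ne_zero s
  have h2 : (s : ℂ) - Complex.I ≠ 0 := by
    intro h
    simpa using congrArg Complex.im h
  simp [omega]
  rw [← sub_eq_add_neg]
  field_simp

theorem omega_zero : omega 0 = -1 := by
  simp [omega]

theorem omega_add_one (s : ℝ) : omega s + 1 = 2 * s / (s + Complex.I) := by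
  have h1 := ofReal_add_I_ne_zero s
  rw [omega]; field_simp; ring

theorem omega_inv_add_one {x : ℝ} (hx : x ≠ 0) : omega x⁻¹ + 1 = 2 / (1 + Complex.I * x) := by
  have hx' : (x : ℂ) ≠ 0 := by exact_mod_cast hx
  have h1 := one_add_I_mul_ne_zero x
  have h2 := ofReal_add_I_ne_zero x⁻¹
  rw [omega_add_one, div_eq_div_iff h2 h1]
  push_cast
  field_simp

theorem omega_injective : Function.Injective omega := by
  intro s t h
  have h1 := ofReal_add_I_ne_zero s
  have h2 := ofReal_add_I_ne_zero t
  rw [omega, omega, div_eq_div_iff h1 h2] at h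
  have : 2 * Complex.I * ((s : ℂ) - t) = 0 := by linear_combination h
  simpa [sub_eq_zero] using this

theorem spec_mem_unitaryGroup {Q : Mat2} (h : IsTraceOneProj Q) {α β : ℂ} (hα : α * star α = 1)
    (hβ : β * star β = 1) : spec α β Q ∈ Matrix.unitaryGroup (Fin 2) ℂ := by
  rw [Matrix.mem_unitaryGroup_iff, Matrix.star_eq_conjTranspose, spec_conjTranspose _ _ h.herm,
    spec_mul _ _ _ _ h.idem, hα, hβ, spec_self, one_smul]

theorem coe_cayley_spec {Q : Mat2} (h : IsTraceOneProj Q) (s t : ℝ) :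
    (cayley (spec s t Q) : Mat2) = spec (omega s) (omega t) Q := by
  have h1 := ofReal_add_I_ne_zero s
  have h2 := ofReal_add_I_ne_zero t
  have hinv : (spec s t Q + Complex.I • (1 : Mat2))⁻¹ =
      spec (s + Complex.I)⁻¹ (t + Complex.I)⁻¹ Q := by
    apply Matrix.inv_eq_right_inv
    have : spec s t Q + Complex.I • (1 : Mat2) = spec (s + Complex.I) (t + Complex.I) Q := by
      simp only [spec]; module
    rw [this, spec_mul _ _ _ _ h.idem, mul_inv_cancel₀ h1, mul_inv_cancel₀ h2, spec_self, one_smul]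
  have hc : cayleyMat (spec s t Q) = spec (omega s) (omega t) Q := by
    rw [cayleyMat, hinv, ← spec_self Complex.I Q, spec_sub, spec_mul _ _ _ _ h.idem]
    simp only [omega, div_eq_mul_inv]
  have hm : cayleyMat (spec s t Q) ∈ Matrix.unitaryGroup (Fin 2) ℂ := by
    rw [hc]; exact spec_mem_unitaryGroup h (omega_mul_star s) (omega_mul_star t)
  rw [cayley, dif_pos hm]
  exact hc

/-- A unitary matrix coherent with two distinct unimodular scalar matrices is determined by a
rank one projection. -/
theorem exists_eq_spec_of_det_eq_zero {V : Mat2} (hV : V ∈ Matrix.unitaryGroup (Fin 2) ℂ)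
    {a b : ℂ} (ha : a * star a = 1) (hb : b * star b = 1) (hab : a ≠ b)
    (h1 : (V - a • (1 : Mat2)).det = 0) (h2 : (V - b • (1 : Mat2)).det = 0) :
    ∃ Q, IsTraceOneProj Q ∧ V = spec a b Q := by
  have hab' : a - b ≠ 0 := sub_ne_zero.2 hab
  have ha0 : a ≠ 0 := left_ne_zero_of_mul_eq_one ha
  have hb0 : b ≠ 0 := left_ne_zero_of_mul_eq_one hb
  simp [Matrix.det_fin_two] at h1 h2
  have htr : V 0 0 + V 1 1 = a + b := by
    apply mul_left_cancel₀ hab'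
    linear_combination h2 - h1
  have hdet : V 0 0 * V 1 1 - V 0 1 * V 1 0 = a * b := by
    linear_combination h1 + a * htr
  have hch : V * V = (a + b) • V - (a * b) • (1 : Mat2) := by
    ext i j
    fin_cases i <;> fin_cases j <;> simp [Matrix.mul_apply, Fin.sum_univ_two]
    · linear_combination V 0 0 * htr - hdet
    · linear_combination V 0 1 * htr
    · linear_combination V 1 0 * htr
    · linear_combination V 1 1 * htr - hdet
  have hstar : (a * b) • Vᴴ = (a + b) • (1 : Mat2) - V := by
    have hVV : V * Vᴴ = 1 := Matrix.mem_unitaryGroup_iff.1 hV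
    have h3 : V * V * Vᴴ = V := by rw [Matrix.mul_assoc, hVV, Matrix.mul_one]
    rw [hch, sub_mul, smul_mul_assoc, smul_mul_assoc, hVV, one_mul] at h3
    exact (sub_sub_cancel _ _).symm.trans (by rw [h3])
  refine ⟨(a - b)⁻¹ • (V - b • (1 : Mat2)), ⟨?_, ?_, ?_⟩, ?_⟩
  · have hsa : star a = a⁻¹ := eq_inv_of_mul_eq_one_right ha
    have hsb : star b = b⁻¹ := eq_inv_of_mul_eq_one_right hb
    have hVH : Vᴴ = (a * b)⁻¹ • ((a + b) • (1 : Mat2) - V) := by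
      rw [← hstar, smul_smul, inv_mul_cancel₀ (mul_ne_zero ha0 hb0), one_smul]
    have hba : b - a ≠ 0 := sub_ne_zero.2 hab.symm
    have hc : a⁻¹ - b⁻¹ ≠ 0 := by
      rw [sub_ne_zero]; exact fun h => hab (inv_injective h)
    rw [conjTranspose_smul, conjTranspose_sub, conjTranspose_smul, hVH, star_inv₀, star_sub, hsa,
      hsb, conjTranspose_one, inv_smul_eq_iff₀ hc, smul_smul]
    match_scalars <;> field_simp <;> ring
  · rw [smul_mul_smul_comm, sub_mul, mul_sub, mul_sub, hch]
    simp only [smul_mul_assoc, mul_smul_comm, one_mul, mul_one]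
    match_scalars <;> field_simp <;> ring
  · simp [Matrix.trace_fin_two]
    field_simp
    linear_combination htr
  · rw [spec]
    match_scalars <;> field_simp <;> ring

/-- A unitary matrix coherent with two points of the line `{spec γ b Q}` lies on that line. -/
theorem exists_eq_spec_of_coherent_line {V Q : Mat2} (hV : V ∈ Matrix.unitaryGroup (Fin 2) ℂ)
    (hQ : IsTraceOneProj Q) {a b c : ℂ} (hb : b * star b = 1) (hac : a ≠ c)
    (h1 : (V - spec a b Q).det = 0) (h2 : (V - spec c b Q).det = 0) :
    ∃ γ : ℂ, γ * star γ = 1 ∧ V = spec γ b Q := by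
  obtain ⟨W, hW, hW', hQW⟩ := hQ.exists_unitary
  have hspec : ∀ α β : ℂ, spec α β Q = W * !![α, 0; 0, β] * Wᴴ := by
    intro α β
    have : (!![α, 0; 0, β] : Mat2) = spec α β !![1, 0; 0, 0] := by
      ext i j; fin_cases i <;> fin_cases j <;> simp [spec]
    rw [this, spec, spec, ← hQW]
    simp only [mul_add, add_mul, mul_sub, sub_mul, mul_smul_comm, smul_mul_assoc, mul_one, hW']
  set X : Mat2 := Wᴴ * V * W with hX
  have hVX : V = W * X * Wᴴ := by
    calc V = (W * Wᴴ) * V * (W * Wᴴ) := by rw [hW', one_mul, mul_one]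
      _ = _ := by simp only [hX, Matrix.mul_assoc]
  have hXX : X * Xᴴ = 1 := by
    have hVV : V * Vᴴ = 1 := Matrix.mem_unitaryGroup_iff.1 hV
    calc X * Xᴴ = Wᴴ * (V * (W * Wᴴ) * Vᴴ) * W := by
          simp only [hX, Matrix.mul_assoc, conjTranspose_mul, conjTranspose_conjTranspose]
      _ = 1 := by rw [hW', mul_one, hVV, mul_one, hW]
  have hX'X : Xᴴ * X = 1 := mul_eq_one_comm.1 hXX
  have hdet : ∀ α : ℂ, (V - spec α b Q).det = 0 →
      (X 0 0 - α) * (X 1 1 - b) = X 0 1 * X 1 0 := by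
    intro α h
    have hWd : W.det * Wᴴ.det = 1 := by rw [← det_mul, hW', det_one]
    rw [hVX, hspec, ← sub_mul, ← mul_sub, det_mul, det_mul, mul_right_comm, hWd, one_mul,
      det_fin_two] at h
    simp at h
    linear_combination h
  have hX11 : X 1 1 = b := by
    have : (a - c) * (X 1 1 - b) = 0 := by linear_combination hdet c h2 - hdet a h1
    exact sub_eq_zero.1 ((mul_eq_zero.1 this).resolve_left (sub_ne_zero.2 hac))
  have e1 := congr_fun₂ hXX 1 1
  have e2 := congr_fun₂ hX'X 1 1
  have e3 := congr_fun₂ hXX 0 0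
  simp [Matrix.mul_apply, Fin.sum_univ_two, hX11] at e1 e2 e3
  simp at hb
  have hX10 : X 1 0 = 0 := by
    have : X 1 0 * (starRingEnd ℂ) (X 1 0) = 0 := by linear_combination e1 - hb
    simpa using this
  have hX01 : X 0 1 = 0 := by
    have : X 0 1 * (starRingEnd ℂ) (X 0 1) = 0 := by linear_combination e2 - hb
    simpa using this
  refine ⟨X 0 0, by simpa [hX01] using e3, ?_⟩
  rw [hspec, hVX]
  congr 2
  ext i j; fin_cases i <;> fin_cases j <;> simp [hX01, hX10, hX11]

/-- The properties of a coherency preserver of `[0, I]` normalized at `0`, `I / 2` and `I`, written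
for matrices given by their spectral decomposition. -/
structure IsNormalizedPreserver (F : Mat2 → Mat2) : Prop where
  unitary : ∀ X, F X ∈ Matrix.unitaryGroup (Fin 2) ℂ
  det_sub : ∀ ⦃P P' : Mat2⦄, IsTraceOneProj P → IsTraceOneProj P' →
    ∀ s ∈ Set.Icc (0 : ℝ) 1, ∀ t ∈ Set.Icc (0 : ℝ) 1, ∀ s' ∈ Set.Icc (0 : ℝ) 1,
    ∀ t' ∈ Set.Icc (0 : ℝ) 1, (spec s t P - spec s' t' P').det = 0 →
      (F (spec s t P) - F (spec s' t' P')).det = 0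
  map_scalar : ∀ P : Mat2, ∀ s : ℝ, (s = 0 ∨ s = 1 / 2 ∨ s = 1) →
    F (spec s s P) = spec (omega s) (omega s) P

namespace IsNormalizedPreserver

variable {F : Mat2 → Mat2}

theorem exists_map_proj (hF : IsNormalizedPreserver F) {P : Mat2} (hP : IsTraceOneProj P) :
    ∃ Q, IsTraceOneProj Q ∧ F (spec (1 : ℝ) (0 : ℝ) P) = spec (omega 1) (omega 0) Q := by
  refine exists_eq_spec_of_det_eq_zero (hF.unitary _) (omega_mul_star _) (omega_mul_star _)
    (omega_injective.ne one_ne_zero) ?_ ?_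
  · rw [← spec_self _ P, ← hF.map_scalar P 1 (by norm_num)]
    refine hF.det_sub hP hP _ (by simp) _ (by simp) _ (by simp) _ (by simp) ?_
    rw [spec_sub, hP.det_spec]; simp
  · rw [← spec_self _ P, ← hF.map_scalar P 0 (by norm_num)]
    refine hF.det_sub hP hP _ (by simp) _ (by simp) _ (by simp) _ (by simp) ?_
    rw [spec_sub, hP.det_spec]; simp

open Classical in
/-- The map induced on rank one projections. -/
def projMap (hF : IsNormalizedPreserver F) (P : Mat2) : Mat2 :=
  if hP : IsTraceOneProj P then (hF.exists_map_proj hP).choose else P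

variable {P P' : Mat2}

theorem isTraceOneProj_projMap (hF : IsNormalizedPreserver F)
    (hP : IsTraceOneProj P) : IsTraceOneProj (hF.projMap P) := by
  rw [projMap, dif_pos hP]
  exact (hF.exists_map_proj hP).choose_spec.1

theorem map_proj (hF : IsNormalizedPreserver F) (hP : IsTraceOneProj P) :
    F (spec (1 : ℝ) (0 : ℝ) P) = spec (omega 1) (omega 0) (hF.projMap P) := by
  rw [projMap, dif_pos hP]
  exact (hF.exists_map_proj hP).choose_spec.2

theorem map_zero (hF : IsNormalizedPreserver F)
    (P Q : Mat2) : F (spec (0 : ℝ) (0 : ℝ) P) = spec (omega 0) (omega 0) Q := by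
  rw [hF.map_scalar P 0 (by norm_num), spec_self, spec_self]

theorem map_one (hF : IsNormalizedPreserver F)
    (P Q : Mat2) : F (spec (1 : ℝ) (1 : ℝ) P) = spec (omega 1) (omega 1) Q := by
  rw [hF.map_scalar P 1 (by norm_num), spec_self, spec_self]

theorem map_half (hF : IsNormalizedPreserver F) (P Q : Mat2) : F (spec (1 / 2 : ℝ) (1 / 2 : ℝ) P) =
    spec (omega (1 / 2)) (omega (1 / 2)) Q := by
  rw [hF.map_scalar P (1 / 2) (by norm_num), spec_self, spec_self]

theorem det_sub_same (hF : IsNormalizedPreserver F)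
    (hP : IsTraceOneProj P) {s t s' t' : ℝ} (hs : s ∈ Set.Icc (0 : ℝ) 1)
    (ht : t ∈ Set.Icc (0 : ℝ) 1) (hs' : s' ∈ Set.Icc (0 : ℝ) 1) (ht' : t' ∈ Set.Icc (0 : ℝ) 1)
    (h : s = s' ∨ t = t') : (F (spec s t P) - F (spec s' t' P)).det = 0 := by
  refine hF.det_sub hP hP _ hs _ ht _ hs' _ ht' ?_
  rw [spec_sub, hP.det_spec]
  rcases h with rfl | rfl <;> simp

theorem exists_map_smul (hF : IsNormalizedPreserver F)
    (hP : IsTraceOneProj P) {s : ℝ} (hs : s ∈ Set.Icc (0 : ℝ) 1) :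
    ∃ γ : ℂ, γ * star γ = 1 ∧ F (spec s (0 : ℝ) P) = spec γ (omega 0) (hF.projMap P) := by
  refine exists_eq_spec_of_coherent_line (hF.unitary _) (hF.isTraceOneProj_projMap hP)
    (omega_mul_star _) (omega_injective.ne one_ne_zero) ?_ ?_
  · rw [← hF.map_proj hP]
    exact hF.det_sub_same hP hs (by simp) (by simp) (by simp) (by simp)
  · rw [← hF.map_zero P]
    exact hF.det_sub_same hP hs (by simp) (by simp) (by simp) (by simp)

open Classical in
/-- The unimodular number by which `F (s P)` acts on the range of the projection induced
by `P`. -/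
def coeff (hF : IsNormalizedPreserver F) (P : Mat2) (s : ℝ) : ℂ :=
  if h : IsTraceOneProj P ∧ s ∈ Set.Icc (0 : ℝ) 1 then (hF.exists_map_smul h.1 h.2).choose else 0

theorem coeff_mul_star (hF : IsNormalizedPreserver F)
    (hP : IsTraceOneProj P) {s : ℝ} (hs : s ∈ Set.Icc (0 : ℝ) 1) :
    hF.coeff P s * star (hF.coeff P s) = 1 := by
  rw [coeff, dif_pos ⟨hP, hs⟩]
  exact (hF.exists_map_smul hP hs).choose_spec.1

theorem map_smul (hF : IsNormalizedPreserver F)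
    (hP : IsTraceOneProj P) {s : ℝ} (hs : s ∈ Set.Icc (0 : ℝ) 1) :
    F (spec s (0 : ℝ) P) = spec (hF.coeff P s) (omega 0) (hF.projMap P) := by
  rw [coeff, dif_pos ⟨hP, hs⟩]
  exact (hF.exists_map_smul hP hs).choose_spec.2

theorem spec_left_injective {Q : Mat2} (hQ : IsTraceOneProj Q) {α β α' β' : ℂ}
    (h : spec α β Q = spec α' β' Q) : α = α' := by
  have h1 : spec α β Q * Q = spec α' β' Q * Q := by rw [h]
  have h2 : ∀ α β : ℂ, (spec α β Q * Q).trace = α := by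
    intro α β
    simp [spec, add_mul, sub_mul, hQ.idem, hQ.trace_eq]
  rw [← h2 α β, h1, h2]

theorem coeff_zero (hF : IsNormalizedPreserver F)
    (hP : IsTraceOneProj P) : hF.coeff P 0 = omega 0 :=
  spec_left_injective (hF.isTraceOneProj_projMap hP)
    ((hF.map_smul hP (by simp)).symm.trans (hF.map_zero P _))

theorem coeff_one (hF : IsNormalizedPreserver F) (hP : IsTraceOneProj P) : hF.coeff P 1 = omega 1 :=
  spec_left_injective (hF.isTraceOneProj_projMap hP)
    ((hF.map_smul hP (by simp)).symm.trans (hF.map_proj hP))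

theorem coeff_half (hF : IsNormalizedPreserver F)
    (hP : IsTraceOneProj P) : hF.coeff P (1 / 2) = omega (1 / 2) := by
  have hQ := hF.isTraceOneProj_projMap hP
  have h := hF.det_sub_same hP (s := 1 / 2) (t := 0) (s' := 1 / 2) (t' := 1 / 2)
    (by norm_num) (by norm_num) (by norm_num) (by norm_num) (by simp)
  rw [hF.map_half P (hF.projMap P), hF.map_smul hP (by norm_num), spec_sub, hQ.det_spec,
    mul_eq_zero] at h
  refine sub_eq_zero.1 (h.resolve_right (sub_ne_zero.2 (omega_injective.ne (by norm_num))))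

theorem map_proj_add_half (hF : IsNormalizedPreserver F) (hP : IsTraceOneProj P) :
    F (spec (1 : ℝ) (1 / 2 : ℝ) P) = spec (omega 1) (omega (1 / 2)) (hF.projMap P) := by
  have hQ := hF.isTraceOneProj_projMap hP
  obtain ⟨γ, -, hγ⟩ := exists_eq_spec_of_coherent_line (V := F (spec (1 : ℝ) (1 / 2 : ℝ) P))
    (a := omega 1) (c := omega 0) (b := omega 1) (hF.unitary _) hQ.one_sub
    (omega_mul_star _) (omega_injective.ne one_ne_zero)
    (by
      rw [spec_one_sub, ← hF.map_one P]
      exact hF.det_sub_same hP (by norm_num) (by norm_num) (by norm_num) (by norm_num) (by simp))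
    (by
      rw [spec_one_sub, ← hF.map_proj hP]
      exact hF.det_sub_same hP (by norm_num) (by norm_num) (by norm_num) (by norm_num) (by simp))
  rw [spec_one_sub] at hγ
  have h := hF.det_sub_same hP (s := 1) (t := 1 / 2) (s' := 1 / 2) (t' := 1 / 2)
    (by norm_num) (by norm_num) (by norm_num) (by norm_num) (by simp)
  rw [hF.map_half P (hF.projMap P), hγ, spec_sub, hQ.det_spec, mul_eq_zero] at h
  rw [hγ, sub_eq_zero.1
    (h.resolve_left (sub_ne_zero.2 (omega_injective.ne (by norm_num))))]

theorem projMap_one_sub (hF : IsNormalizedPreserver F)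
    (hP : IsTraceOneProj P) : hF.projMap (1 - P) = 1 - hF.projMap P := by
  have hQ := hF.isTraceOneProj_projMap hP
  have hR := hF.isTraceOneProj_projMap hP.one_sub
  have h := hF.det_sub_same hP (s := 1 / 2) (t := 0) (s' := 1 / 2) (t' := 1)
    (by norm_num) (by norm_num) (by norm_num) (by norm_num) (by simp)
  rw [hF.map_smul hP (by norm_num), hF.coeff_half hP, ← spec_one_sub ((1 : ℝ) : ℂ),
    hF.map_proj_add_half hP.one_sub, hQ.det_spec_sub_spec hR] at h
  have h1 : omega 1 - omega (1 / 2) ≠ 0 := sub_ne_zero.2 (omega_injective.ne (by norm_num))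
  have h2 : omega 0 - omega (1 / 2) ≠ 0 := sub_ne_zero.2 (omega_injective.ne (by norm_num))
  have h3 : (hF.projMap P * hF.projMap (1 - P)).trace = 0 := by
    apply mul_left_cancel₀ (mul_ne_zero h1 h2)
    linear_combination -h
  have := hQ.eq_of_trace_mul_eq_one hR.one_sub (by rw [hQ.trace_mul_one_sub, h3, sub_zero])
  rw [this, sub_sub_cancel]

theorem map_spec_one_right (hF : IsNormalizedPreserver F)
    (hP : IsTraceOneProj P) {s : ℝ} (hs : s ∈ Set.Icc (0 : ℝ) 1) :
    F (spec s (1 : ℝ) P) = spec (hF.coeff P s) (omega 1) (hF.projMap P) := by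
  have hQ := hF.isTraceOneProj_projMap hP
  obtain ⟨γ, -, hγ⟩ := exists_eq_spec_of_coherent_line (V := F (spec s (1 : ℝ) P))
    (a := omega 1) (c := omega 0) (b := omega 1) (hF.unitary _) hQ
    (omega_mul_star _) (omega_injective.ne one_ne_zero)
    (by
      rw [← hF.map_one P]
      exact hF.det_sub_same hP hs (by norm_num) (by norm_num) (by norm_num) (by simp))
    (by
      rw [← spec_one_sub (omega 1), ← hF.projMap_one_sub hP, ← hF.map_proj hP.one_sub, spec_one_sub]
      exact hF.det_sub_same hP hs (by norm_num) (by norm_num) (by norm_num) (by simp))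
  have h := hF.det_sub_same hP (s := s) (t := 1) (s' := s) (t' := 0)
    hs (by norm_num) hs (by norm_num) (by simp)
  rw [hF.map_smul hP hs, hγ, spec_sub, hQ.det_spec, mul_eq_zero] at h
  rw [hγ, sub_eq_zero.1
    (h.resolve_right (sub_ne_zero.2 (omega_injective.ne (by norm_num))))]

theorem map_spec (hF : IsNormalizedPreserver F)
    (hP : IsTraceOneProj P) {s t : ℝ} (hs : s ∈ Set.Icc (0 : ℝ) 1)
    (ht : t ∈ Set.Icc (0 : ℝ) 1) :
    F (spec s t P) = spec (hF.coeff P s) (hF.coeff (1 - P) t) (hF.projMap P) := by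
  have key : ∀ {P : Mat2} {s t : ℝ}, IsTraceOneProj P → s ∈ Set.Icc (0 : ℝ) 1 →
      t ∈ Set.Icc (0 : ℝ) 1 → ∃ γ, F (spec s t P) = spec (hF.coeff P s) γ (hF.projMap P) := by
    intro P s t hP hs ht
    have hQ := hF.isTraceOneProj_projMap hP
    obtain ⟨γ, -, hγ⟩ := exists_eq_spec_of_coherent_line (V := F (spec s t P))
      (a := omega 1) (c := omega 0) (b := hF.coeff P s) (hF.unitary _) hQ.one_sub
      (hF.coeff_mul_star hP hs) (omega_injective.ne one_ne_zero)
      (by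
        rw [spec_one_sub, ← hF.map_spec_one_right hP hs]
        exact hF.det_sub_same hP hs ht hs (by norm_num) (by simp))
      (by
        rw [spec_one_sub, ← hF.map_smul hP hs]
        exact hF.det_sub_same hP hs ht hs (by norm_num) (by simp))
    exact ⟨γ, by rw [hγ, spec_one_sub]⟩
  have hQ := hF.isTraceOneProj_projMap hP
  obtain ⟨γ, hγ⟩ := key hP hs ht
  obtain ⟨δ, hδ⟩ := key hP.one_sub ht hs
  rw [spec_one_sub, hF.projMap_one_sub hP, hγ, ← spec_one_sub γ] at hδ
  rw [hγ, spec_left_injective hQ.one_sub hδ]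

/-- The relation forced by the coherency of `s P + t (1 - P)` and `u P'`. -/
theorem coeff_relation (hF : IsNormalizedPreserver F)
    (hP : IsTraceOneProj P) (hP' : IsTraceOneProj P') {s t u : ℝ}
    (hs : s ∈ Set.Icc (0 : ℝ) 1) (ht : t ∈ Set.Icc (0 : ℝ) 1) (hu : u ∈ Set.Icc (0 : ℝ) 1)
    (h : (s * t : ℂ) = u * ((P * P').trace * t + (1 - (P * P').trace) * s)) :
    (hF.coeff P s + 1) * (hF.coeff (1 - P) t + 1) = (hF.coeff P' u + 1) *
      ((hF.projMap P * hF.projMap P').trace * (hF.coeff (1 - P) t + 1) +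
        (1 - (hF.projMap P * hF.projMap P').trace) * (hF.coeff P s + 1)) := by
  have h1 := hF.det_sub hP hP' s hs t ht u hu 0 (by simp)
    (by rw [hP.det_spec_sub_spec hP']; push_cast; linear_combination h)
  rw [hF.map_spec hP hs ht, hF.map_smul hP' hu,
    (hF.isTraceOneProj_projMap hP).det_spec_sub_spec (hF.isTraceOneProj_projMap hP'),
    omega_zero] at h1
  linear_combination h1

theorem coeff_one_sub_third (hF : IsNormalizedPreserver F)
    (hP : IsTraceOneProj P) (hP' : IsTraceOneProj P')
    (h : (P * P').trace = 1 / 2) :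
    hF.coeff (1 - P) (1 / 3) = omega (1 / 3) := by
  have hthird : (1 / 3 : ℝ) ∈ Set.Icc (0 : ℝ) 1 := by norm_num
  have hhalf : (1 / 2 : ℝ) ∈ Set.Icc (0 : ℝ) 1 := by norm_num
  have h1 := hF.coeff_relation hP hP' (s := 1) (by simp) hthird hhalf
    (by rw [h]; push_cast; norm_num)
  have h2 := hF.coeff_relation hP hP'.one_sub (s := 1) (by simp) hthird hhalf
    (by rw [hP.trace_mul_one_sub, h]; push_cast; norm_num)
  rw [hF.projMap_one_sub hP', (hF.isTraceOneProj_projMap hP).trace_mul_one_sub] at h2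
  rw [hF.coeff_one hP, hF.coeff_half hP'] at h1
  rw [hF.coeff_one hP, hF.coeff_half hP'.one_sub] at h2
  generalize (hF.projMap P * hF.projMap P').trace = p at h1 h2
  have ea : omega 1 + 1 = 2 / (1 + Complex.I) := by simpa using omega_inv_add_one one_ne_zero
  have ec : omega (1 / 2) + 1 = 2 / (1 + Complex.I * 2) := by
    simpa using omega_inv_add_one two_ne_zero
  have eb : omega (1 / 3) + 1 = 2 / (1 + Complex.I * 3) := by
    simpa using omega_inv_add_one three_ne_zero
  have n1 : (1 + Complex.I) ≠ 0 := by simpa using one_add_I_mul_ne_zero 1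
  have n2 : (1 + 2 * Complex.I) ≠ 0 := by simpa [mul_comm] using one_add_I_mul_ne_zero 2
  have n3 : (1 + Complex.I * 3) ≠ 0 := by simpa using one_add_I_mul_ne_zero 3
  suffices hb : hF.coeff (1 - P) (1 / 3) + 1 = omega (1 / 3) + 1 from add_right_cancel hb
  generalize hF.coeff (1 - P) (1 / 3) + 1 = b at h1 h2 ⊢
  rw [ea, ec] at h1 h2
  rw [eb, eq_div_iff n3]
  field_simp at h1 h2
  have hsum : b * (1 + Complex.I * 2) * 2 = b * (1 + Complex.I) + 2 := by
    linear_combination h1 + h2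
  linear_combination hsum

theorem coeff_third (hF : IsNormalizedPreserver F)
    (hP : IsTraceOneProj P) : hF.coeff P (1 / 3) = omega (1 / 3) := by
  obtain ⟨P', hP', h⟩ := hP.one_sub.exists_trace_mul_eq (r := 1 / 2) (by norm_num) (by norm_num)
  have := hF.coeff_one_sub_third hP.one_sub hP'
    (by rw [Matrix.trace_mul_comm, h]; norm_num)
  rwa [sub_sub_cancel] at this

theorem coeff_inv_relation (hF : IsNormalizedPreserver F)
    (hP : IsTraceOneProj P) (hP' : IsTraceOneProj P') {x y z r r' : ℝ}
    (hx : 1 ≤ x) (hy : 1 ≤ y) (hz : 1 ≤ z) (hPP' : (P * P').trace = r)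
    (hQQ' : (hF.projMap P * hF.projMap P').trace = r') (hzxy : z = r * x + (1 - r) * y)
    (hPx : hF.coeff P x⁻¹ = omega x⁻¹) (hPy : hF.coeff (1 - P) y⁻¹ = omega y⁻¹) :
    (hF.coeff P' z⁻¹ + 1) * (1 + Complex.I * ((r' * x + (1 - r') * y : ℝ) : ℂ)) = 2 := by
  have mem : ∀ {x : ℝ}, 1 ≤ x → x⁻¹ ∈ Set.Icc (0 : ℝ) 1 := fun hx =>
    ⟨by positivity, inv_le_one_of_one_le₀ hx⟩
  have hx0 : x ≠ 0 := by positivity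
  have hy0 : y ≠ 0 := by positivity
  have hz0 : z ≠ 0 := by positivity
  have hxc : (x : ℂ) ≠ 0 := by exact_mod_cast hx0
  have hyc : (y : ℂ) ≠ 0 := by exact_mod_cast hy0
  have hzc : (z : ℂ) ≠ 0 := by exact_mod_cast hz0
  have h := hF.coeff_relation hP hP' (mem hx) (mem hy) (mem hz) (by
    rw [hPP']
    have : (z : ℂ) = r * x + (1 - r) * y := by exact_mod_cast hzxy
    push_cast
    field_simp
    linear_combination this)
  have nx := one_add_I_mul_ne_zero x
  have ny := one_add_I_mul_ne_zero y
  rw [hPx, hPy, omega_inv_add_one hx0, omega_inv_add_one hy0, hQQ'] at h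
  generalize hF.coeff P' z⁻¹ + 1 = c at h ⊢
  field_simp at h
  push_cast
  linear_combination -h

theorem coeff_inv_of_le_three (hF : IsNormalizedPreserver F) (hP : IsTraceOneProj P) {x : ℝ}
    (hx : x = 1 ∨ x = 2 ∨ x = 3) : hF.coeff P x⁻¹ = omega x⁻¹ := by
  rcases hx with rfl | rfl | rfl
  · simpa using hF.coeff_one hP
  · simpa using hF.coeff_half hP
  · simpa using hF.coeff_third hP

/-- Two projections that are coherent with the same multiple of `P'` have related images. -/
theorem trace_projMap_relation (hF : IsNormalizedPreserver F) {P₁ P₂ : Mat2}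
    (hP₁ : IsTraceOneProj P₁) (hP₂ : IsTraceOneProj P₂) (hP' : IsTraceOneProj P')
    {x₁ y₁ x₂ y₂ r₁ r₁' r₂ r₂' : ℝ}
    (hx₁ : x₁ = 1 ∨ x₁ = 2 ∨ x₁ = 3) (hy₁ : y₁ = 1 ∨ y₁ = 2 ∨ y₁ = 3)
    (hx₂ : x₂ = 1 ∨ x₂ = 2 ∨ x₂ = 3) (hy₂ : y₂ = 1 ∨ y₂ = 2 ∨ y₂ = 3)
    (h₁ : (P₁ * P').trace = r₁) (h₁' : (hF.projMap P₁ * hF.projMap P').trace = r₁')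
    (h₂ : (P₂ * P').trace = r₂) (h₂' : (hF.projMap P₂ * hF.projMap P').trace = r₂')
    (hz : 1 ≤ r₁ * x₁ + (1 - r₁) * y₁)
    (h : r₁ * x₁ + (1 - r₁) * y₁ = r₂ * x₂ + (1 - r₂) * y₂) :
    r₁' * x₁ + (1 - r₁') * y₁ = r₂' * x₂ + (1 - r₂') * y₂ := by
  have one_le : ∀ {x : ℝ}, (x = 1 ∨ x = 2 ∨ x = 3) → 1 ≤ x := by
    rintro x (rfl | rfl | rfl) <;> norm_num
  have e₁ := hF.coeff_inv_relation hP₁ hP' (one_le hx₁) (one_le hy₁) hz h₁ h₁' rfl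
    (hF.coeff_inv_of_le_three hP₁ hx₁) (hF.coeff_inv_of_le_three hP₁.one_sub hy₁)
  have e₂ := hF.coeff_inv_relation hP₂ hP' (one_le hx₂) (one_le hy₂) hz h₂ h₂' h
    (hF.coeff_inv_of_le_three hP₂ hx₂) (hF.coeff_inv_of_le_three hP₂.one_sub hy₂)
  have hc := left_ne_zero_of_mul (e₁.trans_ne two_ne_zero)
  have := mul_left_cancel₀ hc (e₁.trans e₂.symm)
  have := mul_left_cancel₀ Complex.I_ne_zero (add_left_cancel this)
  exact_mod_cast this

theorem abs_trace_projMap_sub_le (hF : IsNormalizedPreserver F) (hP' : IsTraceOneProj P') (n : ℕ) :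
    ∀ {P : Mat2} {r r' : ℝ}, IsTraceOneProj P → (P * P').trace = r →
      (hF.projMap P * hF.projMap P').trace = r' → |r' - r| ≤ (1 / 2) ^ n := by
  have hQ' := hF.isTraceOneProj_projMap hP'
  induction n with
  | zero =>
    intro P r r' hP h h'
    obtain ⟨a, ha0, ha1, ha⟩ := hP.exists_trace_mul hP'
    obtain ⟨b, hb0, hb1, hb⟩ := (hF.isTraceOneProj_projMap hP).exists_trace_mul hQ'
    have har : a = r := by exact_mod_cast ha.symm.trans h
    have hbr : b = r' := by exact_mod_cast hb.symm.trans h'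
    subst har hbr
    rw [pow_zero, abs_le]
    constructor <;> linarith
  | succ n ih =>
    intro P r r' hP h h'
    obtain ⟨a, ha0, ha1, ha⟩ := hP.exists_trace_mul hP'
    have har : a = r := by exact_mod_cast ha.symm.trans h
    subst har
    rcases le_total a (1 / 2) with har | har
    · obtain ⟨P₂, hP₂, h₂⟩ := hP'.exists_trace_mul_eq (r := 2 * a) (by linarith) (by linarith)
      obtain ⟨b, -, -, hb⟩ := (hF.isTraceOneProj_projMap hP₂).exists_trace_mul hQ'
      have hrel := hF.trace_projMap_relation hP hP₂ hP' (x₁ := 1) (y₁ := 3) (x₂ := 2) (y₂ := 3)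
        (by simp) (by simp) (by simp) (by simp) h h' h₂ hb (by linarith) (by ring)
      have := ih hP₂ h₂ hb
      rw [abs_le] at this ⊢
      rw [pow_succ]
      constructor <;> linarith
    · obtain ⟨P₂, hP₂, h₂⟩ := hP'.exists_trace_mul_eq (r := 2 * a - 1) (by linarith) (by linarith)
      obtain ⟨b, -, -, hb⟩ := (hF.isTraceOneProj_projMap hP₂).exists_trace_mul hQ'
      have hrel := hF.trace_projMap_relation hP hP₂ hP' (x₁ := 1) (y₁ := 3) (x₂ := 1) (y₂ := 2)
        (by simp) (by simp) (by simp) (by simp) h h' h₂ hb (by linarith) (by ring)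
      have := ih hP₂ h₂ hb
      rw [abs_le] at this ⊢
      rw [pow_succ]
      constructor <;> linarith

theorem trace_projMap_mul (hF : IsNormalizedPreserver F) (hP : IsTraceOneProj P)
    (hP' : IsTraceOneProj P') : (hF.projMap P * hF.projMap P').trace = (P * P').trace := by
  obtain ⟨r, -, -, hr⟩ := hP.exists_trace_mul hP'
  obtain ⟨r', -, -, hr'⟩ :=
    (hF.isTraceOneProj_projMap hP).exists_trace_mul (hF.isTraceOneProj_projMap hP')
  have hle : |r' - r| ≤ 0 :=
    ge_of_tendsto' (tendsto_pow_atTop_nhds_zero_of_lt_one (by norm_num) (by norm_num))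
      fun n => hF.abs_trace_projMap_sub_le hP' n hP hr hr'
  rw [hr, hr', sub_eq_zero.1 (abs_nonpos_iff.1 hle)]

theorem coeff_inv_eq_omega (hF : IsNormalizedPreserver F) (hP : IsTraceOneProj P) {x : ℝ}
    (hx : 1 ≤ x) : hF.coeff P x⁻¹ = omega x⁻¹ := by
  suffices h : (hF.coeff P x⁻¹ + 1) * (1 + Complex.I * x) = 2 by
    rw [← eq_div_iff (one_add_I_mul_ne_zero x), ← omega_inv_add_one (by positivity)] at h
    exact add_right_cancel h
  rcases le_total x 2 with hx2 | hx2
  · obtain ⟨P', hP', h⟩ := hP.exists_trace_mul_eq (r := 2 - x) (by linarith) (by linarith)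
    have := hF.coeff_inv_relation hP' hP (x := 1) (y := 2) le_rfl one_le_two hx h
      ((hF.trace_projMap_mul hP' hP).trans h) (by ring) (hF.coeff_inv_of_le_three hP' (by simp))
      (hF.coeff_inv_of_le_three hP'.one_sub (by simp))
    rwa [show (2 - x) * 1 + (1 - (2 - x)) * 2 = x by ring] at this
  · have hx0 : 0 < x - 1 := by linarith
    obtain ⟨P', hP', h⟩ := hP.one_sub.exists_trace_mul_eq (r := (x - 2) / (x - 1))
      (div_nonneg (by linarith) (by linarith)) ((div_le_one hx0).2 (by linarith))
    rw [trace_mul_comm] at h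
    have hxc : (x : ℂ) ≠ 0 := by exact_mod_cast (by positivity : x ≠ 0)
    have hxc1 : (x : ℂ) - 1 ≠ 0 := by exact_mod_cast hx0.ne'
    have hrel := hF.coeff_relation hP.one_sub hP' (s := 1) (t := x⁻¹) (u := 2⁻¹) (by simp)
      ⟨by positivity, inv_le_one_of_one_le₀ hx⟩ (by norm_num)
      (by rw [h]; push_cast; field_simp; ring)
    have h2 : omega 2⁻¹ + 1 = 2 / (1 + Complex.I * 2) := by
      simpa using omega_inv_add_one two_ne_zero
    have h1 : omega 1 + 1 = 2 / (1 + Complex.I) := by simpa using omega_inv_add_one one_ne_zero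
    have n1 : (1 + Complex.I) ≠ 0 := by simpa using one_add_I_mul_ne_zero 1
    have n2 : (1 + 2 * Complex.I) ≠ 0 := by simpa [mul_comm] using one_add_I_mul_ne_zero 2
    rw [sub_sub_cancel, hF.coeff_one hP.one_sub, hF.coeff_inv_of_le_three hP' (by simp),
      hF.trace_projMap_mul hP.one_sub hP', h, h1, h2] at hrel
    generalize hF.coeff P x⁻¹ + 1 = b at hrel ⊢
    push_cast at hrel
    field_simp at hrel
    linear_combination hrel

theorem coeff_eq_omega (hF : IsNormalizedPreserver F) (hP : IsTraceOneProj P) {s : ℝ}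
    (hs : s ∈ Set.Icc (0 : ℝ) 1) : hF.coeff P s = omega s := by
  rcases hs.1.eq_or_lt with rfl | hs0
  · exact hF.coeff_zero hP
  · simpa using hF.coeff_inv_eq_omega hP ((one_le_inv₀ hs0).2 hs.2)

theorem map_spec_eq (hF : IsNormalizedPreserver F) (hP : IsTraceOneProj P) {s t : ℝ}
    (hs : s ∈ Set.Icc (0 : ℝ) 1) (ht : t ∈ Set.Icc (0 : ℝ) 1) :
    F (spec s t P) = spec (omega s) (omega t) (hF.projMap P) := by
  rw [hF.map_spec hP hs ht, hF.coeff_eq_omega hP hs, hF.coeff_eq_omega hP.one_sub ht]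

end IsNormalizedPreserver

theorem isTraceOneProj_diag : IsTraceOneProj !![1, 0; 0, 0] where
  herm := by ext i j; fin_cases i <;> fin_cases j <;> simp
  idem := by
    ext i j
    fin_cases i <;> fin_cases j <;> simp [Matrix.mul_apply, Fin.sum_univ_two]
  trace_eq := by simp [Matrix.trace_fin_two]

theorem isTraceOneProj_phase {z : ℂ} (hz : z * star z = 1) :
    IsTraceOneProj !![1 / 2, z / 2; star z / 2, 1 / 2] where
  herm := by ext i j; fin_cases i <;> fin_cases j <;> simp
  idem := by
    simp at hz
    ext i j
    fin_cases i <;> fin_cases j <;> simp <;> first | linear_combination (1 / 4) * hz | ring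
  trace_eq := by simp [Matrix.trace_fin_two]; norm_num

/-- A trace-preserving map of rank one projections fixing the projections on `(1, 0)` and `(1, 1)`
is the identity or the transposition. -/
theorem eq_self_or_eq_transpose {ψ : Mat2 → Mat2}
    (hψ : ∀ P, IsTraceOneProj P → IsTraceOneProj (ψ P))
    (htr : ∀ P P', IsTraceOneProj P → IsTraceOneProj P' →
      (ψ P * ψ P').trace = (P * P').trace)
    (h₁ : ψ !![1, 0; 0, 0] = !![1, 0; 0, 0])
    (h₂ : ψ !![1 / 2, 1 / 2; 1 / 2, 1 / 2] = !![1 / 2, 1 / 2; 1 / 2, 1 / 2]) :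
    (∀ P, IsTraceOneProj P → ψ P = P) ∨ (∀ P, IsTraceOneProj P → ψ P = Pᵀ) := by
  have hone : IsTraceOneProj !![1 / 2, 1 / 2; 1 / 2, 1 / 2] := by
    simpa using isTraceOneProj_phase (z := 1) (by simp)
  have hI : IsTraceOneProj !![1 / 2, -Complex.I / 2; Complex.I / 2, 1 / 2] := by
    simpa using isTraceOneProj_phase (z := -Complex.I) (by simp)
  obtain ⟨a, b, hab, hb⟩ := (hψ _ hI).exists_entries
  have e₁ := htr _ _ hI isTraceOneProj_diag
  have e₂ := htr _ _ hI hone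
  rw [h₁, hab] at e₁
  rw [h₂, hab] at e₂
  simp [Matrix.trace_fin_two] at e₁ e₂
  have ha : a = 1 / 2 := by
    have := congrArg Complex.re e₁
    simpa using this
  have hre : b.re = 0 := by
    have := congrArg Complex.re e₂
    simp at this
    linarith
  have him : b.im = -1 / 2 ∨ b.im = 1 / 2 := by
    have := congrArg Complex.re hb
    simp [hre, ha] at this
    have h4 : (b.im - -1 / 2) * (b.im - 1 / 2) = 0 := by linarith
    simpa [sub_eq_zero] using mul_eq_zero.1 h4
  have key : ∀ P, IsTraceOneProj P → ∀ σ : ℝ, (σ = 1 ∨ σ = -1) → b = -(σ * Complex.I) / 2 →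
      ∃ (p : ℝ) (q : ℂ), P = !![(p : ℂ), q; star q, 1 - p] ∧
        ψ P = !![(p : ℂ), ⟨q.re, σ * q.im⟩; star ⟨q.re, σ * q.im⟩, 1 - p] := by
    intro P hP σ hσ hbσ
    obtain ⟨p, q, rfl, hq⟩ := hP.exists_entries
    refine ⟨p, q, rfl, ?_⟩
    have f₁ := htr _ _ hP isTraceOneProj_diag
    have f₂ := htr _ _ hP hone
    have f₃ := htr _ _ hP hI
    rw [h₁] at f₁
    rw [h₂] at f₂
    rw [hab, ha, hbσ] at f₃
    obtain ⟨c, d, hcd, -⟩ := (hψ _ hP).exists_entries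
    rw [hcd] at f₁ f₂ f₃ ⊢
    simp [Matrix.trace_fin_two] at f₁ f₂ f₃
    subst f₁
    have hre : d.re = q.re := by
      have := congrArg Complex.re f₂
      simp at this
      linarith
    have him : d.im = σ * q.im := by
      have := congrArg Complex.re f₃
      simp at this
      rcases hσ with rfl | rfl <;> linarith
    have hd : d = ⟨q.re, σ * q.im⟩ := Complex.ext hre him
    rw [hd]
  rcases him with him | him
  · left
    intro P hP
    obtain ⟨p, q, rfl, h⟩ := key P hP 1 (by simp)
      (Complex.ext (by simp [hre]) (by simp [him]))
    simpa using h
  · right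
    intro P hP
    obtain ⟨p, q, rfl, h⟩ := key P hP (-1) (by simp)
      (Complex.ext (by simp [hre]) (by simp [him]))
    rw [h]
    ext i j
    fin_cases i <;> fin_cases j <;> simp <;> apply Complex.ext <;> simp

/-- Wigner's theorem for rank one projections in dimension two. -/
theorem exists_unitary_of_trace_preserving {ψ : Mat2 → Mat2}
    (hψ : ∀ P, IsTraceOneProj P → IsTraceOneProj (ψ P))
    (htr : ∀ P P', IsTraceOneProj P → IsTraceOneProj P' →
      (ψ P * ψ P').trace = (P * P').trace) :
    ∃ U : Mat2, Uᴴ * U = 1 ∧ U * Uᴴ = 1 ∧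
      ((∀ P, IsTraceOneProj P → ψ P = U * P * Uᴴ) ∨
       (∀ P, IsTraceOneProj P → ψ P = U * Pᵀ * Uᴴ)) := by
  have hone : IsTraceOneProj !![1 / 2, 1 / 2; 1 / 2, 1 / 2] := by
    simpa using isTraceOneProj_phase (z := 1) (by simp)
  obtain ⟨W, hW, hW', hWe⟩ := (hψ _ isTraceOneProj_diag).exists_unitary
  have cancel : ∀ {U : Mat2}, Uᴴ * U = 1 → ∀ X : Mat2, Uᴴ * (U * X * Uᴴ) * U = X := by
    intro U hU X
    calc Uᴴ * (U * X * Uᴴ) * U = (Uᴴ * U) * X * (Uᴴ * U) := by simp only [Matrix.mul_assoc]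
      _ = X := by rw [hU, one_mul, mul_one]
  have hR := (hψ _ hone).conj (W := Wᴴ) (by simpa using hW')
  obtain ⟨a, b, hab, hb⟩ := hR.exists_entries
  rw [conjTranspose_conjTranspose] at hab
  have hψone : ψ !![1 / 2, 1 / 2; 1 / 2, 1 / 2] = W * !![(a : ℂ), b; star b, 1 - a] * Wᴴ := by
    rw [← hab]
    simpa using (cancel (U := Wᴴ) (by simpa using hW') _).symm
  have ha : (a : ℂ) = 1 / 2 := by
    have := htr _ _ hone isTraceOneProj_diag
    rw [← hWe, hψone] at this
    have h2 : (W * !![(a : ℂ), b; star b, 1 - a] * Wᴴ * (W * !![1, 0; 0, 0] * Wᴴ)).trace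
        = (!![(a : ℂ), b; star b, 1 - a] * (Wᴴ * W) * !![1, 0; 0, 0] * (Wᴴ * W)).trace := by
      simp only [Matrix.mul_assoc]; rw [Matrix.trace_mul_comm]; simp only [Matrix.mul_assoc]
    rw [h2, hW] at this
    simpa [Matrix.trace_fin_two] using this
  have hz : (2 * b) * star (2 * b) = 1 := by
    rw [ha] at hb
    simp at hb ⊢
    linear_combination 4 * hb
  set D : Mat2 := !![1, 0; 0, star (2 * b)] with hD
  have hDD : Dᴴ * D = 1 := by
    simp at hz
    ext i j
    fin_cases i <;> fin_cases j <;>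
      simp [hD, Matrix.mul_apply, Fin.sum_univ_two, Complex.conj_ofNat]
    linear_combination hz
  have hDD' : D * Dᴴ = 1 := mul_eq_one_comm.1 hDD
  have hU : (W * D)ᴴ * (W * D) = 1 := by
    calc (W * D)ᴴ * (W * D) = Dᴴ * (Wᴴ * W) * D := by
          simp only [conjTranspose_mul, Matrix.mul_assoc]
      _ = 1 := by rw [hW, mul_one, hDD]
  have hU' : (W * D) * (W * D)ᴴ = 1 := mul_eq_one_comm.1 hU
  set U : Mat2 := W * D with hUdef
  have hfix : ∀ {X Y : Mat2}, ψ X = W * Y * Wᴴ → D * X * Dᴴ = Y → Uᴴ * ψ X * U = X := by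
    intro X Y h hXY
    have : ψ X = U * X * Uᴴ := by
      rw [h, ← hXY, hUdef, conjTranspose_mul]
      simp only [Matrix.mul_assoc]
    rw [this, cancel hU]
  have hcases := eq_self_or_eq_transpose (ψ := fun P => Uᴴ * ψ P * U)
    (fun P hP => by simpa using (hψ P hP).conj (W := Uᴴ) (by simpa using hU'))
    (fun P P' hP hP' => by
      rw [← htr P P' hP hP']
      calc (Uᴴ * ψ P * U * (Uᴴ * ψ P' * U)).trace
          = ((U * Uᴴ) * ψ P * (U * Uᴴ) * ψ P').trace := by
            rw [← Matrix.mul_assoc, Matrix.trace_mul_comm]; simp only [Matrix.mul_assoc]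
        _ = _ := by rw [hU', one_mul, mul_one])
    (hfix hWe.symm (by
      ext i j
      fin_cases i <;> fin_cases j <;> simp [hD, Matrix.mul_apply, Fin.sum_univ_two]))
    (hfix hψone (by
      simp at hz
      ext i j
      fin_cases i <;> fin_cases j <;>
        simp [hD, ha, Matrix.mul_apply, Fin.sum_univ_two, Complex.conj_ofNat]
      all_goals first | linear_combination (1 / 2) * hz | ring))
  have hback : ∀ {X Y : Mat2}, Uᴴ * X * U = Y → X = U * Y * Uᴴ := by
    rintro X Y rfl
    simpa using (cancel (U := Uᴴ) (by simpa using hU') X).symm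
  exact ⟨U, hU, hU', hcases.imp (fun h P hP => hback (h P hP)) fun h P hP => hback (h P hP)⟩

theorem IsTraceOneProj.posSemidef {P : Mat2} (hP : IsTraceOneProj P) : P.PosSemidef := by
  have := Matrix.posSemidef_conjTranspose_mul_self P
  rwa [hP.herm, hP.idem] at this

theorem posSemidef_spec {P : Mat2} (hP : IsTraceOneProj P) {s t : ℝ} (hs : 0 ≤ s) (ht : 0 ≤ t) :
    (spec s t P).PosSemidef :=
  (hP.posSemidef.smul (by exact_mod_cast hs)).add
    (hP.one_sub.posSemidef.smul (by exact_mod_cast ht))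

theorem spec_mem_matIcc {P : Mat2} (hP : IsTraceOneProj P) {s t : ℝ} (hs : s ∈ Set.Icc (0 : ℝ) 1)
    (ht : t ∈ Set.Icc (0 : ℝ) 1) : spec s t P ∈ matIcc 0 1 := by
  refine ⟨by simpa using posSemidef_spec hP hs.1 ht.1, ?_⟩
  have : 1 - spec s t P = spec (1 - s : ℝ) (1 - t : ℝ) P := by
    rw [← one_smul ℂ (1 : Mat2), ← spec_self 1 P, spec_sub]
    push_cast
    rfl
  rw [this]
  exact posSemidef_spec hP (sub_nonneg.2 hs.2) (sub_nonneg.2 ht.2)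

/-- Spectral decomposition of the elements of `[0, I]`. -/
theorem exists_eq_spec_of_mem_matIcc {X : Mat2} (hX : X ∈ matIcc 0 1) :
    ∃ P, IsTraceOneProj P ∧ ∃ s ∈ Set.Icc (0 : ℝ) 1, ∃ t ∈ Set.Icc (0 : ℝ) 1, X = spec s t P := by
  have hX0 : X.PosSemidef := by simpa using hX.1
  have hH := hX0.isHermitian
  set W : Mat2 := (hH.eigenvectorUnitary : Mat2) with hWdef
  have hW' : W * Wᴴ = 1 := Matrix.mem_unitaryGroup_iff.1 hH.eigenvectorUnitary.2
  have hW : Wᴴ * W = 1 := mul_eq_one_comm.1 hW'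
  set s := hH.eigenvalues 0 with hs
  set t := hH.eigenvalues 1 with ht
  have hXW : X = W * !![(s : ℂ), 0; 0, t] * Wᴴ := by
    have hdiag : (!![(s : ℂ), 0; 0, t] : Mat2) =
        diagonal (RCLike.ofReal ∘ hH.eigenvalues : Fin 2 → ℂ) := by
      ext i j; fin_cases i <;> fin_cases j <;> simp [hs, ht]
    have h := hH.spectral_theorem
    rw [Unitary.conjStarAlgAut_apply] at h
    rw [hdiag]
    exact h
  have hspec : X = spec s t (W * !![1, 0; 0, 0] * Wᴴ) := by
    have : (!![(s : ℂ), 0; 0, t] : Mat2) = spec s t !![1, 0; 0, 0] := by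
      ext i j; fin_cases i <;> fin_cases j <;> simp [spec]
    rw [hXW, this, spec, spec]
    simp only [mul_add, add_mul, mul_sub, sub_mul, mul_smul_comm, smul_mul_assoc, mul_one, hW']
  have h1 : (!![(1 : ℂ) - s, 0; 0, 1 - t] : Mat2).PosSemidef := by
    have h := hX.2.conjTranspose_mul_mul_same W
    convert h using 1
    have : (!![(1 : ℂ) - s, 0; 0, 1 - t] : Mat2) = 1 - !![(s : ℂ), 0; 0, t] := by
      ext i j; fin_cases i <;> fin_cases j <;> simp
    have h2 : Wᴴ * X * W = (Wᴴ * W) * !![(s : ℂ), 0; 0, t] * (Wᴴ * W) := by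
      rw [hXW]; simp only [Matrix.mul_assoc]
    rw [mul_sub, sub_mul, mul_one, hW, h2, hW, one_mul, mul_one, this]
  have hs1 : s ≤ 1 := by
    have := h1.diag_nonneg (i := 0)
    simp at this
    exact_mod_cast this
  have ht1 : t ≤ 1 := by
    have := h1.diag_nonneg (i := 1)
    simp at this
    exact_mod_cast this
  exact ⟨_, isTraceOneProj_diag.conj hW, s, ⟨hX0.eigenvalues_nonneg 0, hs1⟩, t,
    ⟨hX0.eigenvalues_nonneg 1, ht1⟩, hspec⟩

theorem conj_spec {U : Mat2} (hU : U * Uᴴ = 1) (α β : ℂ) (P : Mat2) :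
    U * spec α β P * Uᴴ = spec α β (U * P * Uᴴ) := by
  simp only [spec, mul_add, add_mul, mul_sub, sub_mul, mul_smul_comm, smul_mul_assoc, mul_one, hU]

theorem transpose_spec (α β : ℂ) (P : Mat2) : (spec α β P)ᵀ = spec α β Pᵀ := by
  simp [spec]

theorem isNormalizedPreserver_coe {φ : Mat2 → U2}
    (hφ : ∀ X ∈ matIcc 0 1, ∀ Y ∈ matIcc 0 1, Coherent X Y → CoherentU (φ X) (φ Y))
    (h0 : φ 0 = cayley 0)
    (hhalf : φ ((1 / 2 : ℂ) • (1 : Mat2)) = cayley ((1 / 2 : ℂ) • (1 : Mat2)))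
    (h1 : φ 1 = cayley 1) : IsNormalizedPreserver fun X => (φ X : Mat2) where
  unitary X := (φ X).2
  det_sub P P' hP hP' s hs t ht s' hs' t' ht' h :=
    (rank_le_one_iff_det_eq_zero _).1 (hφ _ (spec_mem_matIcc hP hs ht) _
      (spec_mem_matIcc hP' hs' ht') ((rank_le_one_iff_det_eq_zero _).2 h))
  map_scalar P s hs := by
    have h : φ (spec s s P) = cayley (spec s s P) := by
      rw [spec_self]
      rcases hs with rfl | rfl | rfl
      · simpa using h0
      · simpa using hhalf
      · simpa using h1
    rw [h, spec_self, ← spec_self _ !![1, 0; 0, 0], coe_cayley_spec isTraceOneProj_diag, spec_self,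
      spec_self]

/-- A coherency preserver of `[0, I]` fixing `𝔠(0)`, `𝔠((1/2)I)`, `𝔠(I)` is a unitary
(or transpose-unitary) conjugation. -/
theorem coherency_preserver_fixing_three_points
    (φ : Mat2 → U2)
    (hφ : ∀ X ∈ matIcc 0 1, ∀ Y ∈ matIcc 0 1, Coherent X Y → CoherentU (φ X) (φ Y))
    (h0 : φ 0 = cayley 0)
    (hhalf : φ ((1 / 2 : ℂ) • (1 : Mat2)) = cayley ((1 / 2 : ℂ) • (1 : Mat2)))
    (h1 : φ 1 = cayley 1) :
    ∃ U : Mat2, U ∈ Matrix.unitaryGroup (Fin 2) ℂ ∧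
      ((∀ X ∈ matIcc 0 1, φ X = cayley (U * X * Uᴴ)) ∨
       (∀ X ∈ matIcc 0 1, φ X = cayley (U * Xᵀ * Uᴴ))) := by
  have hF := isNormalizedPreserver_coe hφ h0 hhalf h1
  obtain ⟨U, hU, hU', hcases⟩ := exists_unitary_of_trace_preserving (ψ := hF.projMap)
    (fun P hP => hF.isTraceOneProj_projMap hP) (fun P P' hP hP' => hF.trace_projMap_mul hP hP')
  refine ⟨U, Matrix.mem_unitaryGroup_iff.2 hU', hcases.imp ?_ ?_⟩ <;> intro h X hX <;>
    obtain ⟨P, hP, s, hs, t, ht, rfl⟩ := exists_eq_spec_of_mem_matIcc hX <;>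
    apply Subtype.ext <;> rw [hF.map_spec_eq hP hs ht]
  · rw [conj_spec hU', ← h P hP, coe_cayley_spec (hF.isTraceOneProj_projMap hP)]
  · rw [transpose_spec, conj_spec hU', ← h P hP, coe_cayley_spec (hF.isTraceOneProj_projMap hP)]
end
end
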